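/- (Minkowski's analytic conjecture) For every real p with p > 1 and p ≠ 2, and every σ with 1 < σ < σ_p, one has Δ(p,σ) > min(Δ(p,1), Δ(p,σ_p)). -/

import Mathlib

/-- `σ_p = (2^p - 1)^{1/p}`. -/
noncomputable def sigmaP (p : ℝ) : ℝ := (2 ^ p - 1) ^ (1 / p)

/-- `A = A(p,σ,τ) = (1 + τ^p)^{-1/p} - (1 + σ^p)^{-1/p}`. -/
noncomputable def Acoef (p σ τ : ℝ) : ℝ := (1 + τ ^ p) ^ (-1 / p) - (1 + σ ^ p) ^ (-1 / p)

/-- `B = B(p,σ,τ) = σ (1 + σ^p)^{-1/p} + τ (1 + τ^p)^{-1/p}`. -/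
noncomputable def Bcoef (p σ τ : ℝ) : ℝ :=
  σ * (1 + σ ^ p) ^ (-1 / p) + τ * (1 + τ ^ p) ^ (-1 / p)

/-- Given the branch `T : σ ↦ τ(p,σ)`, the Minkowski–Cohn function
`Δ(p,σ) = (τ(p,σ) + σ)(1 + τ(p,σ)^p)^{-1/p}(1 + σ^p)^{-1/p}`. -/
noncomputable def DeltaFun (p : ℝ) (T : ℝ → ℝ) (σ : ℝ) : ℝ :=
  (T σ + σ) * (1 + T σ ^ p) ^ (-1 / p) * (1 + σ ^ p) ^ (-1 / p)

namespace MinkowskiCohn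

open Set Filter Topology

/-- The even part `((1 + x) ^ p + (1 - x) ^ p) / 2` of the binomial power. -/
noncomputable def evenPow (p x : ℝ) : ℝ := ((1 + x) ^ p + (1 - x) ^ p) / 2

/-- The odd part `((1 + x) ^ p - (1 - x) ^ p) / 2` of the binomial power. -/
noncomputable def oddPow (p x : ℝ) : ℝ := ((1 + x) ^ p - (1 - x) ^ p) / 2

/-- The curve on which the Minkowski–Cohn function lives, in the coordinates
`a = (σ - τ) / (σ + τ)`, `b = (ω - σ) / (ω + σ)`, `T = (σ ^ p - 1) / (σ ^ p + 1)`,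
where `ω = B / A`. -/
structure IsAdmissible (p a b T : ℝ) : Prop where
  b_nonneg : 0 ≤ b
  b_le_a : b ≤ a
  a_le_one : a ≤ 1
  T_nonneg : 0 ≤ T
  T_le : T ≤ 1 - 2 ^ (1 - p)
  eq_a : evenPow p a - T * oddPow p a = (a + b) ^ p
  eq_b : evenPow p b + T * oddPow p b = (a + b) ^ p

/-- The part of the curve strictly between its two end points. -/
structure IsInterior (p a b T : ℝ) : Prop where
  b_pos : 0 < b
  b_lt_a : b < a
  a_lt_one : a < 1
  T_pos : 0 < T
  T_lt : T < 1 - 2 ^ (1 - p)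
  eq_a : evenPow p a - T * oddPow p a = (a + b) ^ p
  eq_b : evenPow p b + T * oddPow p b = (a + b) ^ p

/-- The logarithm of `Δ ^ p`, up to an additive constant depending on `p` only. -/
noncomputable def energy (p a b T : ℝ) : ℝ := Real.log (1 - T ^ 2) - p * Real.log (a + b)

/-- The numerator of the derivative of `energy` along the curve. -/
noncomputable def slopeNum (p a b T : ℝ) : ℝ :=
  (a - T) * (evenPow (p - 1) a * oddPow (p - 1) b)
    - (b + T) * (oddPow (p - 1) a * evenPow (p - 1) b)
    + T * (a + b) * (evenPow (p - 1) a * evenPow (p - 1) b)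

/-- The positive factor in the denominator of the derivative of `energy` along the curve. -/
noncomputable def slopeDen (p a b : ℝ) : ℝ :=
  oddPow (p - 1) a * evenPow (p - 1) b + evenPow (p - 1) a * oddPow (p - 1) b

theorem IsInterior.isAdmissible {p a b T : ℝ} (h : IsInterior p a b T) : IsAdmissible p a b T :=
  ⟨h.b_pos.le, h.b_lt_a.le, h.a_lt_one.le, h.T_pos.le, h.T_lt.le, h.eq_a, h.eq_b⟩

theorem rpow_eq_mul_rpow_sub_one {x : ℝ} (hx : 0 < x) (p : ℝ) : x ^ p = x * x ^ (p - 1) := by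
  rw [Real.rpow_sub_one hx.ne']; field_simp

theorem evenPow_eq {x : ℝ} (h0 : -1 < x) (h1 : x < 1) (p : ℝ) :
    evenPow p x = evenPow (p - 1) x + x * oddPow (p - 1) x := by
  unfold evenPow oddPow
  rw [rpow_eq_mul_rpow_sub_one (by linarith : 0 < 1 + x) p,
    rpow_eq_mul_rpow_sub_one (by linarith : 0 < 1 - x) p]
  ring

theorem oddPow_eq {x : ℝ} (h0 : -1 < x) (h1 : x < 1) (p : ℝ) :
    oddPow p x = oddPow (p - 1) x + x * evenPow (p - 1) x := by
  unfold evenPow oddPow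
  rw [rpow_eq_mul_rpow_sub_one (by linarith : 0 < 1 + x) p,
    rpow_eq_mul_rpow_sub_one (by linarith : 0 < 1 - x) p]
  ring

theorem hasStrictDerivAt_one_add_rpow {x : ℝ} (h0 : -1 < x) (p : ℝ) :
    HasStrictDerivAt (fun x : ℝ => (1 + x) ^ p) (p * (1 + x) ^ (p - 1)) x := by
  have hx : 1 + x ≠ 0 := by linarith
  exact ((Real.hasStrictDerivAt_rpow_const_of_ne hx p).comp x
    ((hasStrictDerivAt_id x).const_add 1)).congr_deriv (by simp)

theorem hasStrictDerivAt_one_sub_rpow {x : ℝ} (h1 : x < 1) (p : ℝ) :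
    HasStrictDerivAt (fun x : ℝ => (1 - x) ^ p) (-(p * (1 - x) ^ (p - 1))) x := by
  have hx : 1 - x ≠ 0 := by linarith
  exact ((Real.hasStrictDerivAt_rpow_const_of_ne hx p).comp x
    ((hasStrictDerivAt_id x).const_sub 1)).congr_deriv (by simp)

theorem hasStrictDerivAt_evenPow {x : ℝ} (h0 : -1 < x) (h1 : x < 1) (p : ℝ) :
    HasStrictDerivAt (evenPow p) (p * oddPow (p - 1) x) x := by
  have := ((hasStrictDerivAt_one_add_rpow h0 p).add
    (hasStrictDerivAt_one_sub_rpow h1 p)).div_const 2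
  refine this.congr_deriv ?_
  unfold oddPow; ring

theorem hasStrictDerivAt_oddPow {x : ℝ} (h0 : -1 < x) (h1 : x < 1) (p : ℝ) :
    HasStrictDerivAt (oddPow p) (p * evenPow (p - 1) x) x := by
  have := ((hasStrictDerivAt_one_add_rpow h0 p).sub
    (hasStrictDerivAt_one_sub_rpow h1 p)).div_const 2
  refine this.congr_deriv ?_
  unfold evenPow; ring

theorem continuous_evenPow {p : ℝ} (hp : 0 ≤ p) : Continuous (evenPow p) := by
  unfold evenPow
  have := Real.continuous_rpow_const hp
  fun_prop

theorem continuous_oddPow {p : ℝ} (hp : 0 ≤ p) : Continuous (oddPow p) := by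
  unfold oddPow
  have := Real.continuous_rpow_const hp
  fun_prop

theorem oddPow_pos {p x : ℝ} (hp : 0 < p) (h0 : 0 < x) (h1 : x ≤ 1) : 0 < oddPow p x := by
  unfold oddPow
  have := Real.rpow_lt_rpow (by linarith : 0 ≤ 1 - x) (by linarith : 1 - x < 1 + x) hp
  linarith

theorem evenPow_pos {p x : ℝ} (h0 : 0 ≤ x) (h1 : x ≤ 1) : 0 < evenPow p x := by
  unfold evenPow
  have := Real.rpow_pos_of_pos (by linarith : 0 < 1 + x) p
  have := Real.rpow_nonneg (by linarith : 0 ≤ 1 - x) p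
  linarith

theorem oddPow_zero (p : ℝ) : oddPow p 0 = 0 := by simp [oddPow]

theorem evenPow_zero (p : ℝ) : evenPow p 0 = 1 := by simp [evenPow]

theorem two_rpow_one_sub_mem {p : ℝ} (hp : 1 < p) :
    0 < (2 : ℝ) ^ (1 - p) ∧ (2 : ℝ) ^ (1 - p) < 1 :=
  ⟨Real.rpow_pos_of_pos two_pos _, Real.rpow_lt_one_of_one_lt_of_neg one_lt_two (by linarith)⟩

theorem evenPow_strictMonoOn {p : ℝ} (hp : 1 < p) : StrictMonoOn (evenPow p) (Icc 0 1) := by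
  refine strictMonoOn_of_deriv_pos (convex_Icc 0 1)
    (continuous_evenPow (by linarith)).continuousOn fun x hx => ?_
  rw [interior_Icc] at hx
  rw [(hasStrictDerivAt_evenPow (by linarith [hx.1]) hx.2 p).hasDerivAt.deriv]
  exact mul_pos (by linarith) (oddPow_pos (by linarith) hx.1 hx.2.le)

end MinkowskiCohn

namespace MinkowskiCohn

open Set Filter Topology

theorem slopeNum_eq_of_critical {a b T ea oa eb ob C l μ ν g : ℝ} (hc : a + b ≠ 0)
    (hT : 1 - T ^ 2 ≠ 0)
    (hP : ea + a * oa - T * (oa + a * ea) = (a + b) * C)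
    (hQ : eb + b * ob + T * (ob + b * eb) = (a + b) * C)
    (hne : ¬(l = 0 ∧ μ = 0 ∧ ν = 0))
    (h1 : l * (oa - T * ea - C) + μ * -C + ν * -(1 / (a + b)) = 0)
    (h2 : l * -C + μ * (ob + T * eb - C) + ν * -(1 / (a + b)) = 0)
    (h3 : l * -(oa + a * ea) + μ * (ob + b * eb) + ν * (-2 * T / (1 - T ^ 2) - 2 * T * g) = 0) :
    (a - T) * (ea * ob) - (b + T) * (oa * eb) + T * (a + b) * (ea * eb)
      = 2 * T * (1 - T ^ 2) * (oa * eb + ea * ob) * g := by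
  have hdet : ∀ x : ℝ, x * l = 0 → x * μ = 0 → x * ν = 0 → x = 0 := by
    intro x h h' h''
    by_contra hx
    simp only [mul_eq_zero, hx, false_or] at h h' h''
    exact hne ⟨h, h', h''⟩
  set u := oa - T * ea with hu
  set v := ob + T * eb with hv
  set F := -2 * T / (1 - T ^ 2) - 2 * T * g with hF
  set w := 1 / (a + b) with hw
  have hwc : w * (a + b) = 1 := by rw [hw]; field_simp
  have key : F * ((u - C) * (v - C) - C * C) - w * ((oa + a * ea) * v - (ob + b * eb) * u) = 0 := by
    apply hdet
    · linear_combination (F * (v - C) + w * (ob + b * eb)) * h1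
        + (F * C - w * (ob + b * eb)) * h2 + (w * (v - C) + w * C) * h3
    · linear_combination (F * C + w * (oa + a * ea)) * h1
        + (F * (u - C) - w * (oa + a * ea)) * h2 + (w * C + w * (u - C)) * h3
    · linear_combination ((v - C) * (oa + a * ea) - C * (ob + b * eb)) * h1
        + (C * (oa + a * ea) - (u - C) * (ob + b * eb)) * h2
        + ((u - C) * (v - C) - C * C) * h3
  have key2 : F * (u * v * (a + b) - (a + b) * C * (u + v))
      - ((oa + a * ea) * v - (ob + b * eb) * u) = 0 := by
    linear_combination (a + b) * key + ((oa + a * ea) * v - (ob + b * eb) * u) * hwc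
  have key3 : u * v * (a + b) - (a + b) * C * (u + v) = -(1 - T ^ 2) * (oa * eb + ea * ob) := by
    linear_combination v * hP + u * hQ + (-v * a - u * b) * hu
  have key4 : F * (1 - T ^ 2) = -2 * T - 2 * T * g * (1 - T ^ 2) := by
    rw [hF]; field_simp
  rw [key3] at key2
  linear_combination -key2 - (oa * eb + ea * ob) * key4

/-- The first order condition for a minimum of `energy - G (T ^ 2)` along the curve. -/
theorem slopeNum_eq_of_isLocalMinOn {p a b T : ℝ} (hp : 1 < p) (h : IsInterior p a b T)
    {G : ℝ → ℝ} {g : ℝ} (hG : HasStrictDerivAt G g (T ^ 2))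
    (hmin : IsLocalMinOn (fun z : ℝ × ℝ × ℝ => energy p z.1 z.2.1 z.2.2 - G (z.2.2 ^ 2))
      {z | evenPow p z.1 - z.2.2 * oddPow p z.1 = (z.1 + z.2.1) ^ p ∧
        evenPow p z.2.1 + z.2.2 * oddPow p z.2.1 = (z.1 + z.2.1) ^ p} (a, b, T)) :
    slopeNum p a b T = 2 * T * (1 - T ^ 2) * slopeDen p a b * g := by
  have ha0 : -1 < a := by linarith [h.b_pos, h.b_lt_a]
  have hb0 : -1 < b := by linarith [h.b_pos]
  have hb1 : b < 1 := h.b_lt_a.trans h.a_lt_one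
  have hc : 0 < a + b := by linarith [h.b_pos, h.b_lt_a]
  have hT1 : T < 1 := by linarith [h.T_lt, (two_rpow_one_sub_mem hp).1]
  have hT2 : 0 < 1 - T ^ 2 := by nlinarith [h.T_pos]
  obtain ⟨da, hda, hda'⟩ : ∃ L : ℝ × ℝ × ℝ →L[ℝ] ℝ,
      HasStrictFDerivAt (fun z : ℝ × ℝ × ℝ => z.1) L (a, b, T) ∧ ∀ z, L z = z.1 :=
    ⟨_, (ContinuousLinearMap.fst ℝ ℝ (ℝ × ℝ)).hasStrictFDerivAt, fun _ => rfl⟩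
  obtain ⟨db, hdb, hdb'⟩ : ∃ L : ℝ × ℝ × ℝ →L[ℝ] ℝ,
      HasStrictFDerivAt (fun z : ℝ × ℝ × ℝ => z.2.1) L (a, b, T) ∧ ∀ z, L z = z.2.1 :=
    ⟨_, ((ContinuousLinearMap.fst ℝ ℝ ℝ).comp
      (ContinuousLinearMap.snd ℝ ℝ (ℝ × ℝ))).hasStrictFDerivAt, fun _ => rfl⟩
  obtain ⟨dT, hdT, hdT'⟩ : ∃ L : ℝ × ℝ × ℝ →L[ℝ] ℝ,
      HasStrictFDerivAt (fun z : ℝ × ℝ × ℝ => z.2.2) L (a, b, T) ∧ ∀ z, L z = z.2.2 :=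
    ⟨_, ((ContinuousLinearMap.snd ℝ ℝ ℝ).comp
      (ContinuousLinearMap.snd ℝ ℝ (ℝ × ℝ))).hasStrictFDerivAt, fun _ => rfl⟩
  have hab : HasStrictFDerivAt (fun z : ℝ × ℝ × ℝ => z.1 + z.2.1) (da + db) (a, b, T) :=
    hda.add hdb
  have hcp : HasStrictFDerivAt (fun z : ℝ × ℝ × ℝ => (z.1 + z.2.1) ^ p)
      ((p * (a + b) ^ (p - 1)) • (da + db)) (a, b, T) :=
    HasStrictDerivAt.comp_hasStrictFDerivAt (h₂ := fun x : ℝ => x ^ p) (a, b, T)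
      (Real.hasStrictDerivAt_rpow_const_of_ne hc.ne' p) hab
  have hlog : HasStrictFDerivAt (fun z : ℝ × ℝ × ℝ => Real.log (z.1 + z.2.1))
      ((a + b)⁻¹ • (da + db)) (a, b, T) :=
    HasStrictDerivAt.comp_hasStrictFDerivAt (h₂ := Real.log) (a, b, T)
      (Real.hasStrictDerivAt_log hc.ne') hab
  have hTT : HasStrictFDerivAt (fun z : ℝ × ℝ × ℝ => z.2.2 ^ 2) ((2 * T) • dT) (a, b, T) := by
    simpa using hdT.pow 2
  have hlogT : HasStrictFDerivAt (fun z : ℝ × ℝ × ℝ => Real.log (1 - z.2.2 ^ 2))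
      ((1 - T ^ 2)⁻¹ • -((2 * T) • dT)) (a, b, T) :=
    HasStrictDerivAt.comp_hasStrictFDerivAt (h₂ := Real.log) (a, b, T)
      (Real.hasStrictDerivAt_log hT2.ne') (hTT.const_sub 1)
  have hGT : HasStrictFDerivAt (fun z : ℝ × ℝ × ℝ => G (z.2.2 ^ 2)) (g • (2 * T) • dT) (a, b, T) :=
    hG.comp_hasStrictFDerivAt (a, b, T) hTT
  have hF := (hlogT.sub (hlog.const_mul p)).sub hGT
  have hea := (hasStrictDerivAt_evenPow ha0 h.a_lt_one p).comp_hasStrictFDerivAt (a, b, T) hda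
  have hoa := (hasStrictDerivAt_oddPow ha0 h.a_lt_one p).comp_hasStrictFDerivAt (a, b, T) hda
  have heb := (hasStrictDerivAt_evenPow hb0 hb1 p).comp_hasStrictFDerivAt (a, b, T) hdb
  have hob := (hasStrictDerivAt_oddPow hb0 hb1 p).comp_hasStrictFDerivAt (a, b, T) hdb
  have hP := (hea.sub (hdT.mul hoa)).sub hcp
  have hQ := (heb.add (hdT.mul hob)).sub hcp
  have hset : {z : ℝ × ℝ × ℝ | evenPow p z.1 - z.2.2 * oddPow p z.1 = (z.1 + z.2.1) ^ p ∧
        evenPow p z.2.1 + z.2.2 * oddPow p z.2.1 = (z.1 + z.2.1) ^ p}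
      = {z | (evenPow p z.1 - z.2.2 * oddPow p z.1 - (z.1 + z.2.1) ^ p,
          evenPow p z.2.1 + z.2.2 * oddPow p z.2.1 - (z.1 + z.2.1) ^ p)
        = (evenPow p a - T * oddPow p a - (a + b) ^ p,
          evenPow p b + T * oddPow p b - (a + b) ^ p)} := by
    ext z
    simp only [mem_ofPred_eq, h.eq_a, h.eq_b, sub_self, Prod.mk.injEq, sub_eq_zero]
  rw [hset] at hmin
  obtain ⟨Λ, ν, hne, hΛ⟩ := IsLocalExtrOn.exists_linear_map_of_hasStrictFDerivAt
    (f := fun z : ℝ × ℝ × ℝ => (evenPow p z.1 - z.2.2 * oddPow p z.1 - (z.1 + z.2.1) ^ p,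
          evenPow p z.2.1 + z.2.2 * oddPow p z.2.1 - (z.1 + z.2.1) ^ p))
    (Or.inl hmin) (hP.prodMk hQ) hF
  obtain ⟨l, μ, hΛe⟩ : ∃ l μ : ℝ, ∀ x y : ℝ, Λ (x, y) = x * l + y * μ := by
    refine ⟨Λ (1, 0), Λ (0, 1), fun x y => ?_⟩
    have : ((x, y) : ℝ × ℝ) = x • (1, 0) + y • (0, 1) := by simp
    rw [this, map_add, map_smul, map_smul, smul_eq_mul, smul_eq_mul]
  have e1 := hΛ (1, 0, 0)
  have e2 := hΛ (0, 1, 0)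
  have e3 := hΛ (0, 0, 1)
  simp only [ContinuousLinearMap.prod_apply, hΛe] at e1 e2 e3
  simp only [add_apply, sub_apply,
    smul_apply, neg_apply, hda', hdb', hdT', smul_eq_mul,
    Function.comp_apply]
    at e1 e2 e3
  have hpp : p ≠ 0 := by linarith
  have hP' := h.eq_a
  have hQ' := h.eq_b
  rw [evenPow_eq ha0 h.a_lt_one p, oddPow_eq ha0 h.a_lt_one p, rpow_eq_mul_rpow_sub_one hc] at hP'
  rw [evenPow_eq hb0 hb1 p, oddPow_eq hb0 hb1 p, rpow_eq_mul_rpow_sub_one hc] at hQ'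
  rw [oddPow_eq ha0 h.a_lt_one p, oddPow_eq hb0 hb1 p] at e3
  refine slopeNum_eq_of_critical (l := l) (μ := μ) (ν := ν) hc.ne' hT2.ne' hP' hQ'
    ?_ ?_ ?_ ?_
  · rintro ⟨hl, hμ, hν⟩
    apply hne
    simp only [Prod.mk_eq_zero]
    refine ⟨LinearMap.ext fun z => ?_, hν⟩
    obtain ⟨x, y⟩ := z
    rw [hΛe, hl, hμ]; simp
  · apply mul_left_cancel₀ hpp
    rw [one_div]
    linear_combination e1
  · apply mul_left_cancel₀ hpp
    rw [one_div]
    linear_combination e2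
  · rw [div_eq_mul_inv]
    linear_combination e3

end MinkowskiCohn

namespace MinkowskiCohn

open Set Filter Topology

theorem IsAdmissible.add_pos {p a b T : ℝ} (hp : 1 < p) (h : IsAdmissible p a b T) :
    0 < a + b := by
  have h1 := h.b_nonneg
  have h2 := h.b_le_a
  rcases (by linarith : 0 ≤ a + b).eq_or_lt with h0 | h0
  · exfalso
    have hb : b = 0 := by linarith
    have := h.eq_b
    rw [← h0, hb, evenPow_zero, oddPow_zero, Real.zero_rpow (by linarith)] at this
    norm_num at this
  · exact h0

theorem IsAdmissible.one_sub_sq_pos {p a b T : ℝ} (hp : 1 < p) (h : IsAdmissible p a b T) :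
    0 < 1 - T ^ 2 := by
  have := h.T_le
  have := h.T_nonneg
  nlinarith [(two_rpow_one_sub_mem hp).1]

theorem rpow_add_rpow_lt {p x y : ℝ} (hp : 1 < p) (hx : 0 < x) (hy : 0 < y) :
    x ^ p + y ^ p < (x + y) ^ p := by
  rw [rpow_eq_mul_rpow_sub_one hx p, rpow_eq_mul_rpow_sub_one hy p,
    rpow_eq_mul_rpow_sub_one (add_pos hx hy) p]
  have h1 := Real.rpow_lt_rpow hx.le (by linarith : x < x + y) (by linarith : 0 < p - 1)
  have h2 := Real.rpow_lt_rpow hy.le (by linarith : y < x + y) (by linarith : 0 < p - 1)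
  nlinarith

theorem rpow_add_sub_rpow_le {p c x y : ℝ} (hp : 1 ≤ p) (hc : 0 ≤ c) (hx : 0 ≤ x) (hxy : x ≤ y) :
    (x + c) ^ p - x ^ p ≤ (y + c) ^ p - y ^ p := by
  have hmono : MonotoneOn (fun t : ℝ => (t + c) ^ p - t ^ p) (Ici 0) := by
    have hr := Real.continuous_rpow_const (q := p) (by linarith)
    have hd : ∀ t : ℝ, HasDerivAt (fun t : ℝ => (t + c) ^ p - t ^ p)
        (p * (t + c) ^ (p - 1) - p * t ^ (p - 1)) t := by
      intro t
      have h1 := ((hasDerivAt_id t).add_const c).rpow_const (p := p) (Or.inr hp)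
      have h2 := (hasDerivAt_id t).rpow_const (p := p) (Or.inr hp)
      exact (h1.sub h2).congr_deriv (by simp)
    refine monotoneOn_of_deriv_nonneg (convex_Ici 0) (by fun_prop)
      (fun t _ => (hd t).differentiableAt.differentiableWithinAt) fun t ht => ?_
    rw [interior_Ici] at ht
    rw [(hd t).deriv]
    have := Real.rpow_le_rpow (le_of_lt ht) (by linarith : t ≤ t + c) (by linarith : 0 ≤ p - 1)
    nlinarith
  exact hmono hx (hx.trans hxy) hxy

theorem IsAdmissible.eq_one_of_T_eq {p a b T : ℝ} (hp : 1 < p) (h : IsAdmissible p a b T)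
    (hT : T = 1 - 2 ^ (1 - p)) : a = 1 := by
  by_contra ha
  have ha1 : a < 1 := lt_of_le_of_ne h.a_le_one ha
  have hc := h.add_pos hp
  have hb := h.b_nonneg
  have hba := h.b_le_a
  have h2 : (2 : ℝ) ^ (1 - p) * 2 ^ p = 2 := by
    rw [← Real.rpow_add two_pos]; norm_num
  have h2p : (0 : ℝ) < 2 ^ p := by positivity
  have hPa := h.eq_a
  have hQb := h.eq_b
  have hmul : ((2 : ℝ) * (a + b)) ^ p = 2 ^ p * (a + b) ^ p :=
    Real.mul_rpow two_pos.le hc.le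
  have e1 : (1 + a) ^ p + (2 ^ p - 1) * (1 - a) ^ p = (2 * (a + b)) ^ p := by
    rw [hmul, ← hPa, hT, evenPow, oddPow]
    linear_combination ((1 - a) ^ p - (1 + a) ^ p) / 2 * h2
  have e2 : (1 - b) ^ p + (2 ^ p - 1) * (1 + b) ^ p = (2 * (a + b)) ^ p := by
    rw [hmul, ← hQb, hT, evenPow, oddPow]
    linear_combination ((1 - b) ^ p - (1 + b) ^ p) / (-2) * h2
  have hle : 1 + a ≤ 2 * (a + b) := by
    have : (1 + a) ^ p ≤ (2 * (a + b)) ^ p := by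
      have h1 : 1 ≤ (2 : ℝ) ^ p := Real.one_le_rpow one_le_two (by linarith)
      have := Real.rpow_nonneg (by linarith : 0 ≤ 1 - a) p
      nlinarith
    exact (Real.rpow_le_rpow_iff (by linarith) (by linarith) (by linarith)).1 this
  have hsup : (a + b) ^ p + (1 - a) ^ p < (1 + b) ^ p := by
    have := rpow_add_rpow_lt hp hc (by linarith : 0 < 1 - a)
    rwa [show a + b + (1 - a) = 1 + b by ring] at this
  have hmono := rpow_add_sub_rpow_le hp.le hc.le (by linarith : 0 ≤ 1 - b)
    (by linarith : 1 - b ≤ a + b)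
  rw [show 1 - b + (a + b) = 1 + a by ring, show a + b + (a + b) = 2 * (a + b) by ring] at hmono
  have h1 : 1 < (2 : ℝ) ^ p := Real.one_lt_rpow one_lt_two (by linarith)
  nlinarith

theorem IsAdmissible.cases {p a b T : ℝ} (hp : 1 < p) (h : IsAdmissible p a b T) :
    IsInterior p a b T ∨ (a = b ∧ T = 0) ∨ (a = 1 ∧ b = 0 ∧ T = 1 - 2 ^ (1 - p)) := by
  have hc := h.add_pos hp
  have hb := h.b_nonneg
  have hba := h.b_le_a
  have ha := h.a_le_one
  have hT0 := h.T_nonneg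
  have hT1 := h.T_le
  have h2 := two_rpow_one_sub_mem hp
  have hab : a = b → T = 0 := by
    rintro rfl
    have h1 := h.eq_a.trans h.eq_b.symm
    have h3 := oddPow_pos (p := p) (by linarith) (by linarith : 0 < a) ha
    nlinarith
  have ha1 : a = 1 → b = 0 := by
    rintro rfl
    by_contra hb0
    have hb0 : 0 < b := lt_of_le_of_ne hb (Ne.symm hb0)
    have h1 := h.eq_a
    have h3 := h.eq_b
    have h4 := oddPow_pos (p := p) (by linarith) hb0 hba
    have h5 : evenPow p 1 = oddPow p 1 := by
      simp [evenPow, oddPow, Real.zero_rpow (by linarith : p ≠ 0)]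
    have h6 : (1 - T) * oddPow p b = 0 := by
      have : evenPow p b + oddPow p b = (1 + b) ^ p := by unfold evenPow oddPow; ring
      linear_combination this - h3
    nlinarith
  have hT' : a = 1 → T = 1 - 2 ^ (1 - p) := by
    intro ha'
    have h1 := h.eq_a
    rw [ha1 ha', ha', evenPow, oddPow] at h1
    norm_num [Real.zero_rpow (by linarith : p ≠ 0)] at h1
    have h4 : (2 : ℝ) ^ (1 - p) * 2 ^ p = 2 := by
      rw [← Real.rpow_add two_pos]; norm_num
    have h3 : (0 : ℝ) < 2 ^ p := by positivity
    apply mul_right_cancel₀ h3.ne'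
    linarith
  by_cases h1 : a = 1
  · exact Or.inr (Or.inr ⟨h1, ha1 h1, hT' h1⟩)
  by_cases h3 : T = 0
  · refine Or.inr (Or.inl ⟨?_, h3⟩)
    have h4 := h.eq_a.trans h.eq_b.symm
    rw [h3] at h4
    exact (evenPow_strictMonoOn hp).injOn ⟨hb.trans hba, ha⟩ ⟨hb, hba.trans ha⟩ (by linarith)
  have hb0 : b ≠ 0 := by
    rintro rfl
    have h4 := h.eq_b
    rw [evenPow_zero, oddPow_zero] at h4
    apply h1
    rw [← Real.rpow_left_inj (z := p) (by linarith) zero_le_one (by linarith), Real.one_rpow]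
    simpa using h4.symm
  exact Or.inl ⟨lt_of_le_of_ne hb hb0.symm, lt_of_le_of_ne hba fun h' => h3 (hab h'.symm),
    lt_of_le_of_ne ha h1, lt_of_le_of_ne hT0 (Ne.symm h3),
    lt_of_le_of_ne hT1 fun h' => h1 (h.eq_one_of_T_eq hp h'), h.eq_a, h.eq_b⟩

theorem isCompact_isAdmissible {p : ℝ} (hp : 1 < p) :
    IsCompact {z : ℝ × ℝ × ℝ | IsAdmissible p z.1 z.2.1 z.2.2} := by
  have hbox : IsCompact (Icc (0 : ℝ) 1 ×ˢ Icc (0 : ℝ) 1 ×ˢ Icc (0 : ℝ) 1) :=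
    isCompact_Icc.prod (isCompact_Icc.prod isCompact_Icc)
  have he := continuous_evenPow (p := p) (by linarith)
  have ho := continuous_oddPow (p := p) (by linarith)
  have hr := Real.continuous_rpow_const (q := p) (by linarith)
  have hset : {z : ℝ × ℝ × ℝ | IsAdmissible p z.1 z.2.1 z.2.2}
      = {z | 0 ≤ z.2.1} ∩ {z | z.2.1 ≤ z.1} ∩ {z | z.1 ≤ 1} ∩ {z | 0 ≤ z.2.2}
        ∩ {z | z.2.2 ≤ 1 - 2 ^ (1 - p)}
        ∩ {z | evenPow p z.1 - z.2.2 * oddPow p z.1 = (z.1 + z.2.1) ^ p}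
        ∩ {z | evenPow p z.2.1 + z.2.2 * oddPow p z.2.1 = (z.1 + z.2.1) ^ p} := by
    ext z
    constructor
    · exact fun h => ⟨⟨⟨⟨⟨⟨h.1, h.2⟩, h.3⟩, h.4⟩, h.5⟩, h.6⟩, h.7⟩
    · rintro ⟨⟨⟨⟨⟨⟨h1, h2⟩, h3⟩, h4⟩, h5⟩, h6⟩, h7⟩
      exact ⟨h1, h2, h3, h4, h5, h6, h7⟩
  refine hbox.of_isClosed_subset ?_ fun z h => ?_
  · rw [hset]
    refine IsClosed.inter (IsClosed.inter (IsClosed.inter (IsClosed.inter (IsClosed.inter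
      (IsClosed.inter ?_ ?_) ?_) ?_) ?_) ?_) ?_
    · exact isClosed_le (by fun_prop) (by fun_prop)
    · exact isClosed_le (by fun_prop) (by fun_prop)
    · exact isClosed_le (by fun_prop) (by fun_prop)
    · exact isClosed_le (by fun_prop) (by fun_prop)
    · exact isClosed_le (by fun_prop) (by fun_prop)
    · exact isClosed_eq (by fun_prop) (by fun_prop)
    · exact isClosed_eq (by fun_prop) (by fun_prop)
  · have h1 := h.b_nonneg
    have h2 := h.b_le_a
    have h3 := h.a_le_one
    have h4 := h.T_nonneg
    have h5 := h.T_le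
    have h6 := (two_rpow_one_sub_mem hp).1
    exact ⟨⟨by linarith, h3⟩, ⟨h1, by linarith⟩, ⟨h4, by linarith⟩⟩

theorem continuousOn_energy {p : ℝ} (hp : 1 < p) :
    ContinuousOn (fun z : ℝ × ℝ × ℝ => energy p z.1 z.2.1 z.2.2)
      {z : ℝ × ℝ × ℝ | IsAdmissible p z.1 z.2.1 z.2.2} := by
  unfold energy
  refine ContinuousOn.sub (ContinuousOn.log (by fun_prop) fun z h => ?_)
    (continuousOn_const.mul (ContinuousOn.log (by fun_prop) fun z h => ?_))
  · exact (IsAdmissible.one_sub_sq_pos hp h).ne'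
  · exact (IsAdmissible.add_pos hp h).ne'

theorem IsInterior.isLocalMinOn {p a b T : ℝ} (h : IsInterior p a b T) {f : ℝ × ℝ × ℝ → ℝ}
    (hf : IsMinOn f {z : ℝ × ℝ × ℝ | IsAdmissible p z.1 z.2.1 z.2.2} (a, b, T)) :
    IsLocalMinOn f {z | evenPow p z.1 - z.2.2 * oddPow p z.1 = (z.1 + z.2.1) ^ p ∧
        evenPow p z.2.1 + z.2.2 * oddPow p z.2.1 = (z.1 + z.2.1) ^ p} (a, b, T) := by
  have hopen : ∀ᶠ z : ℝ × ℝ × ℝ in 𝓝 (a, b, T),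
      0 < z.2.1 ∧ z.2.1 < z.1 ∧ z.1 < 1 ∧ 0 < z.2.2 ∧ z.2.2 < 1 - 2 ^ (1 - p) := by
    have c1 : Continuous fun z : ℝ × ℝ × ℝ => z.1 := by fun_prop
    have c2 : Continuous fun z : ℝ × ℝ × ℝ => z.2.1 := by fun_prop
    have c3 : Continuous fun z : ℝ × ℝ × ℝ => z.2.2 := by fun_prop
    have e1 : ∀ᶠ z : ℝ × ℝ × ℝ in 𝓝 (a, b, T), 0 < z.2.1 :=
      (continuous_const.tendsto _).eventually_lt (c2.tendsto _) h.b_pos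
    have e2 : ∀ᶠ z : ℝ × ℝ × ℝ in 𝓝 (a, b, T), z.2.1 < z.1 :=
      (c2.tendsto _).eventually_lt (c1.tendsto _) h.b_lt_a
    have e3 : ∀ᶠ z : ℝ × ℝ × ℝ in 𝓝 (a, b, T), z.1 < 1 :=
      (c1.tendsto _).eventually_lt (continuous_const.tendsto _) h.a_lt_one
    have e4 : ∀ᶠ z : ℝ × ℝ × ℝ in 𝓝 (a, b, T), 0 < z.2.2 :=
      (continuous_const.tendsto _).eventually_lt (c3.tendsto _) h.T_pos
    have e5 : ∀ᶠ z : ℝ × ℝ × ℝ in 𝓝 (a, b, T), z.2.2 < 1 - 2 ^ (1 - p) :=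
      (c3.tendsto _).eventually_lt (continuous_const.tendsto _) h.T_lt
    exact e1.and (e2.and (e3.and (e4.and e5)))
  have h2 := hopen.filter_mono (nhdsWithin_le_nhds (s := {z : ℝ × ℝ × ℝ |
    evenPow p z.1 - z.2.2 * oddPow p z.1 = (z.1 + z.2.1) ^ p ∧
        evenPow p z.2.1 + z.2.2 * oddPow p z.2.1 = (z.1 + z.2.1) ^ p}))
  filter_upwards [h2, self_mem_nhdsWithin] with z hz hz'
  exact isMinOn_iff.1 hf z
    ⟨hz.1.le, hz.2.1.le, hz.2.2.1.le, hz.2.2.2.1.le, hz.2.2.2.2.le, hz'.1, hz'.2⟩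

theorem IsAdmissible.diagonal_unique {p a a' : ℝ} (hp : 1 < p) (h : IsAdmissible p a a 0)
    (hyy : IsAdmissible p a' a' 0) : a = a' := by
  have key : ∀ x y : ℝ, IsAdmissible p x x 0 → IsAdmissible p y y 0 → ¬ x < y := by
    intro x y hx hy hxy
    have hx0 : 0 < x := by linarith [hx.add_pos hp]
    have hy1 := hy.a_le_one
    have e1 := hx.eq_a
    have e2 := hy.eq_a
    rw [evenPow, zero_mul, sub_zero] at e1 e2
    have hp0 : 0 < p := by linarith
    have i1 : (x * (1 + y)) ^ p < (y * (1 + x)) ^ p :=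
      Real.rpow_lt_rpow (by nlinarith) (by nlinarith) hp0
    have i2 : (x * (1 - y)) ^ p ≤ (y * (1 - x)) ^ p :=
      Real.rpow_le_rpow (by nlinarith) (by nlinarith) hp0.le
    have i3 : (x * (y + y)) ^ p = (y * (x + x)) ^ p := by congr 1; ring
    rw [Real.mul_rpow hx0.le (by linarith), Real.mul_rpow (by linarith) (by linarith)] at i1 i2 i3
    rw [← e1, ← e2] at i3
    linarith
  exact le_antisymm (not_lt.1 (key _ _ hyy h)) (not_lt.1 (key _ _ h hyy))

/-- A lower barrier for `energy`: it suffices to compare the slope of `energy` along the curve,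
as a function of `T ^ 2`, with the derivative of a function which is larger at critical points
than at both end points. -/
theorem min_lt_energy {p : ℝ} (hp : 1 < p) {G g : ℝ → ℝ}
    (hG : ∀ u, HasStrictDerivAt G (g u) u)
    (hslope : ∀ a b T, IsInterior p a b T →
      slopeNum p a b T ≠ 2 * T * (1 - T ^ 2) * slopeDen p a b * g (T ^ 2))
    (hcrit : ∀ a b T, IsInterior p a b T → slopeNum p a b T = 0 →
      G 0 < G (T ^ 2) ∧ G ((1 - 2 ^ (1 - p)) ^ 2) < G (T ^ 2))
    {a₀ : ℝ} (h₀ : IsAdmissible p a₀ a₀ 0) {a b T : ℝ} (h : IsInterior p a b T) :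
    min (energy p a₀ a₀ 0) (energy p 1 0 (1 - 2 ^ (1 - p))) < energy p a b T := by
  by_contra! hle
  have hK := isCompact_isAdmissible hp
  have hne : {z : ℝ × ℝ × ℝ | IsAdmissible p z.1 z.2.1 z.2.2}.Nonempty := ⟨(a, b, T), h.isAdmissible⟩
  have hGc : Continuous G := continuous_iff_continuousAt.2 fun u => (hG u).hasDerivAt.continuousAt
  obtain ⟨a₁, b₁, T₁, h₁, hle₁, hs₁⟩ : ∃ a₁ b₁ T₁, IsInterior p a₁ b₁ T₁ ∧
      energy p a₁ b₁ T₁ ≤ min (energy p a₀ a₀ 0) (energy p 1 0 (1 - 2 ^ (1 - p))) ∧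
      slopeNum p a₁ b₁ T₁ = 0 := by
    obtain ⟨z, hz, hmin⟩ := hK.exists_isMinOn hne (continuousOn_energy hp)
    have hcritical : ∀ x y t, IsInterior p x y t → energy p x y t ≤ energy p z.1 z.2.1 z.2.2 →
        slopeNum p x y t = 0 := by
      intro x y t hi hxy
      have := slopeNum_eq_of_isLocalMinOn hp hi (G := fun _ => 0) (hasStrictDerivAt_const _ _)
        (hi.isLocalMinOn (isMinOn_iff.2 fun w hw => by
          simpa using hxy.trans (isMinOn_iff.1 hmin w hw)))
      simpa using this
    have hzi : energy p z.1 z.2.1 z.2.2 ≤ energy p a b T :=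
      isMinOn_iff.1 hmin (a, b, T) h.isAdmissible
    rcases IsAdmissible.cases hp hz with hi | ⟨hi1, hi2⟩ | ⟨hi1, hi2, hi3⟩
    · exact ⟨_, _, _, hi, hzi.trans hle, hcritical _ _ _ hi le_rfl⟩
    · refine ⟨a, b, T, h, hle, hcritical _ _ _ h (hle.trans ((min_le_left _ _).trans ?_))⟩
      have hz' : IsAdmissible p z.2.1 z.2.1 0 := by
        have : IsAdmissible p z.1 z.2.1 z.2.2 := hz
        rwa [hi1, hi2] at this
      rw [hi1, hi2, h₀.diagonal_unique hp hz']
    · refine ⟨a, b, T, h, hle, hcritical _ _ _ h (hle.trans ((min_le_right _ _).trans ?_))⟩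
      rw [hi1, hi2, hi3]
  obtain ⟨hG0, hG1⟩ := hcrit _ _ _ h₁ hs₁
  have hl := hle₁.trans (min_le_left _ _)
  have hr := hle₁.trans (min_le_right _ _)
  obtain ⟨z, hz, hmin⟩ := hK.exists_isMinOn hne
    (f := fun z : ℝ × ℝ × ℝ => energy p z.1 z.2.1 z.2.2 - G (z.2.2 ^ 2))
    ((continuousOn_energy hp).sub (by fun_prop))
  have hz1 : energy p z.1 z.2.1 z.2.2 - G (z.2.2 ^ 2) ≤ energy p a₁ b₁ T₁ - G (T₁ ^ 2) :=
    isMinOn_iff.1 hmin (a₁, b₁, T₁) h₁.isAdmissible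
  rcases IsAdmissible.cases hp hz with hi | ⟨hi1, hi2⟩ | ⟨hi1, hi2, hi3⟩
  · exact hslope _ _ _ hi (slopeNum_eq_of_isLocalMinOn hp hi (hG _) (hi.isLocalMinOn hmin))
  · have hz' : IsAdmissible p z.2.1 z.2.1 0 := by
      have : IsAdmissible p z.1 z.2.1 z.2.2 := hz
      rwa [hi1, hi2] at this
    rw [hi1, hi2, ← h₀.diagonal_unique hp hz', zero_pow two_ne_zero] at hz1
    linarith
  · rw [hi1, hi2, hi3] at hz1
    linarith

theorem min_lt_energy_of_slopeNum_ne_zero {p : ℝ} (hp : 1 < p)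
    (hslope : ∀ a b T, IsInterior p a b T → slopeNum p a b T ≠ 0)
    {a₀ : ℝ} (h₀ : IsAdmissible p a₀ a₀ 0) {a b T : ℝ} (h : IsInterior p a b T) :
    min (energy p a₀ a₀ 0) (energy p 1 0 (1 - 2 ^ (1 - p))) < energy p a b T :=
  min_lt_energy hp (G := fun _ => 0) (g := fun _ => 0) (fun _ => hasStrictDerivAt_const _ _)
    (fun a b T h => by simpa using hslope a b T h)
    (fun a b T h hs => absurd hs (hslope a b T h)) h₀ h

end MinkowskiCohn

namespace MinkowskiCohn

open Set Filter Topology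

theorem rpow_neg_one_div_rpow {p x : ℝ} (hp : 1 < p) (hx : 0 ≤ x) :
    (x ^ (-1 / p)) ^ p = x⁻¹ := by
  rw [← Real.rpow_mul hx, show -1 / p * p = -1 by field_simp, Real.rpow_neg_one]

theorem rpow_le_of_le_sigmaP {p σ : ℝ} (hp : 1 < p) (h1 : 1 ≤ σ) (h2 : σ ≤ sigmaP p) :
    σ ^ p ≤ 2 ^ p - 1 := by
  have h3 : (1 : ℝ) ≤ 2 ^ p := Real.one_le_rpow one_le_two (by linarith)
  have := Real.rpow_le_rpow (by linarith) h2 (by linarith : 0 ≤ p)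
  rwa [sigmaP, ← Real.rpow_mul (by linarith), one_div_mul_cancel (by linarith),
    Real.rpow_one] at this

set_option maxHeartbeats 1000000 in
/-- A point of the branch `τ(p,σ)` gives a point of the curve of admissible triples. -/
theorem exists_isAdmissible {p σ τ τp : ℝ} (hp : 1 < p)
    (hτp : 0 ≤ τp ∧ τp < 1 ∧ 2 * (1 - τp) ^ p = 1 + τp ^ p) (h1 : 1 ≤ σ) (h2 : σ ≤ sigmaP p)
    (h3 : 0 ≤ τ) (h4 : τ ≤ τp) (h5 : Acoef p σ τ ^ p + Bcoef p σ τ ^ p = 1) :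
    ∃ a b, IsAdmissible p a b ((σ ^ p - 1) / (σ ^ p + 1)) ∧
      0 < (τ + σ) * (1 + τ ^ p) ^ (-1 / p) * (1 + σ ^ p) ^ (-1 / p) ∧
      energy p a b ((σ ^ p - 1) / (σ ^ p + 1)) =
        p * Real.log ((τ + σ) * (1 + τ ^ p) ^ (-1 / p) * (1 + σ ^ p) ^ (-1 / p))
          + (2 - p) * Real.log 2 := by
  obtain ⟨hτ0, hτ1, hτe⟩ := hτp
  have hp0 : 0 < p := by linarith
  have hσ0 : 0 < σ := by linarith
  have hτ1' : τ < 1 := by linarith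
  have hlam := rpow_le_of_le_sigmaP hp h1 h2
  have hlam1 : 1 ≤ σ ^ p := Real.one_le_rpow h1 hp0.le
  have hτpow : 0 ≤ τ ^ p := Real.rpow_nonneg h3 p
  have hττ : τ ^ p ≤ τp ^ p := Real.rpow_le_rpow h3 h4 hp0.le
  have hτlt : τ ^ p < 1 := Real.rpow_lt_one h3 hτ1' hp0
  set X := (1 + τ ^ p) ^ (-1 / p) with hX
  set Y := (1 + σ ^ p) ^ (-1 / p) with hY
  have hX0 : 0 < X := Real.rpow_pos_of_pos (by linarith) _
  have hY0 : 0 < Y := Real.rpow_pos_of_pos (by linarith) _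
  have hXp : X ^ p = (1 + τ ^ p)⁻¹ := rpow_neg_one_div_rpow hp (by linarith)
  have hYp : Y ^ p = (1 + σ ^ p)⁻¹ := rpow_neg_one_div_rpow hp (by linarith)
  have hX1 : X ≤ 1 := by
    rw [← Real.rpow_le_rpow_iff hX0.le zero_le_one hp0, hXp, Real.one_rpow]
    exact inv_le_one_of_one_le₀ (by linarith)
  have hY2 : 1 ≤ 2 * Y := by
    rw [← Real.rpow_le_rpow_iff zero_le_one (by linarith) hp0, Real.one_rpow,
      Real.mul_rpow two_pos.le hY0.le, hYp, ← div_eq_mul_inv, one_le_div (by linarith)]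
    linarith
  have hYX : Y < X := by
    rw [← Real.rpow_lt_rpow_iff hY0.le hX0.le hp0, hXp, hYp]
    exact inv_strictAnti₀ (by linarith) (by linarith)
  -- the inequality `σ Y ≤ (σ - τ) X`
  have hbal : σ * Y ≤ (σ - τ) * X := by
    have e1 : 1 + τ ^ p ≤ (σ - τ) ^ p + (1 - τ / σ) ^ p := by
      have i1 : (1 - τp) ^ p ≤ (σ - τ) ^ p :=
        Real.rpow_le_rpow (by linarith) (by linarith) hp0.le
      have i2 : (1 - τp) ^ p ≤ (1 - τ / σ) ^ p := by
        refine Real.rpow_le_rpow (by linarith) ?_ hp0.le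
        have : τ / σ ≤ τ := div_le_self h3 h1
        linarith
      linarith
    have e2 : (1 - τ / σ) ^ p = (σ - τ) ^ p / σ ^ p := by
      rw [← Real.div_rpow (by linarith) hσ0.le]
      congr 1; field_simp
    rw [← Real.rpow_le_rpow_iff (by positivity) (mul_nonneg (by linarith) hX0.le) hp0,
      Real.mul_rpow hσ0.le hY0.le, Real.mul_rpow (by linarith) hX0.le, hXp, hYp,
      ← div_eq_mul_inv, ← div_eq_mul_inv, div_le_div_iff₀ (by linarith) (by linarith)]
    rw [e2] at e1
    have e3 : σ ^ p * ((σ - τ) ^ p / σ ^ p) = (σ - τ) ^ p := by field_simp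
    nlinarith
  have hA : Acoef p σ τ = X - Y := rfl
  have hB : Bcoef p σ τ = σ * Y + τ * X := rfl
  have hA0 : 0 < X - Y := by linarith
  have hB0 : 0 < σ * Y + τ * X := by positivity
  rw [hA, hB] at h5
  set ω := (σ * Y + τ * X) / (X - Y) with hω
  have hω0 : 0 < ω := div_pos hB0 hA0
  have hωe : ω * (X - Y) = σ * Y + τ * X := by rw [hω]; field_simp
  have hωσ : σ ≤ ω := by
    rw [hω, le_div_iff₀ hA0]
    nlinarith
  have hωτ : ω * τ ≤ σ ^ 2 := by
    rw [hω, div_mul_eq_mul_div, div_le_iff₀ hA0]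
    nlinarith
  have hωp : (X - Y) ^ p * (1 + ω ^ p) = 1 := by
    rw [mul_add, mul_one, ← Real.mul_rpow hA0.le hω0.le, mul_comm (X - Y) ω, hωe, h5]
  have hstσ : 0 < σ + τ := by linarith
  have hc : (σ - τ) / (σ + τ) + (ω - σ) / (ω + σ) = 2 * σ * Y / ((σ + τ) * X) := by
    rw [div_add_div _ _ (by linarith) (by linarith), div_eq_div_iff (by positivity) (by positivity)]
    linear_combination 2 * σ * (σ + τ) * hωe
  have hcp : ((σ - τ) / (σ + τ) + (ω - σ) / (ω + σ)) ^ p =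
      (2 / (σ + τ)) ^ p * (σ ^ p * (1 + τ ^ p) / (1 + σ ^ p)) := by
    rw [hc, show 2 * σ * Y / ((σ + τ) * X) = 2 / (σ + τ) * (σ * (Y / X)) by field_simp,
      Real.mul_rpow (by positivity) (by positivity), Real.mul_rpow hσ0.le (by positivity),
      Real.div_rpow hY0.le hX0.le, hXp, hYp]
    field_simp
  refine ⟨(σ - τ) / (σ + τ), (ω - σ) / (ω + σ), ⟨?_, ?_, ?_, ?_, ?_, ?_, ?_⟩, by positivity, ?_⟩
  · exact div_nonneg (by linarith) (by linarith)
  · rw [div_le_div_iff₀ (by linarith) (by linarith)]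
    nlinarith
  · rw [div_le_one hstσ]; linarith
  · exact div_nonneg (by linarith) (by linarith)
  · have h6 : (2 : ℝ) ^ (1 - p) = 2 / 2 ^ p := by
      rw [Real.rpow_sub two_pos, Real.rpow_one]
    have h7 : (σ ^ p - 1) / (σ ^ p + 1) = 1 - 2 / (σ ^ p + 1) := by
      have : σ ^ p + 1 ≠ 0 := by linarith
      field_simp; ring
    rw [h6, h7]
    have : 2 / (2 : ℝ) ^ p ≤ 2 / (σ ^ p + 1) :=
      div_le_div_of_nonneg_left two_pos.le (by linarith) (by linarith)
    linarith
  · rw [hcp, evenPow, oddPow,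
      show 1 + (σ - τ) / (σ + τ) = 2 / (σ + τ) * σ by field_simp; ring,
      show 1 - (σ - τ) / (σ + τ) = 2 / (σ + τ) * τ by field_simp; ring,
      Real.mul_rpow (by positivity) hσ0.le, Real.mul_rpow (by positivity) h3]
    have : σ ^ p + 1 ≠ 0 := by linarith
    have : 1 + σ ^ p ≠ 0 := by linarith
    field_simp
    ring
  · have hc2 : (σ - τ) / (σ + τ) + (ω - σ) / (ω + σ) = 2 / (ω + σ) * (σ * (Y / (X - Y))) := by
      have h8 : (ω + σ) * (X - Y) = X * (σ + τ) := by linear_combination hωe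
      rw [hc, show 2 / (ω + σ) * (σ * (Y / (X - Y))) = 2 * σ * Y / ((ω + σ) * (X - Y)) by
        field_simp, h8, mul_comm X]
    have hAp : (X - Y) ^ p = (1 + ω ^ p)⁻¹ := eq_inv_of_mul_eq_one_left hωp
    rw [hc2, Real.mul_rpow (by positivity) (by positivity), Real.mul_rpow hσ0.le (by positivity),
      Real.div_rpow hY0.le hA0.le, hAp, hYp, evenPow, oddPow,
      show 1 + (ω - σ) / (ω + σ) = 2 / (ω + σ) * ω by field_simp; ring,
      show 1 - (ω - σ) / (ω + σ) = 2 / (ω + σ) * σ by field_simp; ring,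
      Real.mul_rpow (by positivity) hω0.le, Real.mul_rpow (by positivity) hσ0.le]
    have : σ ^ p + 1 ≠ 0 := by linarith
    have : 1 + σ ^ p ≠ 0 := by linarith
    field_simp
    ring
  · have hlogY : p * Real.log Y = -Real.log (1 + σ ^ p) := by
      rw [← Real.log_rpow hY0, hYp, Real.log_inv]
    have e1 : 1 - ((σ ^ p - 1) / (σ ^ p + 1)) ^ 2 = 2 ^ 2 * σ ^ p / (1 + σ ^ p) ^ 2 := by
      have : σ ^ p + 1 ≠ 0 := by linarith
      have : 1 + σ ^ p ≠ 0 := by linarith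
      field_simp
      ring
    rw [energy, hc, e1, Real.log_div (by positivity) (by positivity),
      Real.log_mul (by positivity) (by positivity), Real.log_pow, Real.log_pow,
      Real.log_rpow hσ0, Real.log_div (by positivity) (by positivity),
      Real.log_mul (by positivity) (by positivity), Real.log_mul (by positivity) (by positivity),
      Real.log_mul (by positivity) (by positivity), Real.log_mul (by positivity) (by positivity),
      Real.log_mul (by positivity) (by positivity), add_comm τ σ]
    push_cast
    linear_combination (-2) * hlogY

/-- The conjecture follows from the corresponding statement about `energy`. -/
theorem min_lt_deltaFun {p : ℝ} (hp : 1 < p)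
    (hE : ∀ a₀ a b T, IsAdmissible p a₀ a₀ 0 → IsInterior p a b T →
      min (energy p a₀ a₀ 0) (energy p 1 0 (1 - 2 ^ (1 - p))) < energy p a b T)
    {τp : ℝ} (hτp : 0 ≤ τp ∧ τp < 1 ∧ 2 * (1 - τp) ^ p = 1 + τp ^ p) {T : ℝ → ℝ}
    (hT : ∀ σ ∈ Set.Icc 1 (sigmaP p),
      0 ≤ T σ ∧ T σ ≤ τp ∧ Acoef p σ (T σ) ^ p + Bcoef p σ (T σ) ^ p = 1)
    {σ : ℝ} (hσ : 1 < σ ∧ σ < sigmaP p) :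
    min (DeltaFun p T 1) (DeltaFun p T (sigmaP p)) < DeltaFun p T σ := by
  have hp0 : 0 < p := by linarith
  have h2p : (2 : ℝ) < 2 ^ p := by
    simpa using Real.rpow_lt_rpow_of_exponent_lt one_lt_two hp
  have key : ∀ s ∈ Set.Icc 1 (sigmaP p), ∃ a b, IsAdmissible p a b ((s ^ p - 1) / (s ^ p + 1)) ∧
      0 < DeltaFun p T s ∧ energy p a b ((s ^ p - 1) / (s ^ p + 1)) =
        p * Real.log (DeltaFun p T s) + (2 - p) * Real.log 2 := fun s hs =>
    exists_isAdmissible hp hτp hs.1 hs.2 (hT s hs).1 (hT s hs).2.1 (hT s hs).2.2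
  have hT1 := (two_rpow_one_sub_mem hp).2
  have hσp : sigmaP p ^ p = 2 ^ p - 1 := by
    rw [sigmaP, ← Real.rpow_mul (by linarith), one_div_mul_cancel hp0.ne', Real.rpow_one]
  have hTσp : (sigmaP p ^ p - 1) / (sigmaP p ^ p + 1) = 1 - 2 ^ (1 - p) := by
    rw [hσp, Real.rpow_sub two_pos, Real.rpow_one]
    field_simp
    ring
  obtain ⟨a₀, b₀, had₀, hpos₀, he₀⟩ := key 1 ⟨le_rfl, by linarith⟩
  obtain ⟨a₁, b₁, had₁, hpos₁, he₁⟩ := key (sigmaP p) ⟨by linarith, le_rfl⟩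
  obtain ⟨a, b, had, hpos, he⟩ := key σ ⟨hσ.1.le, hσ.2.le⟩
  have hlam : 1 < σ ^ p := Real.one_lt_rpow hσ.1 hp0
  have hlam' : σ ^ p < 2 ^ p - 1 := by
    rw [← hσp]; exact Real.rpow_lt_rpow (by linarith) hσ.2 hp0
  have hint : IsInterior p a b ((σ ^ p - 1) / (σ ^ p + 1)) := by
    rcases had.cases hp with h | ⟨-, h⟩ | ⟨-, -, h⟩
    · exact h
    · exact absurd h (div_pos (by linarith) (by linarith)).ne'
    · rw [← hTσp, hσp, div_eq_div_iff (by linarith) (by linarith)] at h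
      nlinarith
  rw [Real.one_rpow, sub_self, zero_div] at had₀ he₀
  rw [hTσp] at had₁ he₁
  have hab₀ : a₀ = b₀ := by
    rcases had₀.cases hp with h | ⟨h, -⟩ | ⟨-, -, h⟩
    · exact absurd h.T_pos (lt_irrefl _)
    · exact h
    · linarith
  have hab₁ : a₁ = 1 ∧ b₁ = 0 := by
    rcases had₁.cases hp with h | ⟨-, h⟩ | ⟨h, h', -⟩
    · exact absurd h.T_lt (lt_irrefl _)
    · linarith
    · exact ⟨h, h'⟩
  subst hab₀
  rw [hab₁.1, hab₁.2] at he₁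
  have hmain := hE a₀ a b _ had₀ hint
  rw [min_lt_iff] at hmain ⊢
  refine hmain.imp (fun h => ?_) fun h => ?_
  · rw [he₀, he, add_lt_add_iff_right, mul_lt_mul_iff_of_pos_left hp0,
      Real.log_lt_log_iff hpos₀ hpos] at h
    exact h
  · rw [he₁, he, add_lt_add_iff_right, mul_lt_mul_iff_of_pos_left hp0,
      Real.log_lt_log_iff hpos₁ hpos] at h
    exact h

end MinkowskiCohn

namespace MinkowskiCohn

open Set Filter Topology

theorem oddPow_nonpos {q x : ℝ} (hq : q ≤ 0) (h0 : 0 ≤ x) (h1 : x < 1) : oddPow q x ≤ 0 := by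
  have := Real.rpow_le_rpow_of_nonpos (by linarith : 0 < 1 - x) (by linarith : 1 - x ≤ 1 + x) hq
  unfold oddPow
  linarith

theorem oddPow_neg {q x : ℝ} (hq : q < 0) (h0 : 0 < x) (h1 : x < 1) : oddPow q x < 0 := by
  have := Real.rpow_lt_rpow_of_neg (by linarith : 0 < 1 - x) (by linarith : 1 - x < 1 + x) hq
  unfold oddPow
  linarith

theorem one_sub_sq_mul_evenPow {x : ℝ} (h0 : -1 < x) (h1 : x < 1) (q : ℝ) :
    (1 - x ^ 2) * evenPow (q - 1) x = evenPow q x - x * oddPow q x := by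
  rw [evenPow_eq h0 h1 q, oddPow_eq h0 h1 q]; ring

theorem one_sub_sq_mul_oddPow {x : ℝ} (h0 : -1 < x) (h1 : x < 1) (q : ℝ) :
    (1 - x ^ 2) * oddPow (q - 1) x = oddPow q x - x * evenPow q x := by
  rw [evenPow_eq h0 h1 q, oddPow_eq h0 h1 q]; ring

theorem IsInterior.a_pos {p a b T : ℝ} (h : IsInterior p a b T) : 0 < a :=
  h.b_pos.trans h.b_lt_a

theorem IsInterior.b_lt_one {p a b T : ℝ} (h : IsInterior p a b T) : b < 1 :=
  h.b_lt_a.trans h.a_lt_one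

theorem IsInterior.T_lt_one {p a b T : ℝ} (h : IsInterior p a b T) : T < 1 := by
  have := h.T_lt
  have : (0 : ℝ) < 2 ^ (1 - p) := by positivity
  linarith

/-- Comparison of the mean of `p`-th powers with the mean of `r`-th powers. -/
theorem rpow_mean_le {p r w x y : ℝ} (hp : 0 < p) (hpr : p ≤ r) (hw0 : 0 ≤ w) (hw1 : w ≤ 1)
    (hx : 0 ≤ x) (hy : 0 ≤ y) :
    (w * x ^ p + (1 - w) * y ^ p) ^ (r / p) ≤ w * x ^ r + (1 - w) * y ^ r := by
  have := (convexOn_rpow ((one_le_div hp).2 hpr)).2 (mem_Ici.2 (Real.rpow_nonneg hx p))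
    (mem_Ici.2 (Real.rpow_nonneg hy p)) hw0 (by linarith : 0 ≤ 1 - w) (by ring)
  simp only [smul_eq_mul] at this
  rwa [← Real.rpow_mul hx, ← Real.rpow_mul hy, mul_div_cancel₀ _ hp.ne'] at this

theorem evenPow_sub_mul_oddPow (p x t : ℝ) : evenPow p x - t * oddPow p x =
    (1 - t) / 2 * (1 + x) ^ p + (1 - (1 - t) / 2) * (1 - x) ^ p := by
  unfold evenPow oddPow; ring

theorem evenPow_add_mul_oddPow (p x t : ℝ) : evenPow p x + t * oddPow p x =
    (1 + t) / 2 * (1 + x) ^ p + (1 - (1 + t) / 2) * (1 - x) ^ p := by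
  unfold evenPow oddPow; ring

theorem IsInterior.rpow_le_of_le {p a b T : ℝ} (h : IsInterior p a b T) {r : ℝ} (hp : 0 < p)
    (hpr : p ≤ r) : (a + b) ^ r ≤ evenPow r a - T * oddPow r a ∧
      (a + b) ^ r ≤ evenPow r b + T * oddPow r b := by
  have hT := h.T_lt_one
  have hT0 := h.T_pos
  have ha0 := h.a_pos
  have ha := h.a_lt_one
  have hb := h.b_pos
  have hb1 := h.b_lt_one
  have e : ((a + b) ^ p) ^ (r / p) = (a + b) ^ r := by
    rw [← Real.rpow_mul (by linarith), mul_div_cancel₀ _ hp.ne']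
  constructor
  · rw [← e, ← h.eq_a, evenPow_sub_mul_oddPow, evenPow_sub_mul_oddPow]
    exact rpow_mean_le hp hpr (by linarith) (by linarith) (by linarith) (by linarith)
  · rw [← e, ← h.eq_b, evenPow_add_mul_oddPow, evenPow_add_mul_oddPow]
    exact rpow_mean_le hp hpr (by linarith) (by linarith) (by linarith) (by linarith)

theorem IsInterior.le_rpow_of_le {p a b T : ℝ} (h : IsInterior p a b T) {r : ℝ} (hr : 0 < r)
    (hrp : r ≤ p) : evenPow r a - T * oddPow r a ≤ (a + b) ^ r ∧
      evenPow r b + T * oddPow r b ≤ (a + b) ^ r := by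
  have hT := h.T_lt_one
  have hT0 := h.T_pos
  have ha0 := h.a_pos
  have ha := h.a_lt_one
  have hb := h.b_pos
  have hb1 := h.b_lt_one
  have hc : 0 ≤ (a + b) ^ r := Real.rpow_nonneg (by linarith) _
  have e : ((a + b) ^ r) ^ (p / r) = (a + b) ^ p := by
    rw [← Real.rpow_mul (by linarith), mul_div_cancel₀ _ hr.ne']
  have hpr : 0 < p / r := div_pos (by linarith) hr
  constructor
  · have h1 : 0 ≤ evenPow r a - T * oddPow r a := by
      rw [evenPow_sub_mul_oddPow]
      have h2 := Real.rpow_nonneg (by linarith : 0 ≤ 1 + a) r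
      have h3 := Real.rpow_nonneg (by linarith : 0 ≤ 1 - a) r
      exact add_nonneg (mul_nonneg (by linarith) h2) (mul_nonneg (by linarith) h3)
    rw [← Real.rpow_le_rpow_iff h1 hc hpr, e, ← h.eq_a, evenPow_sub_mul_oddPow,
      evenPow_sub_mul_oddPow]
    exact rpow_mean_le hr hrp (by linarith) (by linarith) (by linarith) (by linarith)
  · have h1 : 0 ≤ evenPow r b + T * oddPow r b := by
      rw [evenPow_add_mul_oddPow]
      have h2 := Real.rpow_nonneg (by linarith : 0 ≤ 1 + b) r
      have h3 := Real.rpow_nonneg (by linarith : 0 ≤ 1 - b) r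
      exact add_nonneg (mul_nonneg (by linarith) h2) (mul_nonneg (by linarith) h3)
    rw [← Real.rpow_le_rpow_iff h1 hc hpr, e, ← h.eq_b, evenPow_add_mul_oddPow,
      evenPow_add_mul_oddPow]
    exact rpow_mean_le hr hrp (by linarith) (by linarith) (by linarith) (by linarith)

theorem evenPow_two (x : ℝ) : evenPow 2 x = 1 + x ^ 2 := by
  unfold evenPow; norm_num; ring

theorem oddPow_two (x : ℝ) : oddPow 2 x = 2 * x := by
  unfold oddPow; norm_num; ring

theorem IsInterior.sq_add_mul_add_sq_le_one {p a b T : ℝ} (h : IsInterior p a b T) (hp : 0 < p)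
    (hp2 : p ≤ 2) : a ^ 2 + a * b + b ^ 2 ≤ 1 := by
  obtain ⟨h1, h2⟩ := h.rpow_le_of_le hp hp2
  rw [evenPow_two, oddPow_two, Real.rpow_two] at h1 h2
  have h3 : 0 < a + b := by linarith [h.a_pos, h.b_pos]
  have h4 := mul_le_mul_of_nonneg_left h1 h.b_pos.le
  have h5 := mul_le_mul_of_nonneg_left h2 h.a_pos.le
  have h6 : (a + b) * (a ^ 2 + a * b + b ^ 2) ≤ (a + b) * 1 := by nlinarith
  exact le_of_mul_le_mul_left h6 h3

theorem IsInterior.one_le_sq_add_mul_add_sq {p a b T : ℝ} (h : IsInterior p a b T)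
    (hp2 : 2 ≤ p) : 1 ≤ a ^ 2 + a * b + b ^ 2 := by
  obtain ⟨h1, h2⟩ := h.le_rpow_of_le two_pos hp2
  rw [evenPow_two, oddPow_two, Real.rpow_two] at h1 h2
  have h3 : 0 < a + b := by linarith [h.a_pos, h.b_pos]
  have h4 := mul_le_mul_of_nonneg_left h1 h.b_pos.le
  have h5 := mul_le_mul_of_nonneg_left h2 h.a_pos.le
  have h6 : (a + b) * 1 ≤ (a + b) * (a ^ 2 + a * b + b ^ 2) := by nlinarith
  exact le_of_mul_le_mul_left h6 h3

theorem evenPow_antitoneOn {s : ℝ} (hs0 : 0 < s) (hs1 : s < 1) :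
    AntitoneOn (evenPow s) (Icc 0 1) := by
  refine antitoneOn_of_deriv_nonpos (convex_Icc 0 1)
    (continuous_evenPow hs0.le).continuousOn ?_ fun x hx => ?_
  · intro x hx
    rw [interior_Icc] at hx
    exact (hasStrictDerivAt_evenPow (by linarith [hx.1]) hx.2
      s).hasDerivAt.differentiableAt.differentiableWithinAt
  · rw [interior_Icc] at hx
    rw [(hasStrictDerivAt_evenPow (by linarith [hx.1]) hx.2 s).hasDerivAt.deriv]
    exact mul_nonpos_of_nonneg_of_nonpos hs0.le (oddPow_nonpos (by linarith) hx.1.le hx.2)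

theorem mul_evenPow_le_oddPow {s x : ℝ} (hs0 : 0 < s) (hs1 : s < 1) (h0 : 0 ≤ x) (h1 : x ≤ 1) :
    s * (x * evenPow s x) ≤ oddPow s x := by
  have hmono : MonotoneOn (fun x => oddPow s x - s * (x * evenPow s x)) (Icc 0 1) := by
    have hd : ∀ y ∈ Ioo (0 : ℝ) 1, HasDerivAt (fun x => oddPow s x - s * (x * evenPow s x))
        (-(s * (1 + s) * (y * oddPow (s - 1) y))) y := by
      intro y hy
      have d1 := (hasStrictDerivAt_oddPow (by linarith [hy.1]) hy.2 s).hasDerivAt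
      have d2 := (hasStrictDerivAt_evenPow (by linarith [hy.1]) hy.2 s).hasDerivAt
      refine (d1.sub (((hasDerivAt_id y).mul d2).const_mul s)).congr_deriv ?_
      have := evenPow_eq (by linarith [hy.1] : -1 < y) hy.2 s
      simp only [id]
      rw [this]; ring
    have c1 := continuous_evenPow hs0.le
    have c2 := continuous_oddPow hs0.le
    refine monotoneOn_of_deriv_nonneg (convex_Icc 0 1) (by fun_prop) ?_ fun y hy => ?_
    · intro y hy
      rw [interior_Icc] at hy
      exact (hd y hy).differentiableAt.differentiableWithinAt
    · rw [interior_Icc] at hy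
      rw [(hd y hy).deriv]
      have := oddPow_nonpos (by linarith : s - 1 ≤ 0) hy.1.le hy.2
      have h1 : y * oddPow (s - 1) y ≤ 0 := mul_nonpos_of_nonneg_of_nonpos hy.1.le this
      nlinarith [mul_pos hs0 (by linarith : 0 < 1 + s)]
  have := hmono ⟨le_rfl, zero_le_one⟩ ⟨h0, h1⟩ h0
  simp only [oddPow_zero] at this
  linarith

/-- For `p < 2`, the parameter `T` is at least its value for quadratic curves. -/
theorem IsInterior.mul_sub_le_T {p a b T : ℝ} (h : IsInterior p a b T) (hp : 1 < p) (hp2 : p < 2) :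
    (p - 1) * (a - b) ≤ 2 * T := by
  have hb := h.b_pos
  have ha := h.a_lt_one
  have hba := h.b_lt_a
  have hga := oddPow_pos (p := p) (by linarith) h.a_pos ha.le
  have hgb := oddPow_pos (p := p) (by linarith) hb h.b_lt_one.le
  have hmono : MonotoneOn (fun x => 2 * (evenPow p x - evenPow p b)
      - (p - 1) * ((x - b) * (oddPow p x + oddPow p b))) (Icc b a) := by
    have hd : ∀ y ∈ Ioo b a, HasDerivAt (fun x => 2 * (evenPow p x - evenPow p b)
        - (p - 1) * ((x - b) * (oddPow p x + oddPow p b)))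
        (2 * (p * oddPow (p - 1) y) - (p - 1) * ((oddPow p y + oddPow p b)
          + (y - b) * (p * evenPow (p - 1) y))) y := by
      intro y hy
      have d1 := (hasStrictDerivAt_oddPow (by linarith [hy.1] : -1 < y) (by linarith [hy.2]) p).hasDerivAt
      have d2 := (hasStrictDerivAt_evenPow (by linarith [hy.1] : -1 < y) (by linarith [hy.2]) p).hasDerivAt
      refine (((d2.sub_const _).const_mul 2).sub ((((hasDerivAt_id y).sub_const b).mul
        (d1.add_const _)).const_mul (p - 1))).congr_deriv ?_
      simp
    have c1 := continuous_evenPow (p := p) (by linarith)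
    have c2 := continuous_oddPow (p := p) (by linarith)
    refine monotoneOn_of_deriv_nonneg (convex_Icc b a) (by fun_prop) ?_ fun y hy => ?_
    · intro y hy
      rw [interior_Icc] at hy
      exact (hd y hy).differentiableAt.differentiableWithinAt
    · rw [interior_Icc] at hy
      rw [(hd y hy).deriv]
      obtain ⟨ξ, hξ, hξe⟩ := exists_hasDerivAt_eq_slope (oddPow p)
        (fun x => p * evenPow (p - 1) x) hy.1 c2.continuousOn fun x hx =>
          (hasStrictDerivAt_oddPow (by linarith [hx.1]) (by linarith [hx.2, hy.2]) p).hasDerivAt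
      have hle := evenPow_antitoneOn (by linarith : 0 < p - 1) (by linarith)
        (⟨by linarith [hξ.1], by linarith [hξ.2, hy.2]⟩ : ξ ∈ Icc (0 : ℝ) 1)
        (⟨by linarith [hy.1], by linarith [hy.2]⟩ : y ∈ Icc (0 : ℝ) 1) hξ.2.le
      have hyb : 0 < y - b := by linarith [hy.1]
      have e1 : oddPow p y - oddPow p b = p * evenPow (p - 1) ξ * (y - b) := by
        rw [hξe]; field_simp
      have e2 : p * evenPow (p - 1) y * (y - b) ≤ oddPow p y - oddPow p b := by
        rw [e1]
        exact mul_le_mul_of_nonneg_right (mul_le_mul_of_nonneg_left hle (by linarith)) hyb.le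
      have e3 := mul_evenPow_le_oddPow (by linarith : 0 < p - 1) (by linarith)
        (by linarith [hy.1] : 0 ≤ y) (by linarith [hy.2])
      have e4 := oddPow_eq (by linarith [hy.1] : -1 < y) (by linarith [hy.2]) p
      nlinarith
  have hH := hmono ⟨le_rfl, hba.le⟩ ⟨hba.le, le_rfl⟩ hba.le
  have hT : T * (oddPow p a + oddPow p b) = evenPow p a - evenPow p b := by
    linear_combination h.eq_b - h.eq_a
  simp only [sub_self, mul_zero, zero_mul] at hH
  have : (p - 1) * (a - b) * (oddPow p a + oddPow p b) ≤ 2 * T * (oddPow p a + oddPow p b) := by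
    nlinarith
  exact le_of_mul_le_mul_right this (by linarith)

/-- An upper bound for `tanh (β * artanh x)`. -/
theorem oddPow_mul_le {β x : ℝ} (hβ0 : 0 < β) (hβ1 : β < 1) (h0 : 0 ≤ x) (h1 : x < 1) :
    oddPow β x * (1 - (1 - β) * (x ^ 2 * (2 + x ^ 2) / 3)) ≤ β * x * evenPow β x := by
  set D : ℝ → ℝ := fun y => 1 - (1 - β) * (y ^ 2 * (2 + y ^ 2) / 3) with hD
  have hDpos : ∀ y ∈ Ico (0 : ℝ) 1, 0 < D y - β * y ∧ 0 < D y + β * y := by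
    intro y hy
    have e : y ^ 2 * (2 + y ^ 2) / 3 ≤ y ^ 2 := by
      nlinarith [sq_nonneg y, pow_le_one₀ (n := 2) hy.1 hy.2.le]
    have e2 : 1 - (1 - β) * y ^ 2 ≤ D y := by
      simp only [hD]; nlinarith
    have e3 : 0 < (1 - y) * (1 + y - β * y) := mul_pos (by linarith [hy.2])
      (by nlinarith [hy.1])
    have e4 : 0 ≤ β * y := mul_nonneg hβ0.le hy.1
    constructor <;> nlinarith
  have hDd : ∀ y, HasDerivAt D (-((1 - β) * (4 * y * (1 + y ^ 2) / 3))) y := by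
    intro y
    have := ((((hasDerivAt_id y).pow 2).mul (((hasDerivAt_id y).pow 2).const_add 2)).div_const
      3).const_mul (1 - β) |>.const_sub 1
    refine this.congr_deriv ?_
    simp only [id, Pi.pow_apply]
    push_cast
    ring
  have hmono : MonotoneOn (fun y => Real.log (D y + β * y) - Real.log (D y - β * y)
      - β * (Real.log (1 + y) - Real.log (1 - y))) (Ico 0 1) := by
    have hd : ∀ y ∈ Ico (0 : ℝ) 1, HasDerivAt (fun y => Real.log (D y + β * y)
        - Real.log (D y - β * y) - β * (Real.log (1 + y) - Real.log (1 - y)))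
        ((-((1 - β) * (4 * y * (1 + y ^ 2) / 3)) + β) / (D y + β * y)
          - (-((1 - β) * (4 * y * (1 + y ^ 2) / 3)) - β) / (D y - β * y)
          - β * (1 / (1 + y) - (-1) / (1 - y))) y := by
      intro y hy
      have b1 : HasDerivAt (fun y : ℝ => β * y) β y := by
        simpa using (hasDerivAt_id y).const_mul β
      have d1 := ((hDd y).add b1).log (hDpos y hy).2.ne'
      have d2 := ((hDd y).sub b1).log (hDpos y hy).1.ne'
      have d3 := ((hasDerivAt_id y).const_add 1).log (by simp; linarith [hy.1])
      have d4 := ((hasDerivAt_id y).const_sub 1).log (by simp; linarith [hy.2])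
      exact (d1.sub d2).sub ((d3.sub d4).const_mul β)
    refine monotoneOn_of_deriv_nonneg (convex_Ico 0 1)
      (fun y hy => (hd y hy).continuousAt.continuousWithinAt) ?_ fun y hy => ?_
    · intro y hy
      rw [interior_Ico] at hy
      exact (hd y ⟨hy.1.le, hy.2⟩).differentiableAt.differentiableWithinAt
    · rw [interior_Ico] at hy
      rw [(hd y ⟨hy.1.le, hy.2⟩).deriv]
      obtain ⟨p1, p2⟩ := hDpos y ⟨hy.1.le, hy.2⟩
      have p3 : 0 < 1 + y := by linarith [hy.1]
      have p4 : 0 < 1 - y := by linarith [hy.2]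
      have key : (D y + β * y) * (D y - β * y) ≤
          (D y + (1 - β) * (4 * y ^ 2 * (1 + y ^ 2) / 3)) * ((1 + y) * (1 - y)) := by
        have q1 : y ^ 2 ≤ 1 := pow_le_one₀ hy.1.le hy.2.le
        have q2 : 0 ≤ (1 - β) * y ^ 2 * (y ^ 2 - (y ^ 2) ^ 2) :=
          mul_nonneg (mul_nonneg (by linarith) (sq_nonneg y)) (by nlinarith [sq_nonneg y])
        have q3 : 0 ≤ (1 - β) ^ 2 * y ^ 2 * (1 - y ^ 2 * (2 + y ^ 2) ^ 2 / 9) := by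
          refine mul_nonneg (by positivity) ?_
          have : (2 + y ^ 2) ^ 2 ≤ 3 ^ 2 := pow_le_pow_left₀ (by positivity) (by linarith) 2
          nlinarith [sq_nonneg y]
        simp only [hD]
        nlinarith
      have e : (-((1 - β) * (4 * y * (1 + y ^ 2) / 3)) + β) / (D y + β * y)
          - (-((1 - β) * (4 * y * (1 + y ^ 2) / 3)) - β) / (D y - β * y)
          - β * (1 / (1 + y) - (-1) / (1 - y)) =
          2 * β * ((D y + (1 - β) * (4 * y ^ 2 * (1 + y ^ 2) / 3)) * ((1 + y) * (1 - y))
            - (D y + β * y) * (D y - β * y)) /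
          ((D y + β * y) * (D y - β * y) * ((1 + y) * (1 - y))) := by
        field_simp
        ring
      rw [e]
      exact div_nonneg (mul_nonneg (by linarith) (by linarith)) (by positivity)
  have hx := hmono ⟨le_rfl, one_pos⟩ ⟨h0, h1⟩ h0
  obtain ⟨p1, p2⟩ := hDpos x ⟨h0, h1⟩
  have p3 : 0 < 1 + x := by linarith
  have p4 : 0 < 1 - x := by linarith
  simp only [mul_zero, add_zero, sub_zero, sub_self, Real.log_one] at hx
  have hlog : Real.log ((1 + x) ^ β * (D x - β * x)) ≤ Real.log ((1 - x) ^ β * (D x + β * x)) := by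
    rw [Real.log_mul (by positivity) p1.ne', Real.log_mul (by positivity) p2.ne',
      Real.log_rpow p3, Real.log_rpow p4]
    linarith
  rw [Real.log_le_log_iff (by positivity) (by positivity)] at hlog
  show oddPow β x * D x ≤ _
  unfold oddPow evenPow
  nlinarith

theorem mul_evenPow_sub_oddPow_pos {s x : ℝ} (hs : s < 1) (h0 : 0 < x) (h1 : x < 1) :
    0 < x * evenPow s x - oddPow s x := by
  have := one_sub_sq_mul_oddPow (by linarith : -1 < x) h1 s
  have := oddPow_neg (by linarith : s - 1 < 0) h0 h1
  nlinarith [mul_pos (by linarith : 0 < 1 - x) (by linarith : 0 < 1 + x)]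

/-- The monotone quantity governing the case `p < 2`; here `s = p - 1` and `κ = 2 - p`. -/
theorem monotoneOn_defect {κ : ℝ} (h0 : 0 < κ) (h1 : κ < 1) :
    MonotoneOn (fun x => Real.log (1 + κ - 2 * κ * x ^ 2) - κ * Real.log (1 - x ^ 2)
      + Real.log (oddPow κ x) - Real.log x - Real.log (evenPow (1 - κ) x)) (Ioo 0 1) := by
  have hd : ∀ y ∈ Ioo (0 : ℝ) 1, HasDerivAt (fun x => Real.log (1 + κ - 2 * κ * x ^ 2)
      - κ * Real.log (1 - x ^ 2) + Real.log (oddPow κ x) - Real.log x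
      - Real.log (evenPow (1 - κ) x))
      (-(2 * κ * (2 * y)) / (1 + κ - 2 * κ * y ^ 2) - κ * (-(2 * y) / (1 - y ^ 2))
        + κ * evenPow (κ - 1) y / oddPow κ y - 1 / y
        - (1 - κ) * oddPow (1 - κ - 1) y / evenPow (1 - κ) y) y := by
    intro y hy
    have q1 : y ^ 2 < 1 := pow_lt_one₀ hy.1.le hy.2 two_ne_zero
    have sq : HasDerivAt (fun x : ℝ => x ^ 2) (2 * y) y := by simpa using hasDerivAt_pow 2 y
    have d1 := ((sq.const_mul (2 * κ)).const_sub (1 + κ)).log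
      (by nlinarith : 1 + κ - 2 * κ * y ^ 2 ≠ 0)
    have d2 := (sq.const_sub 1).log (by linarith : 1 - y ^ 2 ≠ 0)
    have d3 := (hasStrictDerivAt_oddPow (by linarith [hy.1] : -1 < y) hy.2 κ).hasDerivAt.log
      (oddPow_pos h0 hy.1 hy.2.le).ne'
    have d4 := (hasDerivAt_id y).log hy.1.ne'
    have d5 := (hasStrictDerivAt_evenPow (by linarith [hy.1] : -1 < y) hy.2
      (1 - κ)).hasDerivAt.log (evenPow_pos hy.1.le hy.2.le).ne'
    exact (((d1.sub (d2.const_mul κ)).add d3).sub d4).sub d5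
  refine monotoneOn_of_deriv_nonneg (convex_Ioo 0 1)
    (fun y hy => (hd y hy).continuousAt.continuousWithinAt) ?_ fun y hy => ?_
  · intro y hy
    rw [interior_Ioo] at hy
    exact (hd y hy).differentiableAt.differentiableWithinAt
  · rw [interior_Ioo] at hy
    rw [(hd y hy).deriv]
    have hy0 := hy.1
    have q1 : y ^ 2 < 1 := pow_lt_one₀ hy.1.le hy.2 two_ne_zero
    have q0 : 0 < y ^ 2 := by positivity
    have e1 := one_sub_sq_mul_evenPow (by linarith : -1 < y) hy.2 κ
    have e2 := one_sub_sq_mul_oddPow (by linarith : -1 < y) hy.2 (1 - κ)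
    have f1 := oddPow_mul_le h0 h1 hy.1.le hy.2
    have f2 := oddPow_mul_le (by linarith : 0 < 1 - κ) (by linarith) hy.1.le hy.2
    have g1 := oddPow_pos h0 hy.1 hy.2.le
    have g2 := evenPow_pos (p := 1 - κ) hy.1.le hy.2.le
    set o := oddPow κ y
    set e := evenPow κ y
    set o' := oddPow (1 - κ) y
    set e' := evenPow (1 - κ) y
    have hE : evenPow (κ - 1) y = (e - y * o) / (1 - y ^ 2) := by
      rw [eq_div_iff (by linarith)]; linarith
    have hO : oddPow (1 - κ - 1) y = (o' - y * e') / (1 - y ^ 2) := by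
      rw [eq_div_iff (by linarith)]; linarith
    have k1 : 1 / y - (1 - κ) * (y * (2 + y ^ 2) / 3) ≤ κ * (e / o) := by
      rw [← mul_div_assoc κ e o, le_div_iff₀ g1]
      have : (1 / y - (1 - κ) * (y * (2 + y ^ 2) / 3)) * o =
          (o * (1 - (1 - κ) * (y ^ 2 * (2 + y ^ 2) / 3))) / y := by
        field_simp
      rw [this, div_le_iff₀ hy0]
      linarith
    have k2 : o' / e' ≤ (1 - κ) * y / (1 - κ * y ^ 2) := by
      have i1 : 0 < 1 - κ * y ^ 2 := by nlinarith
      rw [div_le_div_iff₀ g2 i1]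
      refine le_trans (mul_le_mul_of_nonneg_left ?_ (oddPow_pos (by linarith) hy0 hy.2.le).le) f2
      nlinarith [mul_nonneg h0.le q0.le]
    have k3 : (1 - κ) * (2 + y ^ 2) / 3 + (1 - κ) ^ 2 / (1 - κ * y ^ 2)
        ≤ 2 * (1 - κ) / (1 + κ - 2 * κ * y ^ 2) := by
      have i1 : 0 < 1 - κ * y ^ 2 := by nlinarith
      have i2 : 0 < 1 + κ - 2 * κ * y ^ 2 := by nlinarith
      rw [div_add_div _ _ (by norm_num) i1.ne', div_le_div_iff₀ (by positivity) i2]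
      generalize y ^ 2 = X at *
      have i3 : 0 ≤ 6 * (1 - κ * X) - (2 + X) * (1 - κ * X) * (1 + κ - 2 * κ * X)
          - 3 * (1 - κ) * (1 + κ - 2 * κ * X) := by
        have j1 : 0 ≤ (1 - X) * (1 - κ) ^ 2 := mul_nonneg (by linarith) (sq_nonneg _)
        have j2 : 0 ≤ (3 * X + 3 * X ^ 2) * (κ * (1 - κ)) :=
          mul_nonneg (by positivity) (mul_nonneg h0.le (by linarith))
        have j3 : 0 ≤ (2 - 2 * X ^ 3) * κ ^ 2 :=
          mul_nonneg (by linarith [pow_le_one₀ (n := 3) q0.le q1.le]) (sq_nonneg _)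
        linarith
      nlinarith [mul_nonneg (by linarith : 0 ≤ 1 - κ) i3]
    have hdecomp : -(2 * κ * (2 * y)) / (1 + κ - 2 * κ * y ^ 2) - κ * (-(2 * y) / (1 - y ^ 2))
        + κ * ((e - y * o) / (1 - y ^ 2)) / o - 1 / y
        - (1 - κ) * ((o' - y * e') / (1 - y ^ 2)) / e' =
        (y / (1 - y ^ 2)) * ((κ * (e / o) - (1 / y - (1 - κ) * (y * (2 + y ^ 2) / 3))) / y
          + (1 - κ) * (((1 - κ) * y / (1 - κ * y ^ 2)) - o' / e') / y
          + (2 * (1 - κ) / (1 + κ - 2 * κ * y ^ 2)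
            - ((1 - κ) * (2 + y ^ 2) / 3 + (1 - κ) ^ 2 / (1 - κ * y ^ 2)))) := by
      have i1 : 1 - κ * y ^ 2 ≠ 0 := by nlinarith
      have i2 : 1 + κ - 2 * κ * y ^ 2 ≠ 0 := by nlinarith
      have i3 : 1 - y ^ 2 ≠ 0 := by linarith
      field_simp
      ring
    rw [hE, hO, hdecomp]
    refine mul_nonneg (div_nonneg hy0.le (by linarith)) (add_nonneg (add_nonneg ?_ ?_) ?_)
    · exact div_nonneg (by linarith) hy0.le
    · exact div_nonneg (mul_nonneg (by linarith) (by linarith)) hy0.le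
    · linarith

theorem slopeNum_eq_defect (p a b T : ℝ) : slopeNum p a b T =
    (b + T) * (a * evenPow (p - 1) a - oddPow (p - 1) a) * evenPow (p - 1) b
      - (a - T) * evenPow (p - 1) a * (b * evenPow (p - 1) b - oddPow (p - 1) b) := by
  unfold slopeNum; ring

theorem log_defect {κ x : ℝ} (h0 : 0 < κ) (hx0 : 0 < x) (hx1 : x < 1) :
    Real.log (x * evenPow (1 - κ) x - oddPow (1 - κ) x)
      = (1 - κ) * Real.log (1 - x ^ 2) + Real.log (oddPow κ x) := by
  have p1 : 0 < 1 + x := by linarith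
  have p2 : 0 < 1 - x := by linarith
  have e : x * evenPow (1 - κ) x - oddPow (1 - κ) x
      = (1 + x) ^ (1 - κ) * (1 - x) ^ (1 - κ) * oddPow κ x := by
    have := one_sub_sq_mul_oddPow (by linarith : -1 < x) hx1 (1 - κ)
    have h2 : x * evenPow (1 - κ) x - oddPow (1 - κ) x =
      - ((1 - x ^ 2) * oddPow (1 - κ - 1) x) := by linarith
    rw [h2, oddPow, oddPow, show 1 - κ - 1 = -κ by ring, Real.rpow_sub p1, Real.rpow_sub p2,
      Real.rpow_one, Real.rpow_one, Real.rpow_neg p1.le, Real.rpow_neg p2.le]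
    field_simp
    ring
  rw [e, Real.log_mul (by positivity) (oddPow_pos h0 hx0 hx1.le).ne',
    Real.log_mul (by positivity) (by positivity), Real.log_rpow p1, Real.log_rpow p2,
    show 1 - x ^ 2 = (1 + x) * (1 - x) by ring, Real.log_mul p1.ne' p2.ne']
  ring

theorem slopeNum_pos_of_lt_two {p a b T : ℝ} (hp : 1 < p) (hp2 : p < 2) (h : IsInterior p a b T) :
    0 < slopeNum p a b T := by
  obtain ⟨κ, rfl⟩ : ∃ κ, p = 2 - κ := ⟨2 - p, by ring⟩
  have h0 : 0 < κ := by linarith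
  have h1 : κ < 1 := by linarith
  have ha0 := h.a_pos
  have ha1 := h.a_lt_one
  have hb0 := h.b_pos
  have hb1 := h.b_lt_one
  have hba := h.b_lt_a
  have hT := h.T_pos
  have hTd := h.mul_sub_le_T hp hp2
  have hq := h.sq_add_mul_add_sq_le_one (by linarith) hp2.le
  rw [slopeNum_eq_defect, show 2 - κ - 1 = 1 - κ by ring]
  rw [show 2 - κ - 1 = 1 - κ by ring] at hTd
  have hmono := monotoneOn_defect h0 h1 ⟨hb0, hb1⟩ ⟨ha0, ha1⟩ hba.le
  have la := log_defect h0 ha0 ha1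
  have lb := log_defect h0 hb0 hb1
  have Pa := mul_evenPow_sub_oddPow_pos (by linarith : 1 - κ < 1) ha0 ha1
  have Pb := mul_evenPow_sub_oddPow_pos (by linarith : 1 - κ < 1) hb0 hb1
  have Ea := evenPow_pos (p := 1 - κ) ha0.le ha1.le
  have Eb := evenPow_pos (p := 1 - κ) hb0.le hb1.le
  set ea := evenPow (1 - κ) a
  set eb := evenPow (1 - κ) b
  set oa := oddPow (1 - κ) a
  set ob := oddPow (1 - κ) b
  have qa : 0 < 1 - a ^ 2 := by nlinarith
  have qb : 0 < 1 - b ^ 2 := by nlinarith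
  have ga : 0 < 1 + κ - 2 * κ * a ^ 2 := by nlinarith
  have gb : 0 < 1 + κ - 2 * κ * b ^ 2 := by nlinarith
  have hcomp : (1 + κ - 2 * κ * b ^ 2) * (b * eb - ob) * ((1 - a ^ 2) * a * ea) ≤
      (1 + κ - 2 * κ * a ^ 2) * (a * ea - oa) * ((1 - b ^ 2) * b * eb) := by
    rw [← Real.log_le_log_iff (by positivity) (by positivity)]
    rw [Real.log_mul (by positivity) (by positivity), Real.log_mul (by positivity) (by positivity),
      Real.log_mul (by positivity) (by positivity), Real.log_mul (by positivity) (by positivity),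
      Real.log_mul (by positivity) (by positivity), Real.log_mul (by positivity) (by positivity),
      Real.log_mul (by positivity) (by positivity), Real.log_mul (by positivity) (by positivity),
      la, lb]
    simp only at hmono
    linarith
  rcases le_or_gt a T with hTa | hTa
  · have i1 : 0 < (b + T) * (a * ea - oa) * eb := by positivity
    have i2 : (a - T) * (ea * (b * eb - ob)) ≤ 0 :=
      mul_nonpos_of_nonpos_of_nonneg (by linarith) (by positivity)
    nlinarith
  · have hmain : b * (a - T) * (1 + κ - 2 * κ * a ^ 2) * (1 - b ^ 2) <
        a * (b + T) * (1 + κ - 2 * κ * b ^ 2) * (1 - a ^ 2) := by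
      have i1 : 0 < T * (κ * (a * b)) := by positivity
      have i2 : 0 < (a + b) * (a * b) * (2 * T * (1 + κ * (a * b)) - (1 - κ) * (a - b)) :=
        mul_pos (by positivity) (by linarith)
      have i3 : 0 ≤ T * (a + b) * (1 + κ) * (1 - (a ^ 2 + a * b + b ^ 2)) :=
        mul_nonneg (by positivity) (by linarith)
      linarith
    have hm : 0 < (1 + κ - 2 * κ * b ^ 2) * (1 - a ^ 2) * a := by positivity
    have key : 0 < ((b + T) * (a * ea - oa) * eb - (a - T) * ea * (b * eb - ob)) *
        ((1 + κ - 2 * κ * b ^ 2) * (1 - a ^ 2) * a) := by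
      have i1 := mul_le_mul_of_nonneg_left hcomp (by linarith : 0 ≤ a - T)
      have i2 := mul_lt_mul_of_pos_left hmain (mul_pos Pa Eb)
      linarith
    exact pos_of_mul_pos_left key hm.le

end MinkowskiCohn

namespace MinkowskiCohn

open Set Filter Topology

/-- Slopes of a power function with exponent at least `1` towards the point `1`. -/
theorem one_sub_rpow_mul_le {β v w : ℝ} (hβ : 1 ≤ β) (hv : 0 ≤ v) (hvw : v ≤ w) (hw : w < 1) :
    (1 - v ^ β) * (1 - w) ≤ (1 - v) * (1 - w ^ β) := by
  have hv1 : 0 < 1 - v := by linarith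
  have h := (convexOn_rpow hβ).2 (mem_Ici.2 hv) (mem_Ici.2 zero_le_one)
    (div_nonneg (by linarith : 0 ≤ 1 - w) hv1.le) (div_nonneg (by linarith : 0 ≤ w - v) hv1.le)
    (by field_simp; ring)
  simp only [smul_eq_mul, mul_one, Real.one_rpow] at h
  rw [show (1 - w) / (1 - v) * v + (w - v) / (1 - v) = w by field_simp; ring] at h
  have h2 := mul_le_mul_of_nonneg_left h hv1.le
  rw [show (1 - v) * ((1 - w) / (1 - v) * v ^ β + (w - v) / (1 - v)) = (1 - w) * v ^ β + (w - v) by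
    field_simp] at h2
  linarith

theorem one_sub_rpow_le {β w : ℝ} (hβ : 1 ≤ β) (hw : 0 ≤ w) : 1 - w ^ β ≤ β * (1 - w) := by
  have := one_add_mul_self_le_rpow_one_add (by linarith : -1 ≤ w - 1) hβ
  rw [show 1 + (w - 1) = w by ring] at this
  linarith

theorem rpow_sub_rpow_le_of_le_eighth {β v w : ℝ} (hβ : 1 ≤ β) (hv : 0 ≤ v) (hvw : v ≤ w)
    (hw0 : 0 < w) (hw : w ≤ 1 / 8) : w ^ β - v ^ β ≤ w - v := by
  have h1 := one_sub_rpow_le hβ (div_nonneg hv hw0.le)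
  rw [Real.div_rpow hv hw0.le] at h1
  have hwb : 0 < w ^ β := by positivity
  have h2 : w ^ β - v ^ β ≤ β * (1 - v / w) * w ^ β := by
    have := mul_le_mul_of_nonneg_right h1 hwb.le
    rwa [sub_mul, div_mul_cancel₀ _ hwb.ne', one_mul] at this
  have h3 : w ^ β = w * w ^ (β - 1) := rpow_eq_mul_rpow_sub_one hw0 β
  have h4 : β * w ^ (β - 1) ≤ 1 := by
    have i1 : w ^ (β - 1) ≤ (1 / 8 : ℝ) ^ (β - 1) :=
      Real.rpow_le_rpow hw0.le hw (by linarith)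
    have i2 : (1 / 8 : ℝ) ≤ Real.exp (-1) := by
      have := Real.exp_one_lt_d9
      rw [Real.exp_neg, ← one_div]
      exact one_div_le_one_div_of_le (Real.exp_pos 1) (by linarith)
    have i3 : (1 / 8 : ℝ) ^ (β - 1) ≤ Real.exp (-(β - 1)) := by
      have := Real.rpow_le_rpow (by norm_num) i2 (by linarith : 0 ≤ β - 1)
      rwa [← Real.exp_mul, neg_one_mul] at this
    have i4 : β ≤ Real.exp (β - 1) := by linarith [Real.add_one_le_exp (β - 1)]
    calc β * w ^ (β - 1) ≤ Real.exp (β - 1) * Real.exp (-(β - 1)) :=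
          mul_le_mul i4 (i1.trans i3) (by positivity) (Real.exp_pos _).le
      _ = 1 := by rw [← Real.exp_add]; simp
  calc w ^ β - v ^ β ≤ β * (1 - v / w) * w ^ β := h2
    _ = (w - v) * (β * w ^ (β - 1)) := by rw [h3]; field_simp
    _ ≤ (w - v) * 1 := mul_le_mul_of_nonneg_left h4 (by linarith)
    _ = w - v := mul_one _

theorem half_log_sub_add_log_div_le {x y : ℝ} (hx : 0 < x) (hxy : x ≤ y) :
    (Real.log (1 + y) - Real.log (1 + x)) / 2 + Real.log (Real.log (1 + y) / Real.log (1 + x))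
      ≤ Real.log (y / x) := by
  have hL : ∀ t : ℝ, 0 < t → 0 < Real.log (1 + t) := fun t ht => Real.log_pos (by linarith)
  have hmono : MonotoneOn (fun t : ℝ => Real.log t - Real.log (1 + t) / 2
      - Real.log (Real.log (1 + t))) (Ioi 0) := by
    have hd : ∀ t ∈ Ioi (0 : ℝ), HasDerivAt (fun t : ℝ => Real.log t - Real.log (1 + t) / 2
        - Real.log (Real.log (1 + t))) (1 / t - 1 / (1 + t) / 2
          - 1 / (1 + t) / Real.log (1 + t)) t := by
      intro t ht
      have ht : 0 < t := ht
      have d1 := (hasDerivAt_id t).log ht.ne'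
      have d2 := ((hasDerivAt_id t).const_add 1).log (by simp; linarith : 1 + id t ≠ 0)
      exact (d1.sub (d2.div_const 2)).sub (d2.log (hL t ht).ne')
    refine monotoneOn_of_deriv_nonneg (convex_Ioi 0)
      (fun y hy => (hd y hy).continuousAt.continuousWithinAt) ?_ fun t ht => ?_
    · intro y hy
      rw [interior_Ioi] at hy
      exact (hd y hy).differentiableAt.differentiableWithinAt
    · rw [interior_Ioi] at ht
      rw [(hd t ht).deriv]
      have ht : 0 < t := ht
      have h1 := Real.le_log_one_add_of_nonneg ht.le
      rw [div_le_iff₀ (by linarith)] at h1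
      have h2 := hL t ht
      have e : 1 / t - 1 / (1 + t) / 2 - 1 / (1 + t) / Real.log (1 + t)
          = (Real.log (1 + t) * (t + 2) - 2 * t) / (2 * t * (1 + t) * Real.log (1 + t)) := by
        field_simp
        ring
      rw [e]
      exact div_nonneg (by linarith) (by positivity)
  have := hmono hx (hx.trans_le hxy) hxy
  simp only at this
  rw [Real.log_div (hL y (by linarith)).ne' (hL x hx).ne', Real.log_div (by linarith) hx.ne']
  linarith

theorem two_mul_sub_div_le_log_div {x y : ℝ} (hx : 0 < x) (hxy : x ≤ y) :
    2 * (y - x) / (y + x) ≤ Real.log (y / x) := by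
  have h := Real.le_log_one_add_of_nonneg (x := y / x - 1) (by
    rw [sub_nonneg, one_le_div hx]; exact hxy)
  rw [show 1 + (y / x - 1) = y / x by ring] at h
  refine le_trans (le_of_eq ?_) h
  field_simp
  ring

theorem exp_le_of_pow {n m : ℕ} {c : ℝ} (hn : n ≠ 0) (hc : 0 ≤ c)
    (h : (2.7182818286 : ℝ) ^ m ≤ c ^ n) : Real.exp (m / n) ≤ c := by
  refine le_of_pow_le_pow_left₀ hn hc ?_
  rw [← Real.exp_nat_mul, mul_div_cancel₀ _ (by exact_mod_cast hn), ← mul_one (m : ℝ),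
    Real.exp_nat_mul]
  exact (pow_le_pow_left₀ (Real.exp_pos 1).le Real.exp_one_lt_d9.le m).trans h

theorem le_exp_of_pow {n m : ℕ} {c : ℝ} (hn : n ≠ 0)
    (h : c ^ n ≤ (2.7182818283 : ℝ) ^ m) : c ≤ Real.exp (m / n) := by
  refine le_of_pow_le_pow_left₀ hn (Real.exp_pos _).le (h.trans ?_)
  rw [← Real.exp_nat_mul, mul_div_cancel₀ _ (by exact_mod_cast hn), ← mul_one (m : ℝ),
    Real.exp_nat_mul]
  exact pow_le_pow_left₀ (by norm_num) Real.exp_one_gt_d9.le m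

/-- The logarithmic inequality behind the case of large `p`, near the symmetric end point. -/
theorem mul_sub_lt_log_div {p x y : ℝ} (hp : 4 ≤ p) (hx : 0 < x) (hxy : x < y)
    (hy : y ≤ 24 / 100) (h : 1 ≤ Real.exp (-(p * y)) + Real.exp (-(p * x))) :
    (p + 107 / 100) * (y - x) < Real.log (y / x) := by
  have hpx : 0 < p * x := by positivity
  have hpxy : p * x < p * y := by nlinarith
  have hy0 : 0 < y := by linarith
  rcases le_or_gt (p * y) (6 / 5) with h1 | h1
  · have hv : 301 / 1000 ≤ Real.exp (-(p * y)) := by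
      have : (301 / 1000 : ℝ) ≤ Real.exp (-(6 / 5)) := by
        have e1 := exp_le_of_pow (n := 5) (m := 6) (c := 1000 / 301) (by norm_num) (by norm_num)
          (by norm_num)
        norm_num at e1
        rw [Real.exp_neg, ← one_div, le_div_iff₀ (Real.exp_pos _)]
        linarith
      exact this.trans (Real.exp_le_exp.2 (by linarith))
    have hvv : Real.exp (-(p * y)) ≤ Real.exp (-(p * x)) := Real.exp_le_exp.2 (by linarith)
    have hprod : 2103 / 10000 ≤ Real.exp (-(p * y + p * x)) := by
      rw [show -(p * y + p * x) = -(p * y) + -(p * x) by ring, Real.exp_add]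
      set v := Real.exp (-(p * y))
      set v' := Real.exp (-(p * x))
      rcases le_or_gt v (699 / 1000) with h2 | h2
      · nlinarith
      · nlinarith
    have hsum : p * y + p * x ≤ 1563 / 1000 := by
      by_contra! hlt
      have : Real.exp (-(p * y + p * x)) < Real.exp (-(1563 / 1000)) :=
        Real.exp_lt_exp.2 (by linarith)
      have : Real.exp (-(1563 / 1000)) ≤ 2103 / 10000 := by
        have e1 := le_exp_of_pow (n := 16) (m := 25) (c := 10000 / 2103) (by norm_num) (by norm_num)
        norm_num at e1
        have e2 : Real.exp (25 / 16) ≤ Real.exp (1563 / 1000) := Real.exp_le_exp.2 (by norm_num)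
        rw [Real.exp_neg, ← one_div, div_le_iff₀ (Real.exp_pos _)]
        linarith
      linarith
    have hlog := two_mul_sub_div_le_log_div hx hxy.le
    refine lt_of_lt_of_le ?_ hlog
    rw [lt_div_iff₀ (by linarith)]
    have e1 : (p + 107 / 100) * (y + x) ≤ 1563 / 1000 * (1 + 107 / 400) := by nlinarith
    nlinarith
  · have hX : p * x ≤ Real.exp (-(p * y)) * Real.exp (p * x / 2) := by
      have i1 := Real.self_le_sinh_iff.2 (by linarith : 0 ≤ p * x / 2)
      rw [Real.sinh_eq] at i1
      have i2 : Real.exp (-(p * x)) * Real.exp (p * x / 2) = Real.exp (-(p * x / 2)) := by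
        rw [← Real.exp_add]; congr 1; ring
      have i3 := mul_le_mul_of_nonneg_right h (Real.exp_pos (p * x / 2)).le
      nlinarith
    have hlX : Real.log (p * x) ≤ -(p * y) + p * x / 2 := by
      have := Real.log_le_log hpx hX
      rwa [← Real.exp_add, Real.log_exp] at this
    have hdiv : Real.log (y / x) = Real.log (p * y) - Real.log (p * x) := by
      rw [← Real.log_div (by positivity) (by positivity), mul_div_mul_left _ _ (by linarith)]
    have hsmall : 107 / 100 * (y - x) < 2568 / 10000 := by linarith
    have hlog : ∀ t : ℝ, 0 ≤ t → 1 + t ≤ p * y → 2 * t / (t + 2) ≤ Real.log (p * y) := fun t ht hty =>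
      (Real.le_log_one_add_of_nonneg ht).trans (Real.log_le_log (by linarith) hty)
    have h2 := hlog (1 / 5) (by norm_num) (by linarith)
    rw [hdiv]
    rcases le_or_gt (13 / 10) (p * y) with h3 | h3
    · have h4 := hlog (3 / 10) (by norm_num) (by linarith)
      norm_num at h4
      nlinarith
    · norm_num at h2
      rcases le_or_gt (16 / 100) (p * x) with h4 | h4
      · nlinarith
      · have h5 : Real.log (p * x) ≤ -(7 / 5) := by
          rw [Real.log_le_iff_le_exp hpx, Real.exp_neg, ← one_div]
          refine h4.le.trans ?_
          have e1 := exp_le_of_pow (n := 5) (m := 7) (c := 100 / 16) (by norm_num) (by norm_num)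
            (by norm_num)
          norm_num at e1
          rw [le_div_iff₀ (Real.exp_pos _)]
          linarith
        nlinarith

end MinkowskiCohn

namespace MinkowskiCohn

open Set Filter Topology

theorem slope_ineq_far {p x y l : ℝ} (hp : 4 ≤ p) (hx : 0 < x) (hxy : x < y) (hy : y < 1)
    (hl : 1 < l) (h : (l + y ^ p) * (1 + x) ^ p = (1 + l) * (1 - x * y) ^ p)
    (hfar : 27 / 100 ≤ y) :
    (l - y) * x * ((1 + y ^ (p - 1)) * (1 - x ^ (p - 2)))
      < (1 - l * x) * y * ((1 + x ^ (p - 1)) * (1 - y ^ (p - 2))) := by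
  have hy0 : 0 < y := by linarith
  have hxy1 : x * y < 1 := by nlinarith
  have hc : 0 < 1 - x * y := by linarith
  have key : 4 * (l * x) ≤ (1 - y) * (1 + y ^ 2) * (1 - x * y) := by
    have c2 : 0 < (1 - x * y) ^ p := by positivity
    have hc12 : (1 - x * y) ^ p ≤ (1 + x) ^ p :=
      Real.rpow_le_rpow hc.le (by nlinarith) (by linarith)
    set u := x * (1 + y) / (1 - x * y) with hu
    have hu0 : 0 < u := by positivity
    have hb := one_add_mul_self_le_rpow_one_add (by linarith : -1 ≤ u) (by linarith : 1 ≤ p)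
    have e : 1 + x = (1 - x * y) * (1 + u) := by rw [hu]; field_simp; ring
    have hb2 : (1 - x * y) ^ p * (1 + p * u) ≤ (1 + x) ^ p := by
      rw [e, Real.mul_rpow hc.le (by linarith)]
      exact mul_le_mul_of_nonneg_left hb c2.le
    have h4 := one_sub_rpow_le (by linarith : 1 ≤ p / 4) (by positivity : 0 ≤ y ^ (4 : ℝ))
    rw [← Real.rpow_mul hy0.le, mul_div_cancel₀ _ (by norm_num : (4 : ℝ) ≠ 0)] at h4
    rw [show y ^ (4 : ℝ) = y ^ 4 by exact_mod_cast Real.rpow_natCast y 4] at h4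
    have hyp : 0 < y ^ p := by positivity
    have i1 : l * ((1 - x * y) ^ p * (p * u)) ≤ (1 - x * y) ^ p * (p / 4 * (1 - y ^ 4)) := by
      have j1 : l * ((1 - x * y) ^ p * (p * u)) ≤ l * ((1 + x) ^ p - (1 - x * y) ^ p) :=
        mul_le_mul_of_nonneg_left (by linarith) (by linarith)
      have j2 : y ^ p * (1 - x * y) ^ p ≤ y ^ p * (1 + x) ^ p :=
        mul_le_mul_of_nonneg_left hc12 hyp.le
      have j3 := mul_le_mul_of_nonneg_left h4 c2.le
      linarith
    have i2 : 4 * (l * u) ≤ 1 - y ^ 4 := by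
      have : (1 - x * y) ^ p * p * (4 * (l * u)) ≤ (1 - x * y) ^ p * p * (1 - y ^ 4) := by linarith
      exact le_of_mul_le_mul_left this (by positivity)
    have i3 : u * (1 - x * y) = x * (1 + y) := by rw [hu]; field_simp
    have i4 := mul_le_mul_of_nonneg_right i2 hc.le
    have i5 : (4 * (l * x)) * (1 + y) ≤ ((1 - y) * (1 + y ^ 2) * (1 - x * y)) * (1 + y) := by
      linear_combination i4 - 4 * l * i3
    exact le_of_mul_le_mul_right i5 (by linarith)
  have hlx : l * x < y * (1 - y) := by
    have : (1 - y) * (1 + y ^ 2) * (1 - x * y) < (1 - y) * (4 * y) * 1 := by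
      have k1 : 1 + y ^ 2 < 4 * y := by nlinarith
      exact mul_lt_mul'' (by nlinarith) (by nlinarith [mul_pos hx hy0])
        (mul_nonneg (by linarith) (by positivity)) hc.le
    linarith
  have hxs : 0 ≤ x ^ (p - 1) := by positivity
  have hxk : 0 ≤ x ^ (p - 2) := by positivity
  have hys : y ^ (p - 1) ≤ y ^ 3 := by
    rw [← Real.rpow_natCast]
    exact Real.rpow_le_rpow_of_exponent_ge hy0 hy.le (by push_cast; linarith)
  have hyk : y ^ (p - 2) ≤ y ^ 2 := by
    rw [← Real.rpow_natCast]
    exact Real.rpow_le_rpow_of_exponent_ge hy0 hy.le (by push_cast; linarith)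
  have hys0 : 0 ≤ y ^ (p - 1) := by positivity
  have hl1 : 0 < 1 - l * x := by nlinarith
  calc (l - y) * x * ((1 + y ^ (p - 1)) * (1 - x ^ (p - 2)))
      ≤ (l - y) * x * ((1 + y ^ 3) * 1) := by
        refine mul_le_mul_of_nonneg_left ?_ (mul_nonneg (by linarith) hx.le)
        have hx1 : x ^ (p - 2) ≤ 1 := Real.rpow_le_one hx.le (by linarith) (by linarith)
        exact mul_le_mul (by linarith) (by linarith) (by linarith) (by positivity)
    _ < (1 - l * x) * y * (1 * (1 - y ^ 2)) := by
        have : (l - y) * x * (1 - y + y ^ 2) < (1 - l * x) * y * (1 - y) := by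
          have : 0 < x * y * (1 - y + y ^ 2) := by
            have := mul_pos hx hy0
            have : 0 < 1 - y + y ^ 2 := by nlinarith
            positivity
          nlinarith
        nlinarith
    _ ≤ (1 - l * x) * y * ((1 + x ^ (p - 1)) * (1 - y ^ (p - 2))) := by
        refine mul_le_mul_of_nonneg_left ?_ (mul_nonneg hl1.le hy0.le)
        exact mul_le_mul (by linarith) (by linarith) (by nlinarith) (by positivity)

theorem ratio_poly_ineq {x y : ℝ} (hx : 0 < x) (hxy : x < y) (hx19 : x ≤ 19 / 100)
    (hy : y ≤ 27 / 100) : (1 - x ^ 2) * (1 + y ^ 3 - x ^ 3)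
      ≤ (1 + 57 / 100 * (1 + x) * (y - x)) * (1 - y ^ 2) := by
  have hy0 : 0 < y := by linarith
  have h1 : (y + x) + (1 - x ^ 2) * (y ^ 2 + y * x + x ^ 2) ≤ 57 / 100 * (1 + x) * (1 - y ^ 2) := by
    have e1 : y ^ 2 ≤ (27 / 100) ^ 2 := by gcongr
    have e2 : (1 - x ^ 2) * (y ^ 2 + y * x + x ^ 2)
        ≤ (1 - x ^ 2) * ((27 / 100) ^ 2 + 27 / 100 * x + x ^ 2) := by
      have : 0 ≤ 1 - x ^ 2 := by nlinarith
      gcongr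
    have e3 : 57 / 100 * (1 + x) * (1 - (27 / 100) ^ 2) ≤ 57 / 100 * (1 + x) * (1 - y ^ 2) := by
      gcongr
    have e4 : (27 / 100 + x) + (1 - x ^ 2) * ((27 / 100) ^ 2 + 27 / 100 * x + x ^ 2)
        ≤ 57 / 100 * (1 + x) * (1 - (27 / 100) ^ 2) := by
      have f1 := mul_le_mul_of_nonneg_left hx19 hx.le
      have f2 := pow_pos hx 3
      have f3 := pow_pos hx 4
      linarith
    linarith
  have := mul_le_mul_of_nonneg_left h1 (sub_nonneg.2 hxy.le)
  linarith

set_option maxHeartbeats 1000000 in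
theorem slope_ineq_near {p x y l : ℝ} (hp : 4 ≤ p) (hx : 0 < x) (hxy : x < y)
    (hl : 1 < l) (hA : (1 + l * x ^ p) * (1 + y) ^ p = (1 + l) * (1 - x * y) ^ p)
    (hB : (l + y ^ p) * (1 + x) ^ p = (1 + l) * (1 - x * y) ^ p)
    (hnear : y ≤ 27 / 100) :
    (l - y) * x * ((1 + y ^ (p - 1)) * (1 - x ^ (p - 2)))
      < (1 - l * x) * y * ((1 + x ^ (p - 1)) * (1 - y ^ (p - 2))) := by
  have hy0 : 0 < y := by linarith
  have hxy1 : x * y < 1 := by nlinarith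
  have hU : 0 < (1 + x) ^ p := by positivity
  have hV : 0 < (1 + y) ^ p := by positivity
  have hp0 : 0 ≤ p := by linarith
  have hlV : l * (1 + x) ^ p ≤ (1 + y) ^ p := by
    have h1 : x ^ p * ((1 + y) ^ p * (1 + y) ^ p) ≤ y ^ p * ((1 + x) ^ p * (1 + x) ^ p) := by
      rw [← Real.mul_rpow (by positivity) (by positivity),
        ← Real.mul_rpow (by positivity) (by positivity),
        ← Real.mul_rpow (by positivity) (by positivity),
        ← Real.mul_rpow (by positivity) (by positivity)]
      refine Real.rpow_le_rpow (by positivity) ?_ hp0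
      nlinarith [mul_pos (sub_pos.2 hxy) (sub_pos.2 hxy1)]
    have h2 : x ^ p * (1 + y) ^ p < (1 + x) ^ p := by
      rw [← Real.mul_rpow (by positivity) (by positivity)]
      exact Real.rpow_lt_rpow (by positivity) (by nlinarith) (by linarith)
    have h3 : 0 < (1 + x) ^ p - x ^ p * (1 + y) ^ p := by linarith
    have h4 : l * (1 + x) ^ p * ((1 + x) ^ p - x ^ p * (1 + y) ^ p)
        ≤ (1 + y) ^ p * ((1 + x) ^ p - x ^ p * (1 + y) ^ p) := by
      linear_combination h1 + (1 + x) ^ p * (hB - hA)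
    exact le_of_mul_le_mul_right h4 h3
  have hsum : 1 ≤ ((1 + y) ^ p)⁻¹ + ((1 + x) ^ p)⁻¹ := by
    have hW0 : 0 ≤ (1 - x * y) ^ p := Real.rpow_nonneg (by linarith) _
    have hW : (1 - x * y) ^ p ≤ 1 := Real.rpow_le_one (by linarith) (by nlinarith) hp0
    have h1 : 1 + l * x ^ p = (1 + l) * (1 - x * y) ^ p * ((1 + y) ^ p)⁻¹ := by
      rw [← hA]; field_simp
    have h2 : l + y ^ p = (1 + l) * (1 - x * y) ^ p * ((1 + x) ^ p)⁻¹ := by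
      rw [← hB]; field_simp
    have h3 : 0 < x ^ p := by positivity
    have h4 : 0 < y ^ p := by positivity
    have h5 : (1 + l) * 1 ≤ (1 + l) * (((1 + y) ^ p)⁻¹ + ((1 + x) ^ p)⁻¹) := by
      have i1 : 0 < l * x ^ p := by positivity
      have i2 : (1 + l) * ((1 - x * y) ^ p * (((1 + y) ^ p)⁻¹ + ((1 + x) ^ p)⁻¹))
          ≤ (1 + l) * (1 * (((1 + y) ^ p)⁻¹ + ((1 + x) ^ p)⁻¹)) :=
        mul_le_mul_of_nonneg_left (mul_le_mul_of_nonneg_right hW (by positivity)) (by linarith)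
      linarith
    exact le_of_mul_le_mul_left h5 (by linarith)
  have hx19 : x ≤ 19 / 100 := by
    by_contra! hlt
    have h1 : (1 + x) ^ p ≤ (1 + y) ^ p := Real.rpow_le_rpow (by positivity) (by linarith) hp0
    have h2 : (119 / 100 : ℝ) ^ 4 ≤ (1 + x) ^ p := by
      have : (1 + x) ^ (4 : ℝ) ≤ (1 + x) ^ p :=
        Real.rpow_le_rpow_of_exponent_le (by linarith) hp
      refine le_trans ?_ this
      rw [show (1 + x) ^ (4 : ℝ) = (1 + x) ^ 4 by exact_mod_cast Real.rpow_natCast (1 + x) 4]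
      exact pow_le_pow_left₀ (by norm_num) (by linarith) 4
    have h3 := inv_anti₀ hU h1
    have h4 := inv_anti₀ (by norm_num) h2
    norm_num at h4
    linarith
  set R := 1 + 57 / 100 * (1 + x) * (y - x) with hR
  have hR1 : 1 < R := by
    have : 0 < 57 / 100 * (1 + x) * (y - x) := by
      have := sub_pos.2 hxy
      positivity
    linarith
  have hLx : 0 < Real.log (1 + x) := Real.log_pos (by linarith)
  have hLxy : Real.log (1 + x) < Real.log (1 + y) := Real.log_lt_log (by linarith) (by linarith)
  have hyx : (1 + y) / (1 + x) = Real.exp (Real.log (1 + y) - Real.log (1 + x)) := by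
    rw [Real.exp_sub, Real.exp_log (by linarith), Real.exp_log (by linarith)]
  have hmain : l * x * (R + y) < y * (1 + x * R) := by
    have hlog := mul_sub_lt_log_div hp hLx hLxy (by
      rw [Real.log_le_iff_le_exp (by linarith)]
      have := le_exp_of_pow (n := 25) (m := 6) (c := 127 / 100) (by norm_num) (by norm_num)
      norm_num at this ⊢
      linarith) (by
      rw [mul_comm p, mul_comm p, ← mul_neg, ← mul_neg, ← Real.rpow_def_of_pos (by linarith),
        ← Real.rpow_def_of_pos (by linarith), Real.rpow_neg (by linarith),
        Real.rpow_neg (by linarith)]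
      exact hsum)
    have hhalf := half_log_sub_add_log_div_le hx hxy.le
    set D := Real.log (1 + y) - Real.log (1 + x) with hD
    have h1 : l ≤ Real.exp (p * D) := by
      have : l ≤ (1 + y) ^ p / (1 + x) ^ p := by rwa [le_div_iff₀ hU]
      rwa [← Real.div_rpow (by positivity) (by positivity), hyx, ← Real.exp_mul, mul_comm D] at this
    have h2 : 1 + 57 / 100 * ((y - x) / (1 + y)) ≤ Real.exp (57 / 100 * D) := by
      have h3 : (y - x) / (1 + y) ≤ D := by
        have := Real.one_sub_inv_le_log_of_pos (by positivity : 0 < (1 + y) / (1 + x))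
        rw [Real.log_div (by linarith) (by linarith)] at this
        refine le_trans (le_of_eq ?_) this
        field_simp
        ring
      linarith [Real.add_one_le_exp (57 / 100 * D)]
    have h3 : l * ((1 + y) / (1 + x)) * (1 + 57 / 100 * ((y - x) / (1 + y))) < y / x := by
      have h0 : 0 ≤ (y - x) / (1 + y) := div_nonneg (by linarith) (by linarith)
      calc _ ≤ Real.exp (p * D) * Real.exp D * Real.exp (57 / 100 * D) := by
            rw [hyx]
            gcongr
        _ = Real.exp ((p + 157 / 100) * D) := by
            rw [← Real.exp_add, ← Real.exp_add]; congr 1; ring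
        _ < y / x := by
            rw [← Real.lt_log_iff_exp_lt (by positivity)]
            linarith
    have h4 : (R + y) * (1 + x) ≤ (1 + x * R) * (1 + y + 57 / 100 * (y - x)) := by
      have e : (1 + x * R) * (1 + y + 57 / 100 * (y - x)) - (R + y) * (1 + x)
          = (1 + x) * x * (57 / 100 * (y - x)) * (y + 57 / 100 * (y - x)) := by rw [hR]; ring
      have := sub_pos.2 hxy
      have : 0 ≤ (1 + x) * x * (57 / 100 * (y - x)) * (y + 57 / 100 * (y - x)) := by positivity
      linarith
    have h5 : l * x * (1 + y + 57 / 100 * (y - x)) < y * (1 + x) := by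
      rw [lt_div_iff₀ hx] at h3
      have := mul_lt_mul_of_pos_right h3 (by linarith : 0 < 1 + x)
      refine lt_of_eq_of_lt ?_ this
      field_simp
    have h6 : l * x * (R + y) * (1 + x) < y * (1 + x * R) * (1 + x) := by
      have i1 := mul_le_mul_of_nonneg_left h4 (by positivity : 0 ≤ l * x)
      have i2 := mul_lt_mul_of_pos_left h5 (by positivity : 0 < 1 + x * R)
      linarith
    exact lt_of_mul_lt_mul_right h6 (by linarith)
  have hk1 : 0 ≤ 1 - x ^ (p - 2) := by
    have := Real.rpow_le_one hx.le (by linarith) (by linarith : 0 ≤ p - 2)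
    linarith
  have hk2 : 0 < 1 - y ^ (p - 2) := by
    have := Real.rpow_lt_one hy0.le (by linarith) (by linarith : 0 < p - 2)
    linarith
  have hkk : (1 - x ^ (p - 2)) * (1 - y ^ 2) ≤ (1 - x ^ 2) * (1 - y ^ (p - 2)) := by
    have := one_sub_rpow_mul_le (β := (p - 2) / 2) (by linarith) (by positivity : 0 ≤ x ^ 2)
      (by gcongr : x ^ 2 ≤ y ^ 2) (by nlinarith)
    have e : ∀ t : ℝ, 0 ≤ t → (t ^ 2) ^ ((p - 2) / 2) = t ^ (p - 2) := fun t ht => by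
      rw [← Real.rpow_natCast, ← Real.rpow_mul ht]
      congr 1; push_cast; ring
    rwa [e x hx.le, e y hy0.le] at this
  have hss : 1 + y ^ (p - 1) ≤ (1 + x ^ (p - 1)) * (1 + y ^ 3 - x ^ 3) := by
    have h3 : y ^ 3 ≤ 1 / 8 := by
      have : y ^ 3 ≤ (27 / 100) ^ 3 := by gcongr
      norm_num at this; linarith
    have hxy3 : x ^ 3 ≤ y ^ 3 := by gcongr
    have := rpow_sub_rpow_le_of_le_eighth (β := (p - 1) / 3) (by linarith)
      (by positivity : 0 ≤ x ^ 3) hxy3 (by positivity) h3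
    have e : ∀ t : ℝ, 0 ≤ t → (t ^ 3) ^ ((p - 1) / 3) = t ^ (p - 1) := fun t ht => by
      rw [← Real.rpow_natCast, ← Real.rpow_mul ht]
      congr 1; push_cast; ring
    rw [e x hx.le, e y hy0.le] at this
    have h0 : 0 ≤ x ^ (p - 1) := by positivity
    nlinarith [mul_nonneg h0 (sub_nonneg.2 hxy3)]
  have hpoly := ratio_poly_ineq hx hxy hx19 hnear
  rw [← hR] at hpoly
  have hM : (1 + y ^ (p - 1)) * (1 - x ^ (p - 2))
      ≤ R * ((1 + x ^ (p - 1)) * (1 - y ^ (p - 2))) := by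
    have hy2 : 0 < 1 - y ^ 2 := by nlinarith
    refine le_of_mul_le_mul_right ?_ hy2
    have h0 : 0 ≤ x ^ (p - 1) := by positivity
    have hxy3 : x ^ 3 ≤ y ^ 3 := by gcongr
    calc (1 + y ^ (p - 1)) * (1 - x ^ (p - 2)) * (1 - y ^ 2)
        = (1 + y ^ (p - 1)) * ((1 - x ^ (p - 2)) * (1 - y ^ 2)) := by ring
      _ ≤ ((1 + x ^ (p - 1)) * (1 + y ^ 3 - x ^ 3)) * ((1 - x ^ 2) * (1 - y ^ (p - 2))) :=
          mul_le_mul hss hkk (mul_nonneg hk1 hy2.le)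
            (mul_nonneg (by linarith) (by linarith))
      _ = ((1 + x ^ (p - 1)) * (1 - y ^ (p - 2))) * ((1 - x ^ 2) * (1 + y ^ 3 - x ^ 3)) := by ring
      _ ≤ ((1 + x ^ (p - 1)) * (1 - y ^ (p - 2))) * (R * (1 - y ^ 2)) :=
          mul_le_mul_of_nonneg_left hpoly (mul_nonneg (by linarith) hk2.le)
      _ = _ := by ring
  have h0 : 0 ≤ x ^ (p - 1) := by positivity
  have hMpos : 0 < (1 + x ^ (p - 1)) * (1 - y ^ (p - 2)) := mul_pos (by linarith) hk2
  calc _ ≤ (l - y) * x * (R * ((1 + x ^ (p - 1)) * (1 - y ^ (p - 2)))) :=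
        mul_le_mul_of_nonneg_left hM (mul_nonneg (by linarith) hx.le)
    _ = ((l - y) * x * R) * ((1 + x ^ (p - 1)) * (1 - y ^ (p - 2))) := by ring
    _ < _ := mul_lt_mul_of_pos_right (by linarith) hMpos

end MinkowskiCohn

namespace MinkowskiCohn

open Set Filter Topology

theorem evenPow_moebius {x : ℝ} (hx : 0 < x) (q : ℝ) :
    evenPow q ((1 - x) / (1 + x)) = (2 / (1 + x)) ^ q / 2 * (1 + x ^ q) := by
  unfold evenPow
  rw [show 1 + (1 - x) / (1 + x) = 2 / (1 + x) by field_simp; ring,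
    show 1 - (1 - x) / (1 + x) = 2 / (1 + x) * x by field_simp; ring,
    Real.mul_rpow (by positivity) hx.le]
  ring

theorem oddPow_moebius {x : ℝ} (hx : 0 < x) (q : ℝ) :
    oddPow q ((1 - x) / (1 + x)) = (2 / (1 + x)) ^ q / 2 * (1 - x ^ q) := by
  unfold oddPow
  rw [show 1 + (1 - x) / (1 + x) = 2 / (1 + x) by field_simp; ring,
    show 1 - (1 - x) / (1 + x) = 2 / (1 + x) * x by field_simp; ring,
    Real.mul_rpow (by positivity) hx.le]
  ring

theorem exists_moebius {x : ℝ} (h0 : -1 < x) (h1 : x < 1) :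
    ∃ y, 0 < y ∧ x = (1 - y) / (1 + y) ∧ y = (1 - x) / (1 + x) := by
  have h2 : 0 < 1 + x := by linarith
  refine ⟨(1 - x) / (1 + x), div_pos (by linarith) h2, ?_, rfl⟩
  field_simp
  ring

theorem slopeNum_pos_of_four_le {p a b T : ℝ} (hp : 4 ≤ p) (h : IsInterior p a b T) :
    0 < slopeNum p a b T := by
  have ha0 := h.a_pos
  have ha1 := h.a_lt_one
  have hb0 := h.b_pos
  have hb1 := h.b_lt_one
  have hba := h.b_lt_a
  have hT0 := h.T_pos
  have hT1 := h.T_lt_one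
  obtain ⟨x, hx, rfl, hx'⟩ := exists_moebius (by linarith : -1 < a) ha1
  obtain ⟨y, hy, rfl, hy'⟩ := exists_moebius (by linarith : -1 < b) hb1
  obtain ⟨l, rfl, hl⟩ : ∃ l : ℝ, T = (l - 1) / (l + 1) ∧ 1 < l := by
    refine ⟨(1 + T) / (1 - T), ?_, ?_⟩
    · have : 0 < 1 - T := by linarith
      field_simp
      ring
    · rw [lt_div_iff₀ (by linarith)]; linarith
  clear hx' hy'
  have hxy : x < y := by
    rw [div_lt_div_iff₀ (by linarith) (by linarith)] at hba
    nlinarith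
  have hy1 : y < 1 := by
    by_contra! hc
    exact absurd hb0 (not_lt.2 (div_nonpos_of_nonpos_of_nonneg (by linarith) (by linarith)))
  have hxy1 : x * y < 1 := by nlinarith
  have eab : (1 - x) / (1 + x) + (1 - y) / (1 + y) = 2 / (1 + x) * (1 - x * y) / (1 + y) := by
    field_simp; ring
  have hW : 0 < 1 - x * y := by linarith
  have hc : ((1 - x) / (1 + x) + (1 - y) / (1 + y)) ^ p
      = (2 / (1 + x)) ^ p * (1 - x * y) ^ p / (1 + y) ^ p := by
    rw [eab, Real.div_rpow (by positivity) (by positivity), Real.mul_rpow (by positivity) hW.le]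
  have hc' : ((1 - x) / (1 + x) + (1 - y) / (1 + y)) ^ p
      = (2 / (1 + y)) ^ p * (1 - x * y) ^ p / (1 + x) ^ p := by
    rw [eab, show 2 / (1 + x) * (1 - x * y) / (1 + y) = 2 / (1 + y) * (1 - x * y) / (1 + x) by ring,
      Real.div_rpow (by positivity) (by positivity), Real.mul_rpow (by positivity) hW.le]
  have hA : (1 + l * x ^ p) * (1 + y) ^ p = (1 + l) * (1 - x * y) ^ p := by
    have := h.eq_a
    rw [evenPow_moebius hx, oddPow_moebius hx, hc] at this
    have h1 : 0 < (2 / (1 + x)) ^ p := by positivity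
    have h2 : 0 < (1 + y) ^ p := by positivity
    have h3 : 0 < l + 1 := by linarith
    field_simp at this
    linarith
  have hB : (l + y ^ p) * (1 + x) ^ p = (1 + l) * (1 - x * y) ^ p := by
    have := h.eq_b
    rw [evenPow_moebius hy, oddPow_moebius hy, hc'] at this
    have h1 : 0 < (2 / (1 + y)) ^ p := by positivity
    have h2 : 0 < (1 + x) ^ p := by positivity
    have h3 : 0 < l + 1 := by linarith
    field_simp at this
    rw [mul_comm y x] at this
    linarith
  have key : (l - y) * x * ((1 + y ^ (p - 1)) * (1 - x ^ (p - 2)))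
      < (1 - l * x) * y * ((1 + x ^ (p - 1)) * (1 - y ^ (p - 2))) := by
    rcases le_total y (27 / 100) with hn | hf
    · exact slope_ineq_near hp hx hxy hl hA hB hn
    · exact slope_ineq_far hp hx hxy hy1 hl hB hf
  have d1 := one_sub_sq_mul_oddPow (by linarith : -1 < (1 - x) / (1 + x)) ha1 (p - 1)
  have d2 := one_sub_sq_mul_oddPow (by linarith : -1 < (1 - y) / (1 + y)) hb1 (p - 1)
  rw [show p - 1 - 1 = p - 2 by ring, oddPow_moebius hx (p - 2)] at d1
  rw [show p - 1 - 1 = p - 2 by ring, oddPow_moebius hy (p - 2)] at d2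
  have e1 : ∀ t : ℝ, 0 < t → (2 / (1 + t)) ^ (p - 1) = 2 / (1 + t) * (2 / (1 + t)) ^ (p - 2) := by
    intro t ht
    rw [rpow_eq_mul_rpow_sub_one (by positivity) (p - 1)]
    congr 2; ring
  have e : slopeNum p ((1 - x) / (1 + x)) ((1 - y) / (1 + y)) ((l - 1) / (l + 1))
      = 4 * (2 / (1 + x)) ^ (p - 2) * (2 / (1 + y)) ^ (p - 2)
        / ((1 + l) * (1 + x) ^ 2 * (1 + y) ^ 2)
        * ((1 - l * x) * y * ((1 + x ^ (p - 1)) * (1 - y ^ (p - 2)))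
          - (l - y) * x * ((1 + y ^ (p - 1)) * (1 - x ^ (p - 2)))) := by
    have d1' := congrArg Neg.neg d1
    have d2' := congrArg Neg.neg d2
    rw [neg_sub] at d1' d2'
    rw [slopeNum_eq_defect, ← d1', ← d2', evenPow_moebius hx, evenPow_moebius hy, e1 x hx, e1 y hy]
    have h3 : 0 < l + 1 := by linarith
    field_simp
    ring
  rw [e]
  have : 0 < 1 + l := by linarith
  exact mul_pos (by positivity) (sub_pos.2 key)

end MinkowskiCohn

namespace MinkowskiCohn

open Set Filter Topology

/-- The quotient `C(β, n + 2 j) / C(β, n)` of binomial coefficients. -/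
noncomputable def chooseRatio (β : ℝ) (n : ℕ) : ℕ → ℝ
  | 0 => 1
  | j + 1 => chooseRatio β n j * ((β - (n + 2 * j)) * (β - (n + 2 * j) - 1)
      / ((n + 2 * j + 1) * (n + 2 * j + 2)))

theorem chooseRatio_zero (β : ℝ) (n : ℕ) : chooseRatio β n 0 = 1 := rfl

theorem chooseRatio_succ (β : ℝ) (n j : ℕ) : chooseRatio β n (j + 1) =
    chooseRatio β n j * ((β - (n + 2 * j)) * (β - (n + 2 * j) - 1)
      / ((n + 2 * j + 1) * (n + 2 * j + 2))) := rfl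

theorem chooseRatio_succ' (β : ℝ) (n j : ℕ) : chooseRatio β n (j + 1) =
    (β - n) * (β - n - 1) / ((n + 1) * (n + 2)) * chooseRatio β (n + 2) j := by
  induction j with
  | zero => rw [chooseRatio_succ]; simp [chooseRatio_zero]
  | succ j ih =>
    rw [chooseRatio_succ, ih, chooseRatio_succ]
    push_cast
    ring

theorem choose_succ (β : ℝ) (n : ℕ) :
    Ring.choose β (n + 1) = Ring.choose β n * (β - n) / (n + 1) := by
  have h1 := Ring.descPochhammer_eq_factorial_smul_choose β (n + 1)
  have h2 := Ring.descPochhammer_eq_factorial_smul_choose β n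
  rw [descPochhammer_succ_right, Polynomial.smeval_mul, h2] at h1
  rw [Polynomial.smeval_sub] at h1
  simp [Nat.factorial_succ, Polynomial.smeval_X, Polynomial.smeval_natCast] at h1
  have h3 : ((n : ℝ) + 1) ≠ 0 := by positivity
  have h4 : (n.factorial : ℝ) ≠ 0 := by positivity
  field_simp
  apply mul_left_cancel₀ h4
  linarith

theorem choose_add_two_mul (β : ℝ) (n j : ℕ) :
    Ring.choose β (n + 2 * j) = Ring.choose β n * chooseRatio β n j := by
  induction j with
  | zero => simp [chooseRatio_zero]
  | succ j ih =>
    rw [show n + 2 * (j + 1) = n + 2 * j + 1 + 1 by ring, choose_succ, choose_succ, ih,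
      chooseRatio_succ]
    have h1 : (n : ℝ) + 2 * j + 1 ≠ 0 := by positivity
    have h2 : (n : ℝ) + 2 * j + 2 ≠ 0 := by positivity
    push_cast
    field_simp
    ring

theorem hasSum_of_eq {f g : ℕ → ℝ} {a b : ℝ} (h : HasSum f a) (hf : ∀ j, g j = f j) (hab : b = a) :
    HasSum g b := by
  obtain rfl : g = f := funext hf
  rwa [hab]

theorem hasSum_choose {x : ℝ} (hx : |x| < 1) (q : ℝ) :
    HasSum (fun n : ℕ => Ring.choose q n * x ^ n) ((1 + x) ^ q) := by
  have := (Real.one_add_rpow_hasFPowerSeriesOnBall_zero (a := q)).hasSum (y := x)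
    (by simpa [Metric.mem_eball, edist_eq_enorm_sub, enorm_eq_nnnorm, ← NNReal.coe_lt_coe] using hx)
  rw [zero_add] at this
  refine this.congr_fun fun n => ?_
  rw [binomialSeries_apply]
  simp

theorem hasSum_evenPow {x : ℝ} (hx : |x| < 1) (q : ℝ) :
    HasSum (fun j : ℕ => Ring.choose q (2 * j) * x ^ (2 * j)) (evenPow q x) := by
  have h := ((hasSum_choose hx q).add (hasSum_choose (x := -x) (by simpa using hx) q)).div_const 2
  have hi : Function.Injective (fun j : ℕ => 2 * j) := fun i j h => by simpa using h
  rw [← hi.hasSum_iff] at h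
  · refine hasSum_of_eq h (fun j => ?_) ?_
    · dsimp only [Function.comp]
      simp [pow_mul]
    · unfold evenPow; ring_nf
  · intro n hn
    have : Odd n := by
      rw [← Nat.not_even_iff_odd]
      rintro ⟨m, rfl⟩
      exact hn ⟨m, by simp; ring⟩
    simp [this.neg_pow]

theorem hasSum_oddPow {x : ℝ} (hx : |x| < 1) (q : ℝ) :
    HasSum (fun j : ℕ => Ring.choose q (1 + 2 * j) * x ^ (1 + 2 * j)) (oddPow q x) := by
  have h := ((hasSum_choose hx q).sub (hasSum_choose (x := -x) (by simpa using hx) q)).div_const 2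
  have hi : Function.Injective (fun j : ℕ => 1 + 2 * j) := fun i j h => by simpa using h
  rw [← hi.hasSum_iff] at h
  · refine hasSum_of_eq h (fun j => ?_) ?_
    · dsimp only [Function.comp]
      have : Odd (1 + 2 * j) := ⟨j, by ring⟩
      simp [this.neg_pow]
    · unfold oddPow; ring_nf
  · intro n hn
    have : Even n := by
      rw [← Nat.not_odd_iff_even]
      rintro ⟨m, rfl⟩
      exact hn ⟨m, by simp; ring⟩
    simp [this.neg_pow]

theorem choose_one (q : ℝ) : Ring.choose q 1 = q := by simp

theorem choose_two (q : ℝ) : Ring.choose q 2 = q * (q - 1) / 2 := by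
  rw [show 2 = 1 + 1 by rfl, choose_succ, choose_one]; norm_num

theorem choose_three (q : ℝ) : Ring.choose q 3 = q * (q - 1) * (q - 2) / 6 := by
  rw [show 3 = 2 + 1 by rfl, choose_succ, choose_two]; norm_num; ring

theorem hasSum_chooseRatio_one {x q : ℝ} (hx : |x| < 1) (hx0 : x ≠ 0) (hq : q ≠ 0) :
    HasSum (fun j : ℕ => chooseRatio q 1 j * (x ^ 2) ^ j) (oddPow q x / (q * x)) := by
  refine hasSum_of_eq ((hasSum_oddPow hx q).div_const (q * x)) (fun j => ?_) rfl
  rw [choose_add_two_mul, choose_one, ← pow_mul, pow_add]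
  field_simp

theorem hasSum_chooseRatio_two {x q : ℝ} (hx : |x| < 1) (hx0 : x ≠ 0) (hq : q * (q - 1) ≠ 0) :
    HasSum (fun j : ℕ => chooseRatio q 2 j * (x ^ 2) ^ j)
      ((evenPow q x - 1) / (q * (q - 1) / 2 * x ^ 2)) := by
  have h := hasSum_evenPow hx q
  rw [← hasSum_nat_add_iff' 1] at h
  refine hasSum_of_eq (h.div_const (q * (q - 1) / 2 * x ^ 2)) (fun j => ?_) ?_
  · rw [show 2 * (j + 1) = 2 + 2 * j by ring, choose_add_two_mul, choose_two, ← pow_mul, pow_add]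
    field_simp
    rw [eq_div_iff hq]
    ring
  · simp

theorem hasSum_chooseRatio_three {x q : ℝ} (hx : |x| < 1) (hx0 : x ≠ 0)
    (hq : q * (q - 1) * (q - 2) ≠ 0) :
    HasSum (fun j : ℕ => chooseRatio q 3 j * (x ^ 2) ^ j)
      ((oddPow q x - q * x) / (q * (q - 1) * (q - 2) / 6 * x ^ 3)) := by
  have h := hasSum_oddPow hx q
  rw [← hasSum_nat_add_iff' 1] at h
  refine hasSum_of_eq (h.div_const (q * (q - 1) * (q - 2) / 6 * x ^ 3)) (fun j => ?_) ?_
  · rw [show 1 + 2 * (j + 1) = 3 + 2 * j by ring, choose_add_two_mul, choose_three, ← pow_mul,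
      pow_add]
    field_simp
    rw [eq_div_iff hq]
    ring
  · simp

theorem chooseRatio_nonneg {β : ℝ} {n : ℕ} (hn : β ≤ n) (j : ℕ) : 0 ≤ chooseRatio β n j := by
  induction j with
  | zero => simp [chooseRatio_zero]
  | succ j ih =>
    rw [chooseRatio_succ]
    have h1 : 0 ≤ (n : ℝ) + 2 * j - β := by have : (0:ℝ) ≤ j := by positivity
                                            linarith
    refine mul_nonneg ih (div_nonneg ?_ (by positivity))
    nlinarith

theorem sum_chooseRatio_le {β : ℝ} (hβ : 0 < β) (N : ℕ) : ∀ n : ℕ, β ≤ n →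
    ∑ j ∈ Finset.range N, chooseRatio β n j ≤ (1 + n / β) / 2 := by
  induction N with
  | zero =>
    intro n hn
    simp only [Finset.range_zero, Finset.sum_empty]
    positivity
  | succ N ih =>
    intro n hn
    rw [Finset.sum_range_succ']
    simp only [chooseRatio_succ', chooseRatio_zero]
    rw [← Finset.mul_sum]
    have h1 := ih (n + 2) (by push_cast; linarith)
    have hr : 0 ≤ (β - n) * (β - n - 1) / (((n : ℝ) + 1) * (n + 2)) :=
      div_nonneg (by nlinarith) (by positivity)
    refine (add_le_add_left (mul_le_mul_of_nonneg_left h1 hr) 1).trans ?_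
    push_cast
    have h2 : (β - n) * (β - n - 1) / (((n : ℝ) + 1) * (n + 2)) * (β + n + 2) ≤ n - β := by
      rw [div_mul_eq_mul_div, div_le_iff₀ (by positivity)]
      have : (n - β) * ((n + 1 - β) * (n + 2 + β)) ≤ (n - β) * (((n : ℝ) + 1) * (n + 2)) :=
        mul_le_mul_of_nonneg_left (by nlinarith) (by linarith)
      linarith
    have h3 : (1 + ((n : ℝ) + 2) / β) / 2 = (β + n + 2) / (2 * β) := by field_simp; ring
    have h4 : (1 + (n : ℝ) / β) / 2 = (n - β) / (2 * β) + 1 := by field_simp; ring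
    rw [h3, h4, ← mul_div_assoc]
    gcongr

/-- The sum of a nonnegative series against an antitone sequence, in terms of its first term. -/
theorem exists_hasSum_mul {ρ w : ℕ → ℝ} {τ : ℝ} (hρ : ∀ j, 0 ≤ ρ j)
    (hτ : ∀ N, ∑ j ∈ Finset.range N, ρ j ≤ τ) (hw : ∀ j, 0 ≤ w j) (hanti : ∀ j, w (j + 1) ≤ w j) :
    ∃ θ, ρ 0 ≤ θ ∧ θ ≤ τ ∧ HasSum (fun j => ρ j * w j) (w 0 * θ) := by
  have hw0 : ∀ j, w j ≤ w 0 := fun j => antitone_nat_of_succ_le hanti (Nat.zero_le j)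
  rcases (hw 0).eq_or_lt with h0 | h0
  · have : ∀ j, w j = 0 := fun j => le_antisymm ((hw0 j).trans h0.ge) (hw j)
    exact ⟨ρ 0, le_rfl, by simpa using hτ 1, by simp [this, hasSum_zero]⟩
  have hs : Summable ρ := summable_of_sum_range_le hρ hτ
  have hle : ∀ j, ρ j * w j ≤ ρ j * w 0 := fun j => mul_le_mul_of_nonneg_left (hw0 j) (hρ j)
  have hnn : ∀ j, 0 ≤ ρ j * w j := fun j => mul_nonneg (hρ j) (hw j)
  have hs' : Summable (fun j => ρ j * w j) := Summable.of_nonneg_of_le hnn hle (hs.mul_right _)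
  refine ⟨(∑' j, ρ j * w j) / w 0, ?_, ?_, ?_⟩
  · rw [le_div_iff₀ h0]
    exact hs'.le_tsum 0 (fun j _ => hnn j)
  · rw [div_le_iff₀ h0]
    refine (hs'.tsum_le_tsum hle (hs.mul_right _)).trans ?_
    rw [tsum_mul_right]
    exact mul_le_mul_of_nonneg_right (hs.tsum_le_of_sum_range_le hτ) h0.le
  · rw [mul_div_cancel₀ _ h0.ne']
    exact hs'.hasSum

theorem exists_hasSum_chooseRatio_mul {β : ℝ} {n : ℕ} (hβ : 0 < β) (hn : β ≤ n) {w : ℕ → ℝ}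
    (hw : ∀ j, 0 ≤ w j) (hanti : ∀ j, w (j + 1) ≤ w j) :
    ∃ θ, 1 ≤ θ ∧ θ ≤ (1 + n / β) / 2 ∧ HasSum (fun j => chooseRatio β n j * w j) (w 0 * θ) :=
  exists_hasSum_mul (fun j => chooseRatio_nonneg hn j) (fun N => sum_chooseRatio_le hβ N n hn)
    hw hanti

theorem chooseRatio_succ_le {β : ℝ} {n : ℕ} (hβ : 0 ≤ β) (hn : β ≤ n) (j : ℕ) :
    chooseRatio β n (j + 1) ≤ chooseRatio β n j := by
  rw [chooseRatio_succ]
  refine mul_le_of_le_one_right (chooseRatio_nonneg hn j) ?_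
  have : (0 : ℝ) ≤ j := by positivity
  rw [div_le_one (by positivity)]
  nlinarith

theorem exists_hasSum_chooseRatio_sub_mul {β : ℝ} {n : ℕ} (hβ : 0 ≤ β) (hn : β ≤ n) {w : ℕ → ℝ}
    (hw : ∀ j, 0 ≤ w j) (hanti : ∀ j, w (j + 1) ≤ w j) :
    ∃ θ, 0 ≤ θ ∧ θ ≤ 1 ∧
      HasSum (fun j => (chooseRatio β n j - chooseRatio β n (j + 1)) * w j) (w 0 * θ) := by
  obtain ⟨θ, h0, h1, h2⟩ := exists_hasSum_mul
    (ρ := fun j => chooseRatio β n j - chooseRatio β n (j + 1)) (τ := 1)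
    (fun j => sub_nonneg.2 (chooseRatio_succ_le hβ hn j)) (fun N => by
      rw [Finset.sum_range_sub', chooseRatio_zero]
      linarith [chooseRatio_nonneg hn N]) hw hanti
  exact ⟨θ, (sub_nonneg.2 (chooseRatio_succ_le hβ hn 0)).trans h0, h1, h2⟩

end MinkowskiCohn

namespace MinkowskiCohn

/-- An affine form `(c - c') + (a - a') ε + (b - b') δ ± e`, scaled by `2 ^ 30`. -/
structure AForm where
  c : Nat
  c' : Nat
  a : Nat
  a' : Nat
  b : Nat
  b' : Nat
  e : Nat

namespace AForm

@[irreducible] def unit : Nat := 1073741824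

def rad (x : AForm) : Nat :=
  Nat.add (Nat.add (Nat.add x.a x.a') (Nat.add x.b x.b')) x.e

def low (x : AForm) : Nat := Nat.sub x.c (Nat.add x.c' x.rad)

def high (x : AForm) : Nat := Nat.sub (Nat.add x.c x.rad) x.c'

def abs (x : AForm) : Nat := Nat.add (Nat.add x.c x.c') x.rad

def ofNat (n : Nat) : AForm := ⟨Nat.mul n unit, 0, 0, 0, 0, 0, 0⟩

def range (l h : Nat) : AForm :=
  ⟨Nat.div (Nat.add l h) 2, 0, 0, 0, 0, 0, Nat.add (Nat.div (Nat.sub h l) 2) 1⟩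

def neg (x : AForm) : AForm := ⟨x.c', x.c, x.a', x.a, x.b', x.b, x.e⟩

def add (x y : AForm) : AForm :=
  let u := Nat.add x.c y.c
  let u' := Nat.add x.c' y.c'
  let v := Nat.add x.a y.a
  let v' := Nat.add x.a' y.a'
  let w := Nat.add x.b y.b
  let w' := Nat.add x.b' y.b'
  ⟨Nat.sub u u', Nat.sub u' u, Nat.sub v v', Nat.sub v' v, Nat.sub w w', Nat.sub w' w,
    Nat.add x.e y.e⟩

def sub (x y : AForm) : AForm := add x (neg y)

def scale (n : Nat) (x : AForm) : AForm :=
  ⟨Nat.mul n x.c, Nat.mul n x.c', Nat.mul n x.a, Nat.mul n x.a', Nat.mul n x.b, Nat.mul n x.b',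
    Nat.mul n x.e⟩

def divNat (x : AForm) (d : Nat) : AForm :=
  ⟨Nat.div x.c d, Nat.div x.c' d, Nat.div x.a d, Nat.div x.a' d, Nat.div x.b d, Nat.div x.b' d,
    Nat.add (Nat.div x.e d) 4⟩

def descale (u v : Nat) : Nat := Nat.div (Nat.sub u v) unit

def mul (x y : AForm) : AForm :=
  let u := Nat.add (Nat.mul x.c y.c) (Nat.mul x.c' y.c')
  let u' := Nat.add (Nat.mul x.c y.c') (Nat.mul x.c' y.c)
  let v := Nat.add (Nat.add (Nat.mul x.c y.a) (Nat.mul x.c' y.a'))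
    (Nat.add (Nat.mul x.a y.c) (Nat.mul x.a' y.c'))
  let v' := Nat.add (Nat.add (Nat.mul x.c y.a') (Nat.mul x.c' y.a))
    (Nat.add (Nat.mul x.a y.c') (Nat.mul x.a' y.c))
  let w := Nat.add (Nat.add (Nat.mul x.c y.b) (Nat.mul x.c' y.b'))
    (Nat.add (Nat.mul x.b y.c) (Nat.mul x.b' y.c'))
  let w' := Nat.add (Nat.add (Nat.mul x.c y.b') (Nat.mul x.c' y.b))
    (Nat.add (Nat.mul x.b y.c') (Nat.mul x.b' y.c))
  ⟨descale u u', descale u' u, descale v v', descale v' v, descale w w', descale w' w,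
    Nat.add (Nat.div (Nat.add (Nat.add (Nat.mul (Nat.add x.c x.c') y.e)
      (Nat.mul (Nat.add y.c y.c') x.e)) (Nat.mul x.rad y.rad)) unit) 4⟩

/-- An enclosure of the inverse of a real number that is at least `1`. -/
def inv (x : AForm) : AForm :=
  let g : AForm := ⟨Nat.div (Nat.mul unit unit) x.c, 0, 0, 0, 0, 0, 0⟩
  let w := sub (ofNat 1) (mul g x)
  add (add g (mul g w))
    (range 0 (Nat.add (Nat.div (Nat.mul w.abs w.abs) (Nat.add unit (Nat.sub x.low unit))) 1))

def clip (x y : AForm) : AForm :=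
  range (Nat.add x.low (Nat.sub y.low x.low)) (Nat.sub x.high (Nat.sub x.high y.high))

def linRec (e₁ e₂ : AForm) : Nat → AForm → AForm → List AForm
  | 0, _, _ => []
  | n + 1, x, y => x :: linRec e₁ e₂ n y (sub (mul e₁ y) (mul e₂ x))

/-- Enclosures of `C(β, n + 2 j) / C(β, n)`, where `g` encloses `β - n`. -/
def choose : Nat → AForm → Nat → AForm → List AForm
  | 0, _, _, _ => []
  | j + 1, g, n, u => u :: choose j (sub g (ofNat 2)) (Nat.add n 2)
      (divNat (mul (mul g (sub g (ofNat 1))) u) (Nat.mul (Nat.add n 1) (Nat.add n 2)))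

def dotTail (i d : Nat) : Nat → Nat → List AForm → List AForm → AForm
  | 0, n, x :: _, y :: _ => mul (mul x y) (range unit (Nat.add (Nat.div
      (Nat.mul unit (Nat.add i (Nat.mul n d))) (Nat.mul 2 i)) 1))
  | j + 1, n, x :: xs, y :: ys => add (mul x y) (dotTail i d j (Nat.add n 2) xs ys)
  | _, _, _, _ => ofNat 0

def dot : Nat → List AForm → List AForm → AForm
  | j + 1, x :: xs, y :: ys => add (mul x y) (dot j xs ys)
  | _, _, _ => ofNat 0

def diff : List AForm → List AForm
  | x :: y :: l => sub y x :: diff (y :: l)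
  | _ => []

def horner (z y : AForm) : List AForm → AForm
  | [x, t] => add x (mul (mul t y) (range 0 unit))
  | x :: l => add x (mul z (horner z y l))
  | [] => ofNat 0

/-- Enclosures of `κ (2 - κ) ⋯ (n - κ) / (n + 1)!`. -/
def negBinom (κ : AForm) : Nat → Nat → AForm → List AForm
  | 0, _, _ => []
  | j + 1, n, u => u :: negBinom κ j (Nat.add n 1)
      (divNat (mul u (sub (ofNat (Nat.add n 1)) κ)) (Nat.add n 2))

end AForm

open AForm

structure ExpForms where
  k : AForm
  s : AForm
  kp : AForm
  A : List AForm
  G : List AForm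
  G₁ : List AForm
  E : List AForm
  ν : List AForm
  N : List AForm
  ζ : List AForm
  co : List AForm

def ExpForms.ofBox (k : AForm) (I J : Nat) : ExpForms :=
  let one := ofNat 1
  let km := sub k one
  let ν := choose (Nat.add J 1) km 1 one
  { k := k
    s := add k one
    kp := sub one (scale 2 (inv (add k (ofNat 2))))
    A := choose (Nat.add I 1) k 2 one
    G := choose (Nat.add I 2) (add k one) 1 one
    G₁ := choose (Nat.add I 1) km 3 one
    E := choose (Nat.add J 1) km 2 one
    ν := ν
    N := diff ν
    ζ := choose 3 k 1 one
    co := let κ := divNat (sub (ofNat 2) k) 2; negBinom κ 6 1 (divNat κ 2) }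

structure PointForms where
  q : AForm
  e₁ : AForm
  e₂ : AForm
  f : AForm
  h : List AForm
  s : List AForm

def PointForms.of (r m : AForm) (n : Nat) : PointForms :=
  let one := ofNat 1
  let q := mul m r
  let e₂ := mul q q
  let e₁ := sub one (mul (sub one (scale 2 m)) r)
  let f := sub one (mul (sub one m) r)
  ⟨q, e₁, e₂, f, linRec e₁ e₂ n one e₁, linRec e₁ e₂ n one f⟩

def tForm (K : ExpForms) (P : PointForms) (I : Nat) : AForm :=
  mul (mul (divNat K.s 2) (dotTail 2 1 I 2 K.A P.h)) (inv (dotTail 2 1 (Nat.add I 1) 1 K.G P.s))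

def mStep (K : ExpForms) (I : Nat) (r m : AForm) : AForm :=
  let one := ofNat 1
  let P := PointForms.of r m (Nat.add I 2)
  let t := tForm K P I
  let R := sub (dotTail 2 1 I 2 K.A P.s)
    (mul (mul (mul (sub one r) t) (divNat K.k 3)) (dotTail 2 1 I 3 K.G₁ P.h))
  let y := mul (sub (scale 4 m) one) r
  let z := sub one (inv (add one y))
  let Θ := add one (mul (mul y K.kp) (sub one (horner z y K.co)))
  inv (sub (ofNat 4) (mul (mul K.s R) (inv Θ)))

def mForm (K : ExpForms) (I n : Nat) (r : AForm) : AForm :=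
  let m := range 357913941 (Nat.add (Nat.div (Nat.add (Nat.mul 45 unit) (Nat.mul 8 r.high)) 100) 1)
  (mStep K I r)^[n] (clip m (mStep K I r m))

structure SlopeForms where
  S : AForm
  X : AForm
  t : AForm
  Y : AForm

def slopeForms (K : ExpForms) (I J : Nat) (tail : Option (Nat × Nat)) (r m : AForm) : SlopeForms :=
  let one := ofNat 1
  let P := PointForms.of r m (Nat.add J 1)
  let t := tForm K P I
  let d := sub one r
  let e := divNat (mul K.s K.k) 2
  let D := mul e (dotTail 1 1 J 2 K.E P.h)
  let Z := mul e (dotTail 1 1 J 2 K.E P.s)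
  let DN := sub (dot (Nat.sub J 1) K.N P.h) (mul (mul (K.ν.getD (Nat.sub J 1) one)
    (P.h.getD (Nat.sub J 1) one)) (range 0 unit))
  let S := linRec P.e₁ P.e₂ (Nat.add J 1) (sub one m)
    (add (mul P.f (sub one (scale 2 m))) (mul m P.q))
  let Q := match tail with
    | none => dot J K.ν S
    | some (i, j) => dotTail i j J 1 K.ν S
  let qZ := add one (mul P.q Z)
  let X := add t (mul P.q (sub (mul t Z) D))
  ⟨add (mul Q X) (mul (mul m DN) (add qZ (mul (mul d D) (sub one t)))), X, t,
    sub (mul (mul K.s (dotTail 1 1 2 1 K.ζ P.s)) qZ)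
      (mul (mul (mul P.q d) (mul K.s (dotTail 1 1 1 3 K.ζ.tail P.h))) D)⟩

def kBox (l h : Nat) : AForm :=
  ⟨Nat.div (Nat.mul (Nat.sub (Nat.add l h) 1600) unit) 800, 0,
    Nat.div (Nat.mul (Nat.sub h l) unit) 800, 0, 0, 0, 2⟩

def rBox (l h : Nat) : AForm :=
  ⟨Nat.mul (Nat.add l h) 2097152, 0, 0, 0, Nat.mul (Nat.sub h l) 2097152, 0, 0⟩

def nonneg (x : AForm) : Bool := Nat.ble (Nat.add x.c' x.rad) x.c

def pos (x : AForm) : Bool := Nat.ble (Nat.add (Nat.add x.c' x.rad) 1) x.c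

def posCells (K : ExpForms) (I J n : Nat) : List Nat → Bool
  | l :: h :: c =>
    let r := rBox l h
    let F := slopeForms K I J none r (mForm K I n r)
    nonneg F.X && pos F.S && posCells K I J n (h :: c)
  | _ => true

def negCells (K : ExpForms) (I J n i j : Nat) : List Nat → Bool
  | l :: h :: c =>
    let r := rBox l h
    let F := slopeForms K I J (some (i, j)) r (mForm K I n r)
    pos (neg F.S) && negCells K I J n i j (h :: c)
  | _ => true

/-- The parameters of the comparison function `g (1 - lam u / 1000) (1 - mu u / 1000) / 10000`
and bounds `v / 1000 ≤ 2 ^ (1 - p) ≤ v' / 1000`. -/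
structure Comparison where
  lam : Nat
  mu : Nat
  g : Nat
  v : Nat
  v' : Nat

def ratio (n d : Nat) : AForm := divNat (ofNat n) d

def Comparison.U (C : Comparison) : AForm :=
  let V := sub (ofNat 1) (range (Nat.div (Nat.mul C.v unit) 1000)
    (Nat.add (Nat.div (Nat.mul C.v' unit) 1000) 1))
  mul V V

def definite (x : AForm) : Bool := pos x || pos (neg x)

def Comparison.check (C : Comparison) (k r U : AForm) (F : SlopeForms) : Bool :=
  let one := ofNat 1
  let u := mul (mul F.t F.t) (sub one r)
  let a := ratio C.lam 1000
  let b := ratio C.mu 1000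
  let fac := mul (mul F.t (sub one u)) F.Y
  let g := mul (mul (sub one (mul a u)) (sub one (mul b u))) (ratio C.g 5000)
  let hs := divNat (add a b) 2
  let pr := divNat (mul a b) 3
  definite (add (mul (mul r k) F.S) (mul fac g)) &&
  (definite F.S || (pos (add (sub one (mul hs u)) (mul pr (mul u u))) &&
    pos (sub (mul hs (add u U)) (add one (mul pr (add (mul u u) (mul U (add u U))))))))

def Comparison.cells (C : Comparison) (K : ExpForms) (U : AForm) (I J n i j : Nat) : List Nat → Bool
  | l :: h :: c =>
    let r := rBox l h
    C.check K.k r U (slopeForms K I J (some (i, j)) r (mForm K I n r)) &&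
      C.cells K U I J n i j (h :: c)
  | _ => true

end MinkowskiCohn

namespace MinkowskiCohn

open Set Filter Topology

namespace AForm

/-- The range of the noise variables. -/
abbrev Noise : Type := Icc (-1 : ℝ) 1

theorem Noise.abs_le (ε : Noise) : |(ε : ℝ)| ≤ 1 := _root_.abs_le.2 ε.2

/-- The central value of a form, scaled by `2 ^ 30`. -/
noncomputable def lin (ε δ : Noise) (x : AForm) : ℝ :=
  ((x.c : ℝ) - x.c') + ((x.a : ℝ) - x.a') * ε + ((x.b : ℝ) - x.b') * δ

/-- The form `x` encloses the real number `v`. -/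
def Mem (ε δ : Noise) (x : AForm) (v : ℝ) : Prop :=
  |v * unit - lin ε δ x| ≤ x.e

variable {ε δ : Noise} {x y : AForm} {v w : ℝ}

theorem unit_pos_nat : 0 < unit := by norm_num [unit]

theorem unit_pos : (0 : ℝ) < unit := Nat.cast_pos.2 unit_pos_nat

theorem cast_sub_sub (u w : ℕ) : ((Nat.sub u w : ℕ) : ℝ) - (Nat.sub w u : ℕ) = u - w := by
  simp only [Nat.sub_eq]
  rcases le_total u w with h | h
  · rw [Nat.sub_eq_zero_of_le h, Nat.cast_sub h]; push_cast; ring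
  · rw [Nat.sub_eq_zero_of_le h, Nat.cast_sub h]; push_cast; ring

theorem le_cast_sub (u w : ℕ) : (u : ℝ) - w ≤ (Nat.sub u w : ℕ) := by
  have := cast_sub_sub u w
  have : (0 : ℝ) ≤ (Nat.sub w u : ℕ) := Nat.cast_nonneg _
  linarith

theorem cast_div_le (n d : ℕ) : ((Nat.div n d : ℕ) : ℝ) ≤ n / d := Nat.cast_div_le

theorem lt_cast_div (n : ℕ) {d : ℕ} (hd : 0 < d) : (n : ℝ) / d < (Nat.div n d : ℕ) + 1 := by
  rw [div_lt_iff₀ (by exact_mod_cast hd)]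
  have h : n < (n / d + 1) * d := by
    rw [add_mul, one_mul]
    exact Nat.lt_div_mul_add hd
  exact_mod_cast h

theorem abs_cast_div_sub (n m : ℕ) {d : ℕ} (hd : 0 < d) :
    |((n : ℝ) - m) / d - ((Nat.div n d : ℕ) - (Nat.div m d : ℕ))| ≤ 1 := by
  have h1 := cast_div_le n d
  have h2 := cast_div_le m d
  have h3 := lt_cast_div n hd
  have h4 := lt_cast_div m hd
  rw [sub_div, _root_.abs_le]
  constructor <;> linarith

theorem abs_descale (u w : ℕ) :
    |((u : ℝ) - w) / unit - ((descale u w : ℕ) - (descale w u : ℕ))| ≤ 1 := by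
  rw [← cast_sub_sub]
  exact abs_cast_div_sub _ _ unit_pos_nat

theorem abs_mul_noise_le (a : ℝ) (ε : Noise) : |a * ε| ≤ |a| := by
  rw [abs_mul]
  exact mul_le_of_le_one_right (abs_nonneg a) (Noise.abs_le ε)

theorem abs_cast_sub_le (m n : ℕ) : |(m : ℝ) - n| ≤ m + n := by
  have hm : (0 : ℝ) ≤ m := m.cast_nonneg
  have hn : (0 : ℝ) ≤ n := n.cast_nonneg
  rw [_root_.abs_le]
  constructor <;> linarith

theorem cast_rad (x : AForm) : (x.rad : ℝ) = x.a + x.a' + (x.b + x.b') + x.e := by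
  simp [rad]

theorem Mem.abs_sub_le (h : Mem ε δ x v) : |v * unit - (x.c - x.c')| ≤ x.rad := by
  have h1 := abs_mul_noise_le ((x.a : ℝ) - x.a') ε
  have h2 := abs_mul_noise_le ((x.b : ℝ) - x.b') δ
  have h3 := abs_cast_sub_le x.a x.a'
  have h4 := abs_cast_sub_le x.b x.b'
  have h5 := abs_add_three (v * unit - lin ε δ x) (((x.a : ℝ) - x.a') * ε) (((x.b : ℝ) - x.b') * δ)
  rw [show v * unit - lin ε δ x + ((x.a : ℝ) - x.a') * ε + ((x.b : ℝ) - x.b') * δ =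
    v * unit - (x.c - x.c') by rw [lin]; ring] at h5
  rw [cast_rad]
  have : |v * unit - lin ε δ x| ≤ x.e := h
  linarith

theorem Mem.low_le (h : Mem ε δ x v) (hv : 0 ≤ v) : (x.low : ℝ) ≤ v * unit := by
  have h1 := _root_.abs_le.1 h.abs_sub_le
  have h2 := unit_pos
  rcases le_total (Nat.add x.c' x.rad) x.c with h3 | h3
  · rw [low, Nat.sub_eq, Nat.cast_sub h3]
    simp only [Nat.add_eq, Nat.cast_add]
    linarith
  · rw [low, Nat.sub_eq, Nat.sub_eq_zero_of_le h3]
    push_cast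
    positivity

theorem Mem.le_high (h : Mem ε δ x v) : v * unit ≤ x.high := by
  have h1 := _root_.abs_le.1 h.abs_sub_le
  have h2 := le_cast_sub (Nat.add x.c x.rad) x.c'
  rw [high]
  simp only [Nat.add_eq, Nat.cast_add] at h2 ⊢
  linarith

theorem Mem.abs_le (h : Mem ε δ x v) : |v| * unit ≤ x.abs := by
  have h1 := h.abs_sub_le
  have h2 := abs_cast_sub_le x.c x.c'
  have h3 := abs_add_le (v * unit - (x.c - x.c')) (x.c - x.c')
  rw [sub_add_cancel, abs_mul, abs_of_pos unit_pos] at h3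
  simp only [abs, Nat.add_eq, Nat.cast_add]
  linarith

theorem mem_ofNat (n : ℕ) : Mem ε δ (ofNat n) n := by simp [Mem, lin, ofNat]

theorem mem_one : Mem ε δ (ofNat 1) 1 := by simpa using mem_ofNat (ε := ε) (δ := δ) 1

theorem mem_range {l h : ℕ} (hl : (l : ℝ) ≤ v * unit) (hh : v * unit ≤ h) :
    Mem ε δ (range l h) v := by
  have h1 : h ≤ (l + h) / 2 + (h - l) / 2 + 1 := by omega
  have h2 : (l + h) / 2 ≤ l + (h - l) / 2 + 1 := by omega
  have h3 : (h : ℝ) ≤ ((l + h) / 2 : ℕ) + ((h - l) / 2 : ℕ) + 1 := by exact_mod_cast h1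
  have h4 : (((l + h) / 2 : ℕ) : ℝ) ≤ l + ((h - l) / 2 : ℕ) + 1 := by exact_mod_cast h2
  rw [Mem, lin, range, _root_.abs_le]
  simp only [Nat.add_eq, Nat.cast_add, Nat.cast_zero, Nat.cast_one, sub_zero, zero_mul, add_zero]
  change -(((h - l) / 2 : ℕ) + 1 : ℝ) ≤ v * unit - ((l + h) / 2 : ℕ) ∧
    v * unit - ((l + h) / 2 : ℕ) ≤ ((h - l) / 2 : ℕ) + 1
  constructor <;> linarith

theorem Mem.neg (h : Mem ε δ x v) : Mem ε δ x.neg (-v) := by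
  rw [Mem, ← abs_neg]
  refine (congrArg _ ?_).trans_le h
  simp only [lin, AForm.neg]
  ring

theorem Mem.add (hx : Mem ε δ x v) (hy : Mem ε δ y w) : Mem ε δ (x.add y) (v + w) := by
  have h := (abs_add_le _ _).trans (add_le_add hx hy)
  rw [Mem]
  simp only [lin, AForm.add, cast_sub_sub] at h ⊢
  simp only [Nat.add_eq, Nat.cast_add]
  refine (congrArg _ ?_).trans_le h
  ring

theorem Mem.sub (hx : Mem ε δ x v) (hy : Mem ε δ y w) : Mem ε δ (x.sub y) (v - w) := by
  rw [sub_eq_add_neg]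
  exact hx.add hy.neg

theorem Mem.scale (n : ℕ) (hx : Mem ε δ x v) : Mem ε δ (x.scale n) (n * v) := by
  have h := mul_le_mul_of_nonneg_left hx (n.cast_nonneg (α := ℝ))
  rw [← abs_of_nonneg (n.cast_nonneg (α := ℝ)), ← abs_mul, abs_of_nonneg (n.cast_nonneg (α := ℝ))] at h
  rw [Mem]
  simp only [lin, AForm.scale, Nat.mul_eq, Nat.cast_mul] at h ⊢
  refine (congrArg _ ?_).trans_le h
  ring

theorem abs_combination_le {A B C D : ℝ} (hA : |A| ≤ 1) (hB : |B| ≤ 1) (hC : |C| ≤ 1)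
    (ε δ : Noise) : |A + B * ε + C * δ + D| ≤ 3 + |D| := by
  have h1 := (abs_mul_noise_le B ε).trans hB
  have h2 := (abs_mul_noise_le C δ).trans hC
  have h3 := abs_add_three A (B * ε) (C * δ)
  have h4 := abs_add_le (A + B * ε + C * δ) D
  linarith

theorem Mem.divNat {d : ℕ} (hd : 0 < d) (hx : Mem ε δ x v) : Mem ε δ (x.divNat d) (v / d) := by
  have hd' : (0 : ℝ) < d := by exact_mod_cast hd
  have h := abs_combination_le (D := (v * unit - lin ε δ x) / d) (abs_cast_div_sub x.c x.c' hd)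
    (abs_cast_div_sub x.a x.a' hd) (abs_cast_div_sub x.b x.b' hd) ε δ
  have h1 : |(v * unit - lin ε δ x) / d| ≤ x.e / d := by
    rw [abs_div, abs_of_pos hd']; gcongr; exact hx
  have h2 := lt_cast_div x.e hd
  rw [Mem]
  simp only [lin, AForm.divNat, Nat.add_eq, Nat.cast_add, Nat.cast_ofNat] at h h1 ⊢
  refine le_trans (le_of_eq ?_) (h.trans (by linarith))
  congr 1
  field_simp
  ring

theorem abs_mul_le_mul {a b A B : ℝ} (ha : |a| ≤ A) (hb : |b| ≤ B) : |a * b| ≤ A * B := by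
  rw [abs_mul]
  exact mul_le_mul ha hb (abs_nonneg b) ((abs_nonneg a).trans ha)

theorem Mem.mul (hx : Mem ε δ x v) (hy : Mem ε δ y w) : Mem ε δ (x.mul y) (v * w) := by
  have hU := unit_pos
  have h1 := abs_mul_le_mul (abs_cast_sub_le x.c x.c') hy
  have h2 := abs_mul_le_mul (abs_cast_sub_le y.c y.c') hx
  have h3 := abs_mul_le_mul hx.abs_sub_le hy.abs_sub_le
  have h4 := (abs_add_three _ _ _).trans (add_le_add (add_le_add h1 h2) h3)
  set e : ℕ := Nat.add (Nat.add (Nat.mul (Nat.add x.c x.c') y.e)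
      (Nat.mul (Nat.add y.c y.c') x.e)) (Nat.mul x.rad y.rad) with he
  have h5 : ((x.c : ℝ) + x.c') * y.e + (y.c + y.c') * x.e + x.rad * y.rad = e := by
    simp [he]
  rw [h5] at h4
  have h6 := lt_cast_div e unit_pos_nat
  have h := fun c₁ c₂ a₁ a₂ b₁ b₂ D => abs_combination_le (D := D) (abs_descale c₁ c₂)
    (abs_descale a₁ a₂) (abs_descale b₁ b₂) ε δ
  rw [Mem]
  rw [lin, AForm.mul]
  simp only [← he]
  refine le_trans (congrArg _ ?_).le ((h
    (Nat.add (Nat.mul x.c y.c) (Nat.mul x.c' y.c'))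
    (Nat.add (Nat.mul x.c y.c') (Nat.mul x.c' y.c))
    (Nat.add (Nat.add (Nat.mul x.c y.a) (Nat.mul x.c' y.a'))
      (Nat.add (Nat.mul x.a y.c) (Nat.mul x.a' y.c')))
    (Nat.add (Nat.add (Nat.mul x.c y.a') (Nat.mul x.c' y.a))
      (Nat.add (Nat.mul x.a y.c') (Nat.mul x.a' y.c)))
    (Nat.add (Nat.add (Nat.mul x.c y.b) (Nat.mul x.c' y.b'))
      (Nat.add (Nat.mul x.b y.c) (Nat.mul x.b' y.c')))
    (Nat.add (Nat.add (Nat.mul x.c y.b') (Nat.mul x.c' y.b))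
      (Nat.add (Nat.mul x.b y.c') (Nat.mul x.b' y.c)))
    ((((x.c : ℝ) - x.c') * (w * unit - lin ε δ y) +
    ((y.c : ℝ) - y.c') * (v * unit - lin ε δ x) +
    (v * unit - (x.c - x.c')) * (w * unit - (y.c - y.c'))) / unit)).trans ?_)
  · have key : ∀ c₁ c₂ a₁ a₂ b₁ b₂ p q₁ q₂ r₁ r₂ s₁ s₂ : ℝ,
        c₁ - c₂ + (a₁ - a₂) * ε + (b₁ - b₂) * δ + p = v * w * unit * unit →
        v * w * unit - (q₁ - q₂ + (r₁ - r₂) * ε + (s₁ - s₂) * δ) =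
        (c₁ - c₂) / unit - (q₁ - q₂) + ((a₁ - a₂) / unit - (r₁ - r₂)) * ε +
          ((b₁ - b₂) / unit - (s₁ - s₂)) * δ + p / unit := by
      intro c₁ c₂ a₁ a₂ b₁ b₂ p q₁ q₂ r₁ r₂ s₁ s₂ hp
      have : v * w * unit = (c₁ - c₂ + (a₁ - a₂) * ε + (b₁ - b₂) * δ + p) / unit := by
        rw [hp]; field_simp
      rw [this]; ring
    apply key
    simp only [lin, Nat.add_eq, Nat.mul_eq, Nat.cast_add, Nat.cast_mul]
    ring
  · rw [abs_div, abs_of_pos hU]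
    have h7 := (div_le_div_of_nonneg_right h4 hU.le).trans h6.le
    simp only [Nat.add_eq, Nat.cast_add, Nat.cast_ofNat]
    linarith

theorem Mem.inv (hx : Mem ε δ x v) (hv : 1 ≤ v) : Mem ε δ x.inv v⁻¹ := by
  have hU := unit_pos
  have hv0 : 0 < v := by linarith
  rw [AForm.inv]
  set g : AForm := ⟨Nat.div (Nat.mul unit unit) x.c, 0, 0, 0, 0, 0, 0⟩ with hg
  obtain ⟨g₀, hg₀⟩ : ∃ g₀, Mem ε δ g g₀ := by
    refine ⟨lin ε δ g / unit, ?_⟩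
    rw [Mem, div_mul_cancel₀ _ hU.ne', sub_self, abs_zero]
    positivity
  have hw := (mem_one (ε := ε) (δ := δ)).sub (hg₀.mul hx)
  have h1 : v⁻¹ = g₀ + g₀ * (1 - g₀ * v) + (1 - g₀ * v) ^ 2 / v := by
    field_simp
    ring
  rw [h1]
  refine (hg₀.add (hg₀.mul hw)).add (mem_range ?_ ?_)
  · push_cast; positivity
  · set W := (AForm.sub (AForm.ofNat 1) (AForm.mul g x)).abs with hW
    have h2 := hw.abs_le
    set D : ℕ := Nat.add unit (Nat.sub x.low unit) with hD
    have h3 : 0 < D := Nat.add_pos_left unit_pos_nat _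
    have h4 : (D : ℝ) ≤ v * unit := by
      have h5 := hx.low_le hv0.le
      rcases le_total x.low unit with h6 | h6
      · simp only [hD, Nat.add_eq, Nat.sub_eq, Nat.sub_eq_zero_of_le h6, add_zero]
        nlinarith
      · simp only [hD, Nat.add_eq, Nat.sub_eq, Nat.add_sub_cancel' h6]
        exact h5
    have h5 := lt_cast_div (Nat.mul W W) h3
    have h3' : (0 : ℝ) < D := by exact_mod_cast h3
    have h6 : (1 - g₀ * v) ^ 2 / v * unit ≤ (Nat.mul W W : ℕ) / D := by
      rw [div_mul_eq_mul_div, div_le_div_iff₀ hv0 h3']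
      have h7 : ((1 - g₀ * v) * unit) ^ 2 ≤ (W : ℝ) ^ 2 := by
        rw [← sq_abs, abs_mul, abs_of_pos hU]
        exact pow_le_pow_left₀ (by positivity) h2 2
      simp only [Nat.mul_eq, Nat.cast_mul]
      calc (1 - g₀ * v) ^ 2 * unit * D ≤ (1 - g₀ * v) ^ 2 * unit * (v * unit) := by gcongr
        _ = ((1 - g₀ * v) * unit) ^ 2 * v := by ring
        _ ≤ (W : ℝ) ^ 2 * v := by gcongr
        _ = _ := by ring
    simp only [Nat.add_eq, Nat.cast_add, Nat.cast_one] at h6 ⊢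
    exact h6.trans h5.le

theorem Mem.clip (hx : Mem ε δ x v) (hy : Mem ε δ y v) (hv : 0 ≤ v) : Mem ε δ (x.clip y) v := by
  have h1 := hx.low_le hv
  have h2 := hy.low_le hv
  have h3 := hx.le_high
  have h4 := hy.le_high
  apply mem_range
  · rw [show Nat.add x.low (Nat.sub y.low x.low) = max x.low y.low by
      simp only [Nat.add_eq, Nat.sub_eq]; omega, Nat.cast_max]
    exact max_le h1 h2
  · rw [show Nat.sub x.high (Nat.sub x.high y.high) = min x.high y.high by
      simp only [Nat.sub_eq]; omega, Nat.cast_min]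
    exact le_min h3 h4

end AForm

end MinkowskiCohn

namespace MinkowskiCohn

open Set Filter Topology

/-- The coefficients `κ (2 - κ) ⋯ (j + 1 - κ) / (j + 2)!`. -/
noncomputable def negBinomCoeff (κ : ℝ) : ℕ → ℝ
  | 0 => κ / 2
  | j + 1 => negBinomCoeff κ j * (j + 2 - κ) / (j + 3)

namespace AForm

/-- The forms of the list `l` enclose the initial terms of the sequence `w`. -/
def MemSeq (ε δ : Noise) : List AForm → (ℕ → ℝ) → Prop
  | [], _ => True
  | x :: l, w => Mem ε δ x (w 0) ∧ MemSeq ε δ l fun j => w (j + 1)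

variable {ε δ : Noise} {x y z : AForm} {us ws l : List AForm} {u w : ℕ → ℝ}

theorem Mem.of_eq {v v' : ℝ} (h : Mem ε δ x v) (hv : v' = v) : Mem ε δ x v' := hv ▸ h

theorem MemSeq.of_eq (h : MemSeq ε δ l w) (hu : ∀ j, u j = w j) : MemSeq ε δ l u :=
  (funext hu : u = w) ▸ h

theorem MemSeq.tail (h : MemSeq ε δ l w) : MemSeq ε δ l.tail fun j => w (j + 1) := by
  cases l with
  | nil => trivial
  | cons x l => exact h.2

theorem MemSeq.getD : ∀ {l : List AForm} {w : ℕ → ℝ}, MemSeq ε δ l w → ∀ {i : ℕ}, i < l.length →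
    Mem ε δ (l.getD i x) (w i)
  | [], _, _, _, hi => by simp at hi
  | _ :: _, _, h, 0, _ => h.1
  | _ :: _, _, h, i + 1, hi => MemSeq.getD h.2 (i := i) (by simpa using hi)

theorem memSeq_linRec {e₁ e₂ : ℝ} (h₁ : Mem ε δ x e₁) (h₂ : Mem ε δ y e₂) :
    ∀ (n : ℕ) {u v : AForm} {w : ℕ → ℝ}, (∀ j, w (j + 2) = e₁ * w (j + 1) - e₂ * w j) →
      Mem ε δ u (w 0) → Mem ε δ v (w 1) → MemSeq ε δ (linRec x y n u v) w
  | 0, _, _, _, _, _, _ => trivial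
  | n + 1, _, _, _, hw, hu, hv => by
    refine ⟨hu, memSeq_linRec h₁ h₂ n (fun j => hw (j + 1)) hv ?_⟩
    rw [hw 0]
    exact (h₁.mul hv).sub (h₂.mul hu)

theorem length_linRec (e₁ e₂ : AForm) : ∀ (n : ℕ) (x y : AForm), (linRec e₁ e₂ n x y).length = n
  | 0, _, _ => rfl
  | n + 1, _, _ => by rw [linRec, List.length_cons, length_linRec]

theorem memSeq_choose {β : ℝ} : ∀ (j : ℕ) {g u : AForm} {n : ℕ} {u₀ : ℝ}, Mem ε δ g (β - n) →
    Mem ε δ u u₀ → MemSeq ε δ (choose j g n u) fun i => u₀ * chooseRatio β n i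
  | 0, _, _, _, _, _, _ => trivial
  | j + 1, g, u, n, u₀, hg, hu => by
    refine ⟨hu.of_eq (mul_one u₀), ?_⟩
    have h1 : Mem ε δ (g.sub (ofNat 2)) (β - (n + 2 : ℕ)) := by
      convert hg.sub (mem_ofNat 2) using 1
      push_cast; ring
    have h2 := ((hg.mul (hg.sub mem_one)).mul hu).divNat (d := Nat.mul (Nat.add n 1) (Nat.add n 2))
      (by simp only [Nat.mul_eq, Nat.add_eq]; positivity)
    refine (memSeq_choose j h1 h2).of_eq fun i => ?_
    beta_reduce
    rw [chooseRatio_succ']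
    simp only [Nat.mul_eq, Nat.add_eq]
    push_cast
    ring

theorem length_choose : ∀ (j : ℕ) (g : AForm) (n : ℕ) (u : AForm), (choose j g n u).length = j
  | 0, _, _, _ => rfl
  | j + 1, _, _, _ => by rw [choose, List.length_cons, length_choose]

theorem memSeq_diff : ∀ {l : List AForm} {w : ℕ → ℝ}, MemSeq ε δ l w →
    MemSeq ε δ (diff l) fun j => w (j + 1) - w j
  | [], _, _ => trivial
  | [_], _, _ => trivial
  | _ :: _ :: _, _, h => ⟨h.2.1.sub h.1, memSeq_diff h.2⟩

theorem length_diff : ∀ l : List AForm, (diff l).length = l.length - 1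
  | [] => rfl
  | [_] => rfl
  | x :: y :: l => by rw [diff, List.length_cons, length_diff]; simp

theorem mem_dot : ∀ (J : ℕ) {us ws : List AForm} {u w : ℕ → ℝ}, MemSeq ε δ us u →
    MemSeq ε δ ws w → J ≤ us.length → J ≤ ws.length →
    Mem ε δ (dot J us ws) (∑ j ∈ Finset.range J, u j * w j)
  | 0, _, _, _, _, _, _, _, _ => by simpa [dot] using mem_ofNat (ε := ε) (δ := δ) 0
  | J + 1, [], _, _, _, _, _, h, _ => by simp at h
  | J + 1, _, [], _, _, _, _, _, h => by simp at h
  | J + 1, _ :: _, _ :: _, _, _, hu, hw, h, h' => by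
    refine ((hu.1.mul hw.1).add
      (mem_dot J hu.2 hw.2 (by simpa using h) (by simpa using h'))).of_eq ?_
    rw [Finset.sum_range_succ', add_comm]

theorem hasSum_shift {f : ℕ → ℝ} {a : ℝ} (h : HasSum f a) : HasSum (fun j => f (j + 1)) (a - f 0) := by
  simpa using (hasSum_nat_add_iff' 1).2 h

theorem mem_dotTail {β : ℝ} {i d : ℕ} (hi : 0 < i) (hβ : (i : ℝ) ≤ β * d) :
    ∀ (J : ℕ) {n : ℕ} {us ws : List AForm} {u w : ℕ → ℝ} {u₀ σ : ℝ}, MemSeq ε δ us u →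
    (∀ j, u j = u₀ * chooseRatio β n j) → MemSeq ε δ ws w → (∀ j, 0 ≤ w j) →
    (∀ j, J ≤ j → w (j + 1) ≤ w j) → β ≤ n + 2 * J → J < us.length → J < ws.length →
    HasSum (fun j => u j * w j) σ → Mem ε δ (dotTail i d J n us ws) σ
  | 0, n, x :: us, y :: ws, u, w, u₀, σ, hus, hu, hws, hw, hw', hn, _, _, hσ => by
    have hi' : (0 : ℝ) < i := by exact_mod_cast hi
    have hd' : (0 : ℝ) ≤ d := d.cast_nonneg
    have hβ0 : 0 < β := by
      by_contra! h
      nlinarith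
    obtain ⟨θ, h1, h2, h3⟩ := exists_hasSum_chooseRatio_mul (n := n) hβ0 (by simpa using hn) hw
      (fun j => hw' j (Nat.zero_le j))
    have h4 : σ = u 0 * w 0 * θ := by
      refine hσ.unique (hasSum_of_eq (h3.mul_left u₀) (fun j => ?_) ?_)
      · rw [hu]; ring
      · rw [hu, chooseRatio_zero]; ring
    rw [h4]
    refine (hus.1.mul hws.1).mul (mem_range ?_ ?_)
    · have := unit_pos
      nlinarith
    · have h5 : θ ≤ ((i : ℝ) + n * d) / (2 * i) := by
        refine h2.trans ?_
        have : (n : ℝ) / β ≤ n * d / i := by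
          rw [div_le_div_iff₀ hβ0 hi']
          nlinarith [mul_le_mul_of_nonneg_left hβ (n.cast_nonneg (α := ℝ))]
        calc (1 + (n : ℝ) / β) / 2 ≤ (1 + n * d / i) / 2 := by gcongr
          _ = _ := by field_simp
      have h6 := lt_cast_div (Nat.mul unit (Nat.add i (Nat.mul n d))) (d := Nat.mul 2 i)
        (by simp only [Nat.mul_eq]; positivity)
      rw [Nat.add_eq, Nat.cast_add, Nat.cast_one]
      refine le_trans ?_ h6.le
      simp only [Nat.mul_eq, Nat.add_eq, Nat.cast_mul, Nat.cast_add, Nat.cast_ofNat]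
      rw [mul_comm, mul_div_assoc]
      exact mul_le_mul_of_nonneg_left h5 unit_pos.le
  | J + 1, n, x :: us, y :: ws, u, w, u₀, σ, hus, hu, hws, hw, hw', hn, h, h', hσ => by
    have h1 := hasSum_shift hσ
    have h2 := mem_dotTail hi hβ J (n := n + 2) (u₀ := u₀ * ((β - n) * (β - n - 1) / ((n + 1) * (n + 2))))
      hus.2 (fun j => by rw [hu, chooseRatio_succ']; ring) hws.2 (fun j => hw (j + 1))
      (fun j hj => hw' (j + 1) (by omega)) (by push_cast at hn ⊢; linarith)
      (by simpa using h) (by simpa using h') h1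
    exact ((hus.1.mul hws.1).add h2).of_eq (by ring)
  | _, _, [], _, _, _, _, _, _, _, _, _, _, _, h, _, _ => by simp at h
  | _, _, _, [], _, _, _, _, _, _, _, _, _, _, _, h, _ => by simp at h

theorem mem_range_unit {θ : ℝ} (h0 : 0 ≤ θ) (h1 : θ ≤ 1) : Mem ε δ (range 0 unit) θ := by
  have := unit_pos
  apply mem_range
  · push_cast; positivity
  · nlinarith

theorem exists_eq_mul_of_le {a b : ℝ} (ha : 0 ≤ a) (hb : a ≤ b) : ∃ θ, 0 ≤ θ ∧ θ ≤ 1 ∧ a = b * θ := by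
  rcases hb.eq_or_lt with h | h
  · exact ⟨1, zero_le_one, le_rfl, by rw [h, mul_one]⟩
  · have : 0 < b := by linarith
    exact ⟨a / b, by positivity, (div_le_one this).2 hb, by field_simp⟩

theorem mem_horner {v : ℝ} (hv : 0 < v) (hv1 : v < 1) (hz : Mem ε δ z v) (hy : Mem ε δ y (v / (1 - v))) :
    ∀ {l : List AForm} {w : ℕ → ℝ} {σ : ℝ}, MemSeq ε δ l w → (∀ j, 0 ≤ w j) → Antitone w →
      2 ≤ l.length → HasSum (fun j => w j * v ^ j) σ → Mem ε δ (horner z y l) σ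
  | [], _, _, _, _, _, h, _ => by simp at h
  | [_], _, _, _, _, _, h, _ => by simp at h
  | [x, t], w, σ, hl, hw, hw', _, hσ => by
    have h1 := hasSum_shift hσ
    have h2 : HasSum (fun j => w 1 * v * v ^ j) (w 1 * v * (1 - v)⁻¹) :=
      (hasSum_geometric_of_lt_one hv.le hv1).mul_left _
    have h3 : 0 ≤ σ - w 0 * v ^ 0 := h1.nonneg fun j => mul_nonneg (hw _) (pow_nonneg hv.le _)
    have h4 : σ - w 0 * v ^ 0 ≤ w 1 * v * (1 - v)⁻¹ := hasSum_le (fun j => by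
      rw [pow_succ', ← mul_assoc]
      gcongr
      exact hw' (by omega)) h1 h2
    obtain ⟨θ, h5, h6, h7⟩ := exists_eq_mul_of_le h3 h4
    have h8 : σ = w 0 + w 1 * (v / (1 - v)) * θ := by
      rw [div_eq_mul_inv, ← mul_assoc, ← h7]; ring
    rw [h8]
    exact hl.1.add ((hl.2.1.mul hy).mul (mem_range_unit h5 h6))
  | x :: t :: t' :: l, w, σ, hl, hw, hw', _, hσ => by
    have h1 := hasSum_shift hσ
    have h2 : HasSum (fun j => w (j + 1) * v ^ j) ((σ - w 0) / v) := by
      refine hasSum_of_eq (h1.mul_left v⁻¹) (fun j => ?_) ?_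
      · rw [pow_succ]; field_simp
      · rw [pow_zero, mul_one, div_eq_inv_mul]
    have h3 := mem_horner hv hv1 hz hy hl.2 (fun j => hw (j + 1)) (fun i j h => hw' (by omega))
      (by simp) h2
    exact (hl.1.add (hz.mul h3)).of_eq (by field_simp; ring)

theorem memSeq_negBinom {κ : ℝ} (hx : Mem ε δ x κ) : ∀ (j : ℕ) {n : ℕ} {u : AForm} {i : ℕ}, n = i + 1 →
    Mem ε δ u (negBinomCoeff κ i) → MemSeq ε δ (negBinom x j n u) fun m => negBinomCoeff κ (m + i)
  | 0, _, _, _, _, _ => trivial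
  | j + 1, n, u, i, hn, hu => by
    subst hn
    refine ⟨by simpa using hu, ?_⟩
    have h2 := (hu.mul ((mem_ofNat (i + 2)).sub hx)).divNat (d := i + 3) (by omega)
    have h3 := h2.of_eq (v' := negBinomCoeff κ (i + 1)) (by rw [negBinomCoeff]; push_cast; ring)
    exact (memSeq_negBinom hx j (n := i + 2) rfl h3).of_eq fun m => by
      beta_reduce
      rw [add_assoc, add_comm 1]

theorem length_negBinom (κ : AForm) : ∀ (j n : ℕ) (u : AForm), (negBinom κ j n u).length = j
  | 0, _, _ => rfl
  | j + 1, _, _ => by rw [negBinom, List.length_cons, length_negBinom]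

end AForm

end MinkowskiCohn

namespace MinkowskiCohn

open Set Filter Topology

noncomputable def midSeq (a b : ℝ) (j : ℕ) : ℝ := (a ^ (2 * j + 1) + b ^ (2 * j + 1)) / (a + b)

noncomputable def divSeq (a b : ℝ) (j : ℕ) : ℝ :=
  ((a ^ 2) ^ (j + 1) - (b ^ 2) ^ (j + 1)) / (a ^ 2 - b ^ 2)

noncomputable def gapSeq (a b : ℝ) (j : ℕ) : ℝ :=
  ((1 - a ^ 2) * a ^ (2 * j + 1) + (1 - b ^ 2) * b ^ (2 * j + 1)) / ((a + b) * (1 - (a - b) ^ 2))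

section
variable {a b : ℝ}

theorem midSeq_add_two (j : ℕ) :
    midSeq a b (j + 2) = (a ^ 2 + b ^ 2) * midSeq a b (j + 1) - (a * b) ^ 2 * midSeq a b j := by
  unfold midSeq; ring

theorem divSeq_add_two (j : ℕ) :
    divSeq a b (j + 2) = (a ^ 2 + b ^ 2) * divSeq a b (j + 1) - (a * b) ^ 2 * divSeq a b j := by
  unfold divSeq; ring

theorem gapSeq_add_two (j : ℕ) :
    gapSeq a b (j + 2) = (a ^ 2 + b ^ 2) * gapSeq a b (j + 1) - (a * b) ^ 2 * gapSeq a b j := by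
  unfold gapSeq; ring

theorem midSeq_nonneg (ha : 0 ≤ a) (hb : 0 ≤ b) (j : ℕ) : 0 ≤ midSeq a b j := by
  unfold midSeq; positivity

theorem divSeq_nonneg (hb : 0 ≤ b) (hba : b ≤ a) (j : ℕ) : 0 ≤ divSeq a b j := by
  have h : b ^ 2 ≤ a ^ 2 := pow_le_pow_left₀ hb hba 2
  exact div_nonneg (sub_nonneg.2 (pow_le_pow_left₀ (sq_nonneg b) h _)) (sub_nonneg.2 h)

theorem pow_add_two_le {x : ℝ} (h0 : 0 ≤ x) (h1 : x ≤ 1) (j : ℕ) :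
    x ^ (2 * (j + 1) + 1) ≤ x ^ (2 * j + 1) :=
  pow_le_pow_of_le_one h0 h1 (by omega)

theorem midSeq_succ_le (ha : 0 ≤ a) (hb : 0 ≤ b) (ha1 : a ≤ 1) (hb1 : b ≤ 1) (j : ℕ) :
    midSeq a b (j + 1) ≤ midSeq a b j := by
  have h1 := pow_add_two_le ha ha1 j
  have h2 := pow_add_two_le hb hb1 j
  unfold midSeq
  gcongr

theorem gap_denom_nonneg (ha : 0 ≤ a) (hb : 0 ≤ b) (ha1 : a ≤ 1) (hb1 : b ≤ 1) :
    0 ≤ (a + b) * (1 - (a - b) ^ 2) :=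
  mul_nonneg (by linarith) (by nlinarith)

theorem gapSeq_nonneg (ha : 0 ≤ a) (hb : 0 ≤ b) (ha1 : a ≤ 1) (hb1 : b ≤ 1) (j : ℕ) :
    0 ≤ gapSeq a b j := by
  have h1 : 0 ≤ 1 - a ^ 2 := by nlinarith
  have h2 : 0 ≤ 1 - b ^ 2 := by nlinarith
  exact div_nonneg (by positivity) (gap_denom_nonneg ha hb ha1 hb1)

theorem gapSeq_succ_le (ha : 0 ≤ a) (hb : 0 ≤ b) (ha1 : a ≤ 1) (hb1 : b ≤ 1) (j : ℕ) :
    gapSeq a b (j + 1) ≤ gapSeq a b j := by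
  have h1 : 0 ≤ 1 - a ^ 2 := by nlinarith
  have h2 : 0 ≤ 1 - b ^ 2 := by nlinarith
  exact div_le_div_of_nonneg_right (add_le_add
    (mul_le_mul_of_nonneg_left (pow_add_two_le ha ha1 j) h1)
    (mul_le_mul_of_nonneg_left (pow_add_two_le hb hb1 j) h2)) (gap_denom_nonneg ha hb ha1 hb1)

theorem pow_mul_one_sub_le {x y : ℝ} (hy : 0 ≤ y) (hyx : y ≤ x) (hx : x ≤ 1)
    (h : x ^ 2 + x * y + y ^ 2 ≤ x + y) : ∀ {j : ℕ}, 1 ≤ j →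
    y ^ (j + 1) * (1 - y) ≤ x ^ (j + 1) * (1 - x) := by
  intro j hj
  induction j, hj using Nat.le_induction with
  | base =>
    have h1 := mul_nonneg (sub_nonneg.2 hyx) (sub_nonneg.2 h)
    rw [one_add_one_eq_two]
    linarith
  | succ j hj ih =>
    have h1 : 0 ≤ y ^ (j + 1) * (1 - y) := mul_nonneg (by positivity) (by linarith)
    rw [pow_succ', pow_succ' x, mul_assoc, mul_assoc]
    exact mul_le_mul hyx ih h1 (hy.trans hyx)

theorem divSeq_succ_le (hb : 0 ≤ b) (hba : b < a) (ha1 : a ≤ 1)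
    (h : (a ^ 2 + b ^ 2) ^ 2 - (a * b) ^ 2 ≤ a ^ 2 + b ^ 2) {j : ℕ} (hj : 1 ≤ j) :
    divSeq a b (j + 1) ≤ divSeq a b j := by
  have h1 : b ^ 2 < a ^ 2 := by nlinarith
  have h2 := pow_mul_one_sub_le (x := a ^ 2) (sq_nonneg b) h1.le (by nlinarith) (by nlinarith) hj
  refine div_le_div_of_nonneg_right ?_ (by linarith)
  rw [pow_succ (a ^ 2) (j + 1), pow_succ (b ^ 2) (j + 1)]
  linarith

variable {c : ℕ → ℝ} {F F' : ℝ}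

theorem hasSum_mul_midSeq (hF : HasSum (fun j => c j * (a ^ 2) ^ j) F)
    (hF' : HasSum (fun j => c j * (b ^ 2) ^ j) F') :
    HasSum (fun j => c j * midSeq a b j) ((a * F + b * F') / (a + b)) :=
  hasSum_of_eq (((hF.mul_left a).add (hF'.mul_left b)).div_const (a + b))
    (fun j => by unfold midSeq; ring) rfl

theorem hasSum_mul_gapSeq (hF : HasSum (fun j => c j * (a ^ 2) ^ j) F)
    (hF' : HasSum (fun j => c j * (b ^ 2) ^ j) F') :
    HasSum (fun j => c j * gapSeq a b j) (((1 - a ^ 2) * a * F + (1 - b ^ 2) * b * F')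
      / ((a + b) * (1 - (a - b) ^ 2))) :=
  hasSum_of_eq (((hF.mul_left ((1 - a ^ 2) * a)).add (hF'.mul_left ((1 - b ^ 2) * b))).div_const
    ((a + b) * (1 - (a - b) ^ 2)))
    (fun j => by unfold gapSeq; ring) rfl

theorem hasSum_mul_divSeq (hF : HasSum (fun j => c j * (a ^ 2) ^ j) F)
    (hF' : HasSum (fun j => c j * (b ^ 2) ^ j) F') :
    HasSum (fun j => c j * divSeq a b j) ((a ^ 2 * F - b ^ 2 * F') / (a ^ 2 - b ^ 2)) :=
  hasSum_of_eq (((hF.mul_left (a ^ 2)).sub (hF'.mul_left (b ^ 2))).div_const (a ^ 2 - b ^ 2))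
    (fun j => by unfold divSeq; ring) rfl

theorem hasSum_succ_mul_divSeq (hF : HasSum (fun j => c j * (a ^ 2) ^ j) F)
    (hF' : HasSum (fun j => c j * (b ^ 2) ^ j) F') :
    HasSum (fun j => c (j + 1) * divSeq a b j) ((F - F') / (a ^ 2 - b ^ 2)) :=
  hasSum_of_eq (((AForm.hasSum_shift hF).sub (AForm.hasSum_shift hF')).div_const (a ^ 2 - b ^ 2))
    (fun j => by unfold divSeq; ring) (by simp)

end

theorem one_le_evenPow {q x : ℝ} (hq : 1 ≤ q) (h0 : -1 ≤ x) (h1 : x ≤ 1) : 1 ≤ evenPow q x := by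
  have h2 := one_add_mul_self_le_rpow_one_add h0 hq
  have h3 := one_add_mul_self_le_rpow_one_add (s := -x) (by linarith) hq
  rw [← sub_eq_add_neg] at h3
  unfold evenPow
  linarith

theorem mul_le_oddPow {p x : ℝ} (hp : 2 ≤ p) (h0 : 0 ≤ x) (h1 : x < 1) : p * x ≤ oddPow p x := by
  have hd : ∀ y ∈ Ico (0 : ℝ) 1, HasDerivAt (fun y => oddPow p y - p * y)
      (p * evenPow (p - 1) y - p) y := fun y hy =>
    ((hasStrictDerivAt_oddPow (by linarith [hy.1]) hy.2 p).hasDerivAt.sub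
      ((hasDerivAt_id y).const_mul p)).congr_deriv (by simp)
  have hmono : MonotoneOn (fun y => oddPow p y - p * y) (Ico 0 1) := by
    refine monotoneOn_of_deriv_nonneg (convex_Ico 0 1)
      (fun y hy => (hd y hy).continuousAt.continuousWithinAt)
      (fun y hy => (hd y (interior_subset hy)).differentiableAt.differentiableWithinAt)
      fun y hy => ?_
    have hy' := interior_subset hy
    rw [(hd y hy').deriv]
    have := one_le_evenPow (q := p - 1) (x := y) (by linarith) (by linarith [hy'.1]) hy'.2.le
    nlinarith
  have := hmono ⟨le_rfl, one_pos⟩ ⟨h0, h1⟩ h0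
  simp only [oddPow_zero, mul_zero, sub_zero] at this
  linarith

/-- The second order remainder of `(1 - z) ^ κ`. -/
theorem exists_hasSum_negBinomCoeff {κ z : ℝ} (hκ : κ < 1) (hz0 : 0 < z) (hz1 : z < 1) :
    ∃ B, HasSum (fun j => negBinomCoeff κ j * z ^ j) B ∧
      (1 - z) ^ κ = 1 - κ * z - (1 - κ) * z ^ 2 * B := by
  have hc : ∀ j : ℕ, Ring.choose κ (j + 2) * (-z) ^ (j + 2) =
      -((1 - κ) * z ^ 2) * (negBinomCoeff κ j * z ^ j) := by
    intro j
    induction j with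
    | zero => rw [zero_add, choose_two, negBinomCoeff]; ring
    | succ j ih =>
      rw [show j + 1 + 2 = j + 2 + 1 by ring, choose_succ, pow_succ, negBinomCoeff,
        show Ring.choose κ (j + 2) * (κ - (j + 2 : ℕ)) / ((j + 2 : ℕ) + 1) * ((-z) ^ (j + 2) * -z)
        = Ring.choose κ (j + 2) * (-z) ^ (j + 2) * (((j + 2 : ℕ) - κ) / ((j + 2 : ℕ) + 1) * z) by
          ring, ih]
      push_cast
      ring
  have h := hasSum_choose (x := -z) (by rw [abs_neg, abs_of_pos hz0]; exact hz1) κ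
  rw [← hasSum_nat_add_iff' 2] at h
  have hne : -((1 - κ) * z ^ 2) ≠ 0 := by
    have : 0 < 1 - κ := by linarith
    exact neg_ne_zero.2 (by positivity)
  refine ⟨_, hasSum_of_eq (h.mul_left (-((1 - κ) * z ^ 2))⁻¹) (fun j => ?_) rfl, ?_⟩
  · rw [hc, inv_mul_cancel_left₀ hne]
  · rw [Finset.sum_range_succ, Finset.sum_range_one, choose_one, ← sub_eq_add_neg 1 z]
    have hne' : (1 - κ) * z ^ 2 ≠ 0 := neg_ne_zero.1 hne
    simp only [Ring.choose_zero_right, pow_zero, pow_one]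
    generalize (1 - z) ^ κ = Q at *
    rw [inv_neg]
    generalize (1 - κ) * z ^ 2 = P at *
    field_simp
    ring

theorem negBinomCoeff_nonneg {κ : ℝ} (h0 : 0 ≤ κ) (h1 : κ ≤ 1) : ∀ j, 0 ≤ negBinomCoeff κ j
  | 0 => by rw [negBinomCoeff]; positivity
  | j + 1 => by
    rw [negBinomCoeff]
    have : (0 : ℝ) ≤ j := j.cast_nonneg
    exact div_nonneg (mul_nonneg (negBinomCoeff_nonneg h0 h1 j) (by linarith)) (by linarith)

theorem antitone_negBinomCoeff {κ : ℝ} (h0 : 0 ≤ κ) (h1 : κ ≤ 1) : Antitone (negBinomCoeff κ) :=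
  antitone_nat_of_succ_le fun j => by
    have : (0 : ℝ) ≤ j := j.cast_nonneg
    rw [negBinomCoeff, mul_div_assoc]
    exact mul_le_of_le_one_right (negBinomCoeff_nonneg h0 h1 j)
      ((div_le_one (by linarith)).2 (by linarith))

end MinkowskiCohn

namespace MinkowskiCohn

open Set Filter Topology

theorem evenPow_four (x : ℝ) : evenPow 4 x = 1 + 6 * x ^ 2 + x ^ 4 := by
  unfold evenPow
  rw [show (4 : ℝ) = (4 : ℕ) by norm_num, Real.rpow_natCast, Real.rpow_natCast]
  ring

theorem oddPow_four (x : ℝ) : oddPow 4 x = 4 * x + 4 * x ^ 3 := by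
  unfold oddPow
  rw [show (4 : ℝ) = (4 : ℕ) by norm_num, Real.rpow_natCast, Real.rpow_natCast]
  ring

theorem quartic_mean_pos {r w : ℝ} (hr0 : 0 < r) (hr1 : r < 1) (hw : 0 < w) :
    0 < (4 * (w + (0.45 + 0.08 * r)) - 1) * (2 + (4 * (w + (0.45 + 0.08 * r)) - 1) * r) *
      (1 + (1 - (1 - (w + (0.45 + 0.08 * r))) * r)) - (w + (0.45 + 0.08 * r)) *
      (6 + 6 * ((w + (0.45 + 0.08 * r)) * r) + (1 - (1 - (w + (0.45 + 0.08 * r))) * r) +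
        ((w + (0.45 + 0.08 * r)) * r) ^ 2) := by
  have h2 : r ^ 2 ≤ r := by nlinarith
  have h3 : r ^ 3 ≤ r := by nlinarith
  have h4 : r ^ 4 ≤ r := by nlinarith
  have h5 : 0 < r ^ 5 := by positivity
  have c0 : 0 < 0.05 + 0.1525 * r - 0.067125 * r ^ 2 - 0.0678 * r ^ 3 - 0.024 * r ^ 4
      + 0.00768 * r ^ 5 := by linarith
  have c1 : 0 < 9 + 4.7 * r + 1.7925 * r ^ 2 - 0.6 * r ^ 3 + 0.288 * r ^ 4 := by
    have : 0 < r ^ 2 := by positivity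
    have : 0 < r ^ 4 := by positivity
    linarith
  have c2 : 0 < 33 * r - 3.75 * r ^ 2 + 3.6 * r ^ 3 := by
    have : 0 < r ^ 3 := by positivity
    linarith
  have e1 := mul_pos hw c1
  have e2 := mul_pos (pow_pos hw 2) c2
  have e3 := mul_pos (pow_pos hw 3) (pow_pos hr0 2)
  linarith

theorem IsInterior.mul_sub_le {p a b T : ℝ} (h : IsInterior p a b T) (hp2 : 2 < p) (hp4 : p ≤ 4) :
    (1 - (a - b) ^ 2) / 3 ≤ a * b ∧
      a * b ≤ (0.45 + 0.08 * (1 - (a - b) ^ 2)) * (1 - (a - b) ^ 2) := by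
  have ha := h.a_pos
  have hb := h.b_pos
  refine ⟨by linarith [h.one_le_sq_add_mul_add_sq hp2.le], ?_⟩
  obtain ⟨h1, h2⟩ := h.rpow_le_of_le (by linarith) hp4
  rw [evenPow_four, oddPow_four, show (4 : ℝ) = (4 : ℕ) by norm_num, Real.rpow_natCast] at h1 h2
  push_cast at h1 h2
  set r := 1 - (a - b) ^ 2 with hr
  have hr0 : 0 < r := by nlinarith [h.b_lt_a, h.a_lt_one]
  have hr1 : r < 1 := by nlinarith [h.b_lt_a]
  by_contra! hcon
  obtain ⟨w, hw⟩ : ∃ w, a * b = (w + (0.45 + 0.08 * r)) * r := ⟨a * b / r - (0.45 + 0.08 * r), by field_simp; ring⟩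
  have hw0 : 0 < w := by
    rw [hw] at hcon
    by_contra! hw'
    nlinarith
  have h3 := quartic_mean_pos hr0 hr1 hw0
  generalize w + (0.45 + 0.08 * r) = m at *
  have h4 : (a + b) ^ 4 * (1 + (1 - (1 - m) * r)) ≤ 1 + (1 - (1 - m) * r) + 6 * (m * r) + 6 * (m * r) ^ 2
      + m * r * (1 - (1 - m) * r) + (m * r) ^ 3 := by
    have hc : 0 < a + b := by linarith
    have h5 := mul_le_mul_of_nonneg_left h1 (by positivity : 0 ≤ b + b ^ 3)
    have h6 := mul_le_mul_of_nonneg_left h2 (by positivity : 0 ≤ a + a ^ 3)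
    have hf : 1 - (1 - m) * r = a ^ 2 - a * b + b ^ 2 := by linarith
    rw [hf, ← hw]
    refine le_of_mul_le_mul_left ?_ hc
    linarith
  have h5 : (a + b) ^ 2 = 1 + (4 * m - 1) * r := by linarith
  rw [show (a + b) ^ 4 = ((a + b) ^ 2) ^ 2 by ring, h5] at h4
  have h6 := mul_pos hr0 h3
  linarith

theorem sq_sub_le_of_le {m r : ℝ} (hr0 : 0 < r) (hr1 : r < 1) (hm0 : 1 / 3 ≤ m)
    (hm : m ≤ 0.45 + 0.08 * r) :
    (1 - (1 - 2 * m) * r) ^ 2 - (m * r) ^ 2 ≤ 1 - (1 - 2 * m) * r := by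
  rcases le_total m (1 / 2) with h | h
  · have h1 : 0 ≤ (1 - 2 * m) * r := by apply mul_nonneg <;> linarith
    have h2 : 0 ≤ 1 - (1 - 2 * m) * r := by nlinarith
    nlinarith [mul_nonneg h1 h2, sq_nonneg (m * r)]
  · have h1 : 5 / 8 ≤ r := by linarith
    have h2 : 1 - (1 - 2 * m) * r ≤ 1.06 := by nlinarith
    have h3 : 0 ≤ (2 * m - 1) * r := by apply mul_nonneg <;> linarith
    have h4 : (1 - (1 - 2 * m) * r) * ((2 * m - 1) * r) ≤ 1.06 * (0.06 * r) := by
      apply mul_le_mul h2 _ h3 (by norm_num)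
      apply mul_le_mul_of_nonneg_right _ hr0.le
      linarith
    have h5 : 1 / 4 * (5 / 8 * r) ≤ (m * r) ^ 2 := by
      have h6 : 1 / 4 ≤ m ^ 2 := by nlinarith
      have h7 : 5 / 8 * r ≤ r ^ 2 := by nlinarith
      rw [mul_pow]
      exact mul_le_mul h6 h7 (by positivity) (by positivity)
    nlinarith

/-- The data that determine the slope at an interior point, and the series representing it. -/
structure SlopeSystem (k : ℝ) where
  r : ℝ
  m : ℝ
  t : ℝ
  s : ℕ → ℝ
  h : ℕ → ℝ
  g : ℕ → ℝ
  sumAh : ℝ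
  sumAs : ℝ
  sumGs : ℝ
  sumG₁h : ℝ
  sumB : ℝ
  sumEh : ℝ
  sumEs : ℝ
  sumNh : ℝ
  sumνg : ℝ
  sumζs : ℝ
  sumζh : ℝ
  r_pos : 0 < r
  r_lt_one : r < 1
  le_m : 1 / 3 ≤ m
  m_le : m ≤ 0.45 + 0.08 * r
  t_pos : 0 < t
  s_zero : s 0 = 1
  s_one : s 1 = 1 - (1 - m) * r
  s_add_two : ∀ j, s (j + 2) = (1 - (1 - 2 * m) * r) * s (j + 1) - m * r * (m * r) * s j
  s_nonneg : ∀ j, 0 ≤ s j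
  s_succ_le : ∀ j, s (j + 1) ≤ s j
  h_zero : h 0 = 1
  h_one : h 1 = 1 - (1 - 2 * m) * r
  h_add_two : ∀ j, h (j + 2) = (1 - (1 - 2 * m) * r) * h (j + 1) - m * r * (m * r) * h j
  h_nonneg : ∀ j, 0 ≤ h j
  h_succ_le : ∀ j, 1 ≤ j → h (j + 1) ≤ h j
  g_zero : g 0 = 1 - m
  g_one : g 1 = (1 - (1 - m) * r) * (1 - 2 * m) + m * (m * r)
  g_add_two : ∀ j, g (j + 2) = (1 - (1 - 2 * m) * r) * g (j + 1) - m * r * (m * r) * g j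
  g_nonneg : ∀ j, 0 ≤ g j
  g_succ_le : ∀ j, g (j + 1) ≤ g j
  hasSum_Ah : HasSum (fun j => chooseRatio (k + 2) 2 j * h j) sumAh
  hasSum_As : HasSum (fun j => chooseRatio (k + 2) 2 j * s j) sumAs
  hasSum_Gs : HasSum (fun j => chooseRatio (k + 2) 1 j * s j) sumGs
  hasSum_G₁h : HasSum (fun j => chooseRatio (k + 2) 3 j * h j) sumG₁h
  hasSum_B : HasSum (fun j => negBinomCoeff ((2 - k) / 2) j * (1 - (1 + (4 * m - 1) * r)⁻¹) ^ j) sumB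
  hasSum_Eh : HasSum (fun j => chooseRatio (k + 1) 2 j * h j) sumEh
  hasSum_Es : HasSum (fun j => chooseRatio (k + 1) 2 j * s j) sumEs
  hasSum_Nh : HasSum (fun j => (chooseRatio k 1 (j + 1) - chooseRatio k 1 j) * h j) sumNh
  hasSum_νg : HasSum (fun j => chooseRatio k 1 j * g j) sumνg
  hasSum_ζs : HasSum (fun j => chooseRatio (k + 1) 1 j * s j) sumζs
  hasSum_ζh : HasSum (fun j => chooseRatio (k + 1) 1 (j + 1) * h j) sumζh
  one_le_sumGs : 1 ≤ sumGs
  t_eq : t = (k + 1) / 2 * sumAh * sumGs⁻¹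
  one_le_theta : 1 ≤ 1 + (4 * m - 1) * r * (1 - 2 * (k + 2)⁻¹) * (1 - sumB)
  inv_m : m⁻¹ = 4 - (k + 1) * (sumAs - (1 - r) * t * (k / 3) * sumG₁h) *
    (1 + (4 * m - 1) * r * (1 - 2 * (k + 2)⁻¹) * (1 - sumB))⁻¹

namespace SlopeSystem
variable {k : ℝ} (M : SlopeSystem k)

noncomputable def q : ℝ := M.m * M.r

noncomputable def D : ℝ := (k + 1) * k / 2 * M.sumEh

noncomputable def Z : ℝ := (k + 1) * k / 2 * M.sumEs

noncomputable def X : ℝ := M.t + M.q * (M.t * M.Z - M.D)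

noncomputable def S : ℝ :=
  M.sumνg * M.X + M.m * M.sumNh * (1 + M.q * M.Z + (1 - M.r) * M.D * (1 - M.t))

noncomputable def Y : ℝ :=
  (k + 1) * M.sumζs * (1 + M.q * M.Z) - M.q * (1 - M.r) * ((k + 1) * M.sumζh) * M.D

end SlopeSystem

end MinkowskiCohn

namespace MinkowskiCohn

open Set Filter Topology

theorem slopeNum_eq_of_eq {k a b T r m t E E' ν N : ℝ} (ha : 0 < a) (ha1 : a < 1)
    (hb : 0 < b) (hb1 : b < 1) (hr : r = 1 - (a - b) ^ 2) (hm : m * r = a * b)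
    (hT : T = t * (a - b))
    (hE : (a ^ 2 - b ^ 2) * ((k + 1) * k / 2 * E) = evenPow (k + 1) a - evenPow (k + 1) b)
    (hE' : a * b * (a + b) * ((k + 1) * k / 2 * E') =
      b * (evenPow (k + 1) a - 1) + a * (evenPow (k + 1) b - 1))
    (hν : k * (a + b) * r * ν = (1 - a ^ 2) * oddPow k a + (1 - b ^ 2) * oddPow k b)
    (hN : a * b * (k * (a ^ 2 - b ^ 2) * N) =
      b * ((1 - a ^ 2) * oddPow k a) - a * ((1 - b ^ 2) * oddPow k b)) :
    slopeNum (k + 2) a b T = -(k * (a + b) * (a - b) * r * (ν * (t + m * r *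
      (t * ((k + 1) * k / 2 * E') - (k + 1) * k / 2 * E)) + m * N * (1 + m * r *
      ((k + 1) * k / 2 * E') + (1 - r) * ((k + 1) * k / 2 * E) * (1 - t)))) := by
  have h1 := one_sub_sq_mul_oddPow (by linarith) ha1 (k + 1)
  have h2 := one_sub_sq_mul_oddPow (by linarith) hb1 (k + 1)
  rw [add_sub_cancel_right] at h1 h2
  rw [h1, h2] at hν hN
  rw [slopeNum_eq_defect, show k + 2 - 1 = k + 1 by ring]
  generalize (k + 1) * k / 2 * E = D at *
  generalize (k + 1) * k / 2 * E' = Z at *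
  have hc : a + b ≠ 0 := by positivity
  obtain ⟨hE₁, hE₂⟩ : evenPow (k + 1) a = 1 + a * b * Z + a * (a - b) * D ∧
      evenPow (k + 1) b = 1 + a * b * Z - b * (a - b) * D := by
    constructor <;> refine mul_left_cancel₀ hc ?_
    · linear_combination -a * hE - hE'
    · linear_combination b * hE - hE'
  rw [← neg_sub (oddPow (k + 1) a), ← neg_sub (oddPow (k + 1) b)]
  generalize oddPow (k + 1) a - a * evenPow (k + 1) a = n at *
  generalize oddPow (k + 1) b - b * evenPow (k + 1) b = n' at *
  rw [← hm] at hN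
  rw [show k * (a + b) * (a - b) * r * (ν * (t + m * r * (t * Z - D))
      + m * N * (1 + m * r * Z + (1 - r) * D * (1 - t))) =
      (a - b) * (k * (a + b) * r * ν) * (t + m * r * (t * Z - D)) +
      m * r * (k * (a ^ 2 - b ^ 2) * N) * (1 + m * r * Z + (1 - r) * D * (1 - t)) by ring,
    hν, hN, hm, hE₁, hE₂, hT, hr]
  ring

theorem slopeDen_eq_of_eq {k a b r m E E' ζ ζ' : ℝ} (ha : 0 < a) (hb : 0 < b)
    (hr : r = 1 - (a - b) ^ 2) (hm : m * r = a * b)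
    (hE : (a ^ 2 - b ^ 2) * ((k + 1) * k / 2 * E) = evenPow (k + 1) a - evenPow (k + 1) b)
    (hE' : a * b * (a + b) * ((k + 1) * k / 2 * E') =
      b * (evenPow (k + 1) a - 1) + a * (evenPow (k + 1) b - 1))
    (hζ : (a + b) * ((k + 1) * ζ) = oddPow (k + 1) a + oddPow (k + 1) b)
    (hζ' : a * b * (a ^ 2 - b ^ 2) * ((k + 1) * ζ') = b * oddPow (k + 1) a - a * oddPow (k + 1) b) :
    slopeDen (k + 2) a b = (a + b) * ((k + 1) * ζ * (1 + m * r * ((k + 1) * k / 2 * E'))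
      - m * r * (1 - r) * ((k + 1) * ζ') * ((k + 1) * k / 2 * E)) := by
  rw [slopeDen, show k + 2 - 1 = k + 1 by ring]
  generalize (k + 1) * k / 2 * E = D at *
  generalize (k + 1) * k / 2 * E' = Z at *
  generalize (k + 1) * ζ = z at *
  generalize (k + 1) * ζ' = z' at *
  have hc : a + b ≠ 0 := by positivity
  obtain ⟨hE₁, hE₂⟩ : evenPow (k + 1) a = 1 + a * b * Z + a * (a - b) * D ∧
      evenPow (k + 1) b = 1 + a * b * Z - b * (a - b) * D := by
    constructor <;> refine mul_left_cancel₀ hc ?_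
    · linear_combination -a * hE - hE'
    · linear_combination b * hE - hE'
  rw [hm, hr, sub_sub_cancel, hE₁, hE₂]
  linear_combination -(1 + a * b * Z) * hζ + (a - b) * D * hζ'

theorem rpow_eq_one_add_of_hasSum {k y B : ℝ} (hy : 0 < y)
    (h : (1 - (1 - (1 + y)⁻¹)) ^ ((2 - k) / 2) = 1 - (2 - k) / 2 * (1 - (1 + y)⁻¹)
      - (1 - (2 - k) / 2) * (1 - (1 + y)⁻¹) ^ 2 * B) (hk : 0 < k) :
    (1 + y) ^ ((k + 2) / 2) =
      1 + (k + 2) / 2 * y * (1 + y * (1 - 2 * (k + 2)⁻¹) * (1 - B)) := by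
  have hy' : 0 < 1 + y := by linarith
  have h1 : (1 + y) ^ ((k + 2) / 2) = (1 + y) ^ 2 * (1 - (1 - (1 + y)⁻¹)) ^ ((2 - k) / 2) := by
    rw [sub_sub_cancel, Real.inv_rpow hy'.le, ← Real.rpow_neg hy'.le, ← Real.rpow_two,
      ← Real.rpow_add hy']
    congr 1; ring
  rw [h1, h]
  field_simp
  ring

theorem add_one_mul_mean_eq {k a b r T E E' O O' C : ℝ} (hk : 0 < k) (ha : 0 < a) (hb : 0 < b)
    (hba : 0 < a - b) (hr : r = 1 - (a - b) ^ 2) (hE : E - T * O = C)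
    (hE' : E' + T * O' = C) :
    a * b * ((k + 2) * (k + 1) / 2) *
      ((a * ((E - 1) / ((k + 2) * (k + 1) / 2 * a ^ 2))
        + b * ((E' - 1) / ((k + 2) * (k + 1) / 2 * b ^ 2))) / (a + b)
      - (1 - r) * (T / (a - b)) * (k / 3) *
        ((a ^ 2 * ((O - (k + 2) * a) / ((k + 2) * (k + 1) * k / 6 * a ^ 3))
          - b ^ 2 * ((O' - (k + 2) * b) / ((k + 2) * (k + 1) * k / 6 * b ^ 3)))
          / (a ^ 2 - b ^ 2))) = C - 1 := by
  have h1 : a * b * ((k + 2) * (k + 1) / 2) * ((a * ((E - 1) / ((k + 2) * (k + 1) / 2 * a ^ 2))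
      + b * ((E' - 1) / ((k + 2) * (k + 1) / 2 * b ^ 2))) / (a + b)) =
      (b * (E - 1) + a * (E' - 1)) / (a + b) := by field_simp
  have h2 : a * b * ((k + 2) * (k + 1) / 2) * ((1 - r) * (T / (a - b)) * (k / 3) *
        ((a ^ 2 * ((O - (k + 2) * a) / ((k + 2) * (k + 1) * k / 6 * a ^ 3))
          - b ^ 2 * ((O' - (k + 2) * b) / ((k + 2) * (k + 1) * k / 6 * b ^ 3)))
          / (a ^ 2 - b ^ 2))) = T * (b * O - a * O') / (a + b) := by
    rw [hr, sub_sub_cancel, show a ^ 2 - b ^ 2 = (a + b) * (a - b) by ring]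
    field_simp
    ring
  rw [mul_sub, h1, h2, ← sub_div, div_eq_iff (by positivity)]
  linear_combination b * hE + a * hE'

theorem inv_eq_of_mul_eq {k m r R Θ C : ℝ} (hk : 0 < k) (hm : 0 < m) (hr : 0 < r) (hΘ : 0 < Θ)
    (h1 : C = 1 + (k + 2) / 2 * ((4 * m - 1) * r) * Θ)
    (h2 : m * r * ((k + 2) * (k + 1) / 2) * R = C - 1) :
    m⁻¹ = 4 - (k + 1) * R * Θ⁻¹ := by
  have h3 : r * ((k + 2) / 2) * (m * (k + 1) * R) = r * ((k + 2) / 2) * ((4 * m - 1) * Θ) := by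
    linear_combination h2 + h1
  have h4 := mul_left_cancel₀ (by positivity) h3
  field_simp
  linarith

set_option maxHeartbeats 800000 in
/-- Every interior point yields a slope system that computes its slope. -/
theorem IsInterior.exists_slopeSystem {k a b T : ℝ} (hk : 0 < k) (hk2 : k ≤ 2)
    (H : IsInterior (k + 2) a b T) : ∃ (M : SlopeSystem k) (c d : ℝ), 0 < c ∧ 0 < d ∧
      d ^ 2 = 1 - M.r ∧ T = M.t * d ∧ slopeNum (k + 2) a b T = -(k * c * d * M.r * M.S) ∧
      slopeDen (k + 2) a b = c * M.Y := by
  have ha := H.a_pos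
  have hb := H.b_pos
  have hba := H.b_lt_a
  have ha1 := H.a_lt_one
  have hb1 := H.b_lt_one
  have hT := H.T_pos
  have hxa : |a| < 1 := by rw [abs_of_pos ha]; exact ha1
  have hxb : |b| < 1 := by rw [abs_of_pos hb]; exact hb1
  obtain ⟨hm1, hm2⟩ := H.mul_sub_le (by linarith) (by linarith)
  have hr0 : 0 < 1 - (a - b) ^ 2 := by nlinarith
  have hr1 : 1 - (a - b) ^ 2 < 1 := by nlinarith
  obtain ⟨r, hr⟩ : ∃ r, r = 1 - (a - b) ^ 2 := ⟨_, rfl⟩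
  obtain ⟨m, hm⟩ : ∃ m, m * r = a * b := ⟨a * b / r, by rw [hr]; field_simp⟩
  rw [← hr] at hr0 hr1 hm1 hm2
  have hm3 : 1 / 3 ≤ m := by
    rw [← hm] at hm1
    exact le_of_mul_le_mul_right (by linarith) hr0
  have hm4 : m ≤ 0.45 + 0.08 * r := by
    rw [← hm] at hm2
    exact le_of_mul_le_mul_right (by linarith) hr0
  have hsq : a ^ 2 + b ^ 2 = 1 - (1 - 2 * m) * r := by linarith
  have hc : 0 < a + b := by linarith
  have hd : 0 < a - b := by linarith
  have hcd : 0 < a ^ 2 - b ^ 2 := by nlinarith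
  have hk1 : (k + 2) * (k + 2 - 1) ≠ 0 := by apply mul_ne_zero <;> linarith
  have hk3 : (k + 2) * (k + 2 - 1) * (k + 2 - 2) ≠ 0 := mul_ne_zero hk1 (by linarith)
  have hk4 : (k + 1) * (k + 1 - 1) ≠ 0 := by apply mul_ne_zero <;> linarith
  have hA := hasSum_chooseRatio_two hxa ha.ne' hk1
  have hA' := hasSum_chooseRatio_two hxb hb.ne' hk1
  have hG := hasSum_chooseRatio_one hxa ha.ne' (q := k + 2) (by linarith)
  have hG' := hasSum_chooseRatio_one hxb hb.ne' (q := k + 2) (by linarith)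
  have hG₁ := hasSum_chooseRatio_three hxa ha.ne' hk3
  have hG₁' := hasSum_chooseRatio_three hxb hb.ne' hk3
  have hE := hasSum_chooseRatio_two hxa ha.ne' hk4
  have hE' := hasSum_chooseRatio_two hxb hb.ne' hk4
  have hν := hasSum_chooseRatio_one hxa ha.ne' hk.ne'
  have hν' := hasSum_chooseRatio_one hxb hb.ne' hk.ne'
  have hζ := hasSum_chooseRatio_one hxa ha.ne' (q := k + 1) (by linarith)
  have hζ' := hasSum_chooseRatio_one hxb hb.ne' (q := k + 1) (by linarith)
  have hy : 0 < (4 * m - 1) * r := mul_pos (by linarith) hr0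
  have hz0 : 0 < 1 - (1 + (4 * m - 1) * r)⁻¹ := sub_pos.2 (inv_lt_one_of_one_lt₀ (by linarith))
  have hz1 : 1 - (1 + (4 * m - 1) * r)⁻¹ < 1 := by
    have : 0 < (1 + (4 * m - 1) * r)⁻¹ := inv_pos.2 (by linarith)
    linarith
  obtain ⟨B, hB, hB'⟩ := exists_hasSum_negBinomCoeff (κ := (2 - k) / 2) (by linarith) hz0 hz1
  have hpow := rpow_eq_one_add_of_hasSum hy hB' hk
  have hcp : (1 + (4 * m - 1) * r) ^ ((k + 2) / 2) = (a + b) ^ (k + 2) := by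
    rw [show 1 + (4 * m - 1) * r = (a + b) ^ 2 by linarith, ← Real.rpow_two, ← Real.rpow_mul hc.le]
    congr 1; ring
  obtain ⟨Θ, hΘ⟩ : ∃ Θ, Θ = 1 + (4 * m - 1) * r * (1 - 2 * (k + 2)⁻¹) * (1 - B) := ⟨_, rfl⟩
  have hΘ1 : 1 ≤ Θ := by
    have h1 := one_add_mul_self_le_rpow_one_add (s := (4 * m - 1) * r) (by linarith)
      (p := (k + 2) / 2) (by linarith)
    rw [hpow, ← hΘ] at h1
    have h2 : 0 < (k + 2) / 2 * ((4 * m - 1) * r) := by positivity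
    nlinarith
  rw [hcp, ← hΘ] at hpow
  have hGa := mul_le_oddPow (p := k + 2) (by linarith) ha.le ha1
  have hGb := mul_le_oddPow (p := k + 2) (by linarith) hb.le hb1
  have eqa := H.eq_a
  have eqb := H.eq_b
  have hOO : 0 < oddPow (k + 2) a + oddPow (k + 2) b := by
    have : 0 < (k + 2) * a := by positivity
    have : 0 < (k + 2) * b := by positivity
    linarith
  have hd2 : (a - b) ^ 2 = 1 - r := by linarith
  refine ⟨{ r := r, m := m, t := T / (a - b), s := midSeq a b, h := divSeq a b, g := gapSeq a b
            sumAh := _, sumAs := _, sumGs := _, sumG₁h := _, sumB := B, sumEh := _, sumEs := _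
            sumNh := _, sumνg := _, sumζs := _, sumζh := _
            r_pos := hr0, r_lt_one := hr1, le_m := hm3, m_le := hm4, t_pos := by positivity
            s_zero := ?_, s_one := ?_, s_add_two := fun j => ?_
            s_nonneg := midSeq_nonneg ha.le hb.le
            s_succ_le := midSeq_succ_le ha.le hb.le ha1.le hb1.le
            h_zero := ?_, h_one := ?_, h_add_two := fun j => ?_
            h_nonneg := divSeq_nonneg hb.le hba.le
            h_succ_le := fun j hj => divSeq_succ_le hb.le hba ha1.le ?_ hj
            g_zero := ?_, g_one := ?_, g_add_two := fun j => ?_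
            g_nonneg := gapSeq_nonneg ha.le hb.le ha1.le hb1.le
            g_succ_le := gapSeq_succ_le ha.le hb.le ha1.le hb1.le
            hasSum_Ah := hasSum_mul_divSeq hA hA'
            hasSum_As := hasSum_mul_midSeq hA hA'
            hasSum_Gs := hasSum_mul_midSeq hG hG'
            hasSum_G₁h := hasSum_mul_divSeq hG₁ hG₁'
            hasSum_B := hB
            hasSum_Eh := hasSum_mul_divSeq hE hE'
            hasSum_Es := hasSum_mul_midSeq hE hE'
            hasSum_Nh := hasSum_of_eq ((hasSum_succ_mul_divSeq hν hν').sub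
              (hasSum_mul_divSeq hν hν')) (fun j => sub_mul _ _ _) rfl
            hasSum_νg := hasSum_mul_gapSeq hν hν'
            hasSum_ζs := hasSum_mul_midSeq hζ hζ'
            hasSum_ζh := hasSum_succ_mul_divSeq hζ hζ'
            one_le_sumGs := ?_, t_eq := ?_, one_le_theta := by rwa [← hΘ], inv_m := ?_ },
          a + b, a - b, hc, hd, ?_, ?_, ?_, ?_⟩
  · simp [midSeq, hc.ne']
  · unfold midSeq
    rw [show 1 - (1 - m) * r = a ^ 2 - a * b + b ^ 2 by linarith]
    field_simp; ring
  · rw [midSeq_add_two, hsq, hm]; ring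
  · simp [divSeq, hcd.ne']
  · unfold divSeq
    rw [← hsq]
    field_simp; ring
  · rw [divSeq_add_two, hsq, hm]; ring
  · rw [hsq, ← hm]; exact sq_sub_le_of_le hr0 hr1 hm3 hm4
  · rw [gapSeq, ← hr, div_eq_iff (by positivity)]
    linear_combination (a + b) * hm - (a + b) * hr
  · rw [gapSeq, ← hr, div_eq_iff (by positivity), show ((1 - (1 - m) * r) * (1 - 2 * m)
      + m * (m * r)) * ((a + b) * r) = (a + b) * ((1 - (1 - m) * r) * (r - 2 * (m * r))
      + (m * r) * (m * r)) by ring, show 1 - (1 - m) * r = a ^ 2 - a * b + b ^ 2 by linarith, hm, hr]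
    ring
  · rw [gapSeq_add_two, hsq, hm]; ring
  · rw [le_div_iff₀ hc, ← mul_div_assoc, ← mul_div_assoc, mul_comm (k + 2) a, mul_comm (k + 2) b,
      mul_div_mul_left _ _ ha.ne', mul_div_mul_left _ _ hb.ne', ← add_div,
      le_div_iff₀ (by linarith)]
    linarith
  · rw [show k + 2 - 1 = k + 1 by ring]
    have : evenPow (k + 2) a - evenPow (k + 2) b = T * (oddPow (k + 2) a + oddPow (k + 2) b) := by
      linarith
    rw [show a ^ 2 - b ^ 2 = (a + b) * (a - b) by ring]
    field_simp
    linear_combination -this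
  · rw [← hΘ]
    refine inv_eq_of_mul_eq hk (by linarith) hr0 (by linarith) hpow ?_
    rw [hm, show k + 2 - 1 = k + 1 by ring, add_sub_cancel_right]
    exact add_one_mul_mean_eq hk ha hb hd hr eqa eqb
  · exact hd2
  · exact (div_mul_cancel₀ T hd.ne').symm
  · refine slopeNum_eq_of_eq ha ha1 hb hb1 hr hm (div_mul_cancel₀ T hd.ne').symm ?_ ?_ ?_ ?_
    all_goals dsimp only; try rw [add_sub_cancel_right]
    · field_simp
      ring
    · field_simp
    · field_simp
      rw [← hr]
      field_simp
    · field_simp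
      ring
  · refine slopeDen_eq_of_eq ha hb hr hm ?_ ?_ ?_ ?_
    all_goals dsimp only; try rw [add_sub_cancel_right]
    · field_simp
      ring
    · field_simp
    · field_simp
    · field_simp

end MinkowskiCohn

namespace MinkowskiCohn

open Set Filter Topology
open AForm

variable {ε δ : Noise} {k : ℝ}

/-- The forms `K` enclose the quantities that depend on the exponent `k` only. -/
structure ExpForms.Encloses (ε δ : Noise) (k : ℝ) (I J : ℕ) (K : ExpForms) : Prop where
  mem_k : Mem ε δ K.k k
  mem_s : Mem ε δ K.s (k + 1)
  mem_kp : Mem ε δ K.kp (1 - 2 * (k + 2)⁻¹)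
  mem_A : MemSeq ε δ K.A (chooseRatio (k + 2) 2)
  mem_G : MemSeq ε δ K.G (chooseRatio (k + 2) 1)
  mem_G₁ : MemSeq ε δ K.G₁ (chooseRatio (k + 2) 3)
  mem_E : MemSeq ε δ K.E (chooseRatio (k + 1) 2)
  mem_ν : MemSeq ε δ K.ν (chooseRatio k 1)
  mem_N : MemSeq ε δ K.N fun j => chooseRatio k 1 (j + 1) - chooseRatio k 1 j
  mem_ζ : MemSeq ε δ K.ζ (chooseRatio (k + 1) 1)
  mem_co : MemSeq ε δ K.co (negBinomCoeff ((2 - k) / 2))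
  length_A : K.A.length = I + 1
  length_G : K.G.length = I + 2
  length_G₁ : K.G₁.length = I + 1
  length_E : K.E.length = J + 1
  length_ν : K.ν.length = J + 1
  length_N : K.N.length = J
  length_ζ : K.ζ.length = 3
  length_co : K.co.length = 6

theorem memSeq_choose_one {β : ℝ} {g : AForm} {n : ℕ} (j : ℕ) (hg : Mem ε δ g (β - n)) :
    MemSeq ε δ (choose j g n (ofNat 1)) (chooseRatio β n) :=
  (memSeq_choose j hg mem_one).of_eq fun _ => (one_mul _).symm

theorem ExpForms.encloses_ofBox {x : AForm} (hx : Mem ε δ x k) (hk : 0 ≤ k) (I J : ℕ) :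
    (ExpForms.ofBox x I J).Encloses ε δ k I J where
  mem_k := hx
  mem_s := hx.add mem_one
  mem_kp := mem_one.sub ((((hx.add (mem_ofNat 2)).inv (by push_cast; linarith)).scale 2).of_eq
    (by push_cast; ring))
  mem_A := memSeq_choose_one _ (hx.of_eq (by push_cast; ring))
  mem_G := memSeq_choose_one _ ((hx.add mem_one).of_eq (by push_cast; ring))
  mem_G₁ := memSeq_choose_one _ ((hx.sub mem_one).of_eq (by push_cast; ring))
  mem_E := memSeq_choose_one _ ((hx.sub mem_one).of_eq (by push_cast; ring))
  mem_ν := memSeq_choose_one _ ((hx.sub mem_one).of_eq (by push_cast; ring))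
  mem_N := memSeq_diff (memSeq_choose_one _ ((hx.sub mem_one).of_eq (by push_cast; ring)))
  mem_ζ := memSeq_choose_one _ (hx.of_eq (by push_cast; ring))
  mem_co := by
    have h := ((mem_ofNat 2).sub hx).divNat (d := 2) two_pos
    push_cast at h
    exact memSeq_negBinom h 6 (i := 0) rfl ((h.divNat two_pos).of_eq (by simp [negBinomCoeff]))
  length_A := length_choose _ _ _ _
  length_G := length_choose _ _ _ _
  length_G₁ := length_choose _ _ _ _
  length_E := length_choose _ _ _ _
  length_ν := length_choose _ _ _ _
  length_N := by
    change (diff (choose (J + 1) _ _ _)).length = J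
    rw [length_diff, length_choose]; rfl
  length_ζ := length_choose _ _ _ _
  length_co := length_negBinom _ _ _ _

/-- The forms `P` enclose the quantities that depend on the coordinates of the point only. -/
structure PointForms.Encloses (ε δ : Noise) (M : SlopeSystem k) (n : ℕ) (P : PointForms) : Prop where
  mem_q : Mem ε δ P.q (M.m * M.r)
  mem_e₁ : Mem ε δ P.e₁ (1 - (1 - 2 * M.m) * M.r)
  mem_e₂ : Mem ε δ P.e₂ (M.m * M.r * (M.m * M.r))
  mem_f : Mem ε δ P.f (1 - (1 - M.m) * M.r)
  mem_h : MemSeq ε δ P.h M.h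
  mem_s : MemSeq ε δ P.s M.s
  length_h : P.h.length = n
  length_s : P.s.length = n

variable {M : SlopeSystem k} {K : ExpForms} {P : PointForms} {r m : AForm} {I J : ℕ}

theorem PointForms.encloses_of (hr : Mem ε δ r M.r) (hm : Mem ε δ m M.m) (n : ℕ) :
    (PointForms.of r m n).Encloses ε δ M n := by
  have hq := hm.mul hr
  have h1 := mem_one.sub ((mem_one.sub (hm.scale 2)).mul hr)
  push_cast at h1
  have hf := mem_one.sub ((mem_one.sub hm).mul hr)
  exact ⟨hq, h1, hq.mul hq, hf,
    memSeq_linRec h1 (hq.mul hq) n M.h_add_two (mem_one.of_eq M.h_zero) (h1.of_eq M.h_one),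
    memSeq_linRec h1 (hq.mul hq) n M.s_add_two (mem_one.of_eq M.s_zero) (hf.of_eq M.s_one),
    length_linRec _ _ _ _ _, length_linRec _ _ _ _ _⟩

theorem mem_tForm (hk : 0 < k) (hk2 : k ≤ 2) (hK : K.Encloses ε δ k I J) {n : ℕ}
    (hP : P.Encloses ε δ M n) (hI : 1 ≤ I) (hn : I + 1 < n) : Mem ε δ (tForm K P I) M.t := by
  have hI' : (1 : ℝ) ≤ I := by exact_mod_cast hI
  rw [M.t_eq]
  refine ((((hK.mem_s.divNat two_pos).of_eq (by push_cast; rfl)).mul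
    (mem_dotTail (β := k + 2) two_pos (by push_cast; linarith) I hK.mem_A
      (fun j => (one_mul _).symm) hP.mem_h M.h_nonneg (fun j hj => M.h_succ_le j (hI.trans hj))
      (by push_cast; linarith) (by rw [hK.length_A]; omega) (by rw [hP.length_h]; omega)
      M.hasSum_Ah)).mul
    ((mem_dotTail (β := k + 2) two_pos (by push_cast; linarith) (I + 1) hK.mem_G
      (fun j => (one_mul _).symm) hP.mem_s M.s_nonneg (fun j _ => M.s_succ_le j)
      (by push_cast; linarith) (by rw [hK.length_G]; omega) (by rw [hP.length_s]; omega)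
      M.hasSum_Gs).inv M.one_le_sumGs))

theorem mem_mStep (hk : 0 < k) (hk2 : k ≤ 2) (hK : K.Encloses ε δ k I J) (hI : 1 ≤ I)
    (hr : Mem ε δ r M.r) (hm : Mem ε δ m M.m) : Mem ε δ (mStep K I r m) M.m := by
  have hI' : (1 : ℝ) ≤ I := by exact_mod_cast hI
  have hP := PointForms.encloses_of hr hm (I + 2)
  have ht := mem_tForm hk hk2 hK hP hI (by omega)
  have hm0 := M.le_m
  have hm1 := M.m_le
  have hr0 := M.r_pos
  have hr1 := M.r_lt_one
  have hy0 : 0 < (4 * M.m - 1) * M.r := mul_pos (by linarith) hr0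
  have hR := (mem_dotTail (β := k + 2) (i := 2) (d := 1) two_pos (by push_cast; linarith) I hK.mem_A
      (fun j => (one_mul _).symm) hP.mem_s M.s_nonneg (fun j _ => M.s_succ_le j)
      (by push_cast; linarith) (by rw [hK.length_A]; omega) (by rw [hP.length_s]; omega)
      M.hasSum_As).sub
    ((((mem_one.sub hr).mul ht).mul (hK.mem_k.divNat (d := 3) three_pos)).mul
    (mem_dotTail (β := k + 2) (i := 2) (d := 1) two_pos (by push_cast; linarith) I hK.mem_G₁
      (fun j => (one_mul _).symm) hP.mem_h M.h_nonneg (fun j hj => M.h_succ_le j (hI.trans hj))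
      (by push_cast; linarith) (by rw [hK.length_G₁]; omega) (by rw [hP.length_h]; omega)
      M.hasSum_G₁h))
  have hy := (((hm.scale 4).sub mem_one).mul hr)
  push_cast at hy hR
  have hz := mem_one.sub ((mem_one.add hy).inv (by linarith))
  have hi : 0 < (1 + (4 * M.m - 1) * M.r)⁻¹ := inv_pos.2 (by linarith)
  have hi1 : (1 + (4 * M.m - 1) * M.r)⁻¹ < 1 := inv_lt_one_of_one_lt₀ (by linarith)
  have hB := mem_horner (by linarith) (by linarith) hz (hy.of_eq (by field_simp; ring)) hK.mem_co
    (negBinomCoeff_nonneg (by linarith) (by linarith))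
    (antitone_negBinomCoeff (by linarith) (by linarith)) (by rw [hK.length_co]; norm_num) M.hasSum_B
  have hΘ := mem_one.add ((hy.mul hK.mem_kp).mul (mem_one.sub hB))
  have h4 := (mem_ofNat 4).sub ((hK.mem_s.mul hR).mul (hΘ.inv M.one_le_theta))
  push_cast at h4
  rw [← M.inv_m] at h4
  exact (h4.inv (one_le_inv_iff₀.2 ⟨by linarith, by linarith⟩)).of_eq (inv_inv _).symm

theorem mem_iterate {f : AForm → AForm} {v : ℝ} (hf : ∀ x, Mem ε δ x v → Mem ε δ (f x) v) (n : ℕ)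
    {x : AForm} (hx : Mem ε δ x v) : Mem ε δ (f^[n] x) v := by
  induction n with
  | zero => exact hx
  | succ n ih => rw [Function.iterate_succ_apply']; exact hf _ ih

theorem mem_mForm (hk : 0 < k) (hk2 : k ≤ 2) (hK : K.Encloses ε δ k I J) (hI : 1 ≤ I)
    (hr : Mem ε δ r M.r) (n : ℕ) : Mem ε δ (mForm K I n r) M.m := by
  have hm0 := M.le_m
  have hm1 := M.m_le
  have hm : Mem ε δ (range 357913941
      (Nat.add (Nat.div (Nat.add (Nat.mul 45 unit) (Nat.mul 8 r.high)) 100) 1)) M.m := by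
    apply AForm.mem_range
    · rw [show (unit : ℝ) = 1073741824 by norm_num [AForm.unit]]
      push_cast
      linarith
    · have h1 := lt_cast_div (Nat.add (Nat.mul 45 unit) (Nat.mul 8 r.high)) (d := 100) (by norm_num)
      have h2 := hr.le_high
      have h3 := mul_le_mul_of_nonneg_right hm1 unit_pos.le
      simp only [Nat.add_eq, Nat.mul_eq] at *
      push_cast at h1 ⊢
      linarith
  exact mem_iterate (fun x => mem_mStep hk hk2 hK hI hr) n
    (hm.clip (mem_mStep hk hk2 hK hI hr hm) (by linarith))

end MinkowskiCohn

namespace MinkowskiCohn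

open Set Filter Topology
open AForm

theorem chooseRatio_add (β : ℝ) (n i j : ℕ) :
    chooseRatio β n (i + j) = chooseRatio β n i * chooseRatio β (n + 2 * i) j := by
  induction j with
  | zero => simp [chooseRatio_zero]
  | succ j ih =>
    rw [← add_assoc, chooseRatio_succ, chooseRatio_succ, ih]
    push_cast
    ring

variable {ε δ : Noise} {k : ℝ} {M : SlopeSystem k} {K : ExpForms} {P : PointForms} {r m : AForm}
  {I J : ℕ}

theorem exists_sumNh_eq (hk : 0 < k) (hk2 : k ≤ 2) (M : SlopeSystem k) (J : ℕ) :
    ∃ θ, 0 ≤ θ ∧ θ ≤ 1 ∧ M.sumNh = ∑ j ∈ Finset.range (J + 1),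
      (chooseRatio k 1 (j + 1) - chooseRatio k 1 j) * M.h j
      - chooseRatio k 1 (J + 1) * M.h (J + 1) * θ := by
  have hJ : (0 : ℝ) ≤ J := J.cast_nonneg
  obtain ⟨θ, h0, h1, hθ⟩ := exists_hasSum_chooseRatio_sub_mul (β := k) (n := 1 + 2 * (J + 1)) hk.le
    (by push_cast; linarith) (w := fun j => M.h (J + 1 + j)) (fun j => M.h_nonneg _)
    (fun j => M.h_succ_le (J + 1 + j) (by omega))
  refine ⟨θ, h0, h1, ?_⟩
  have h2 := (hasSum_nat_add_iff' (J + 1)).2 M.hasSum_Nh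
  have h3 := hasSum_of_eq (hθ.mul_left (-chooseRatio k 1 (J + 1)))
    (g := fun j => (chooseRatio k 1 (j + (J + 1) + 1) - chooseRatio k 1 (j + (J + 1))) *
      M.h (j + (J + 1))) (fun j => ?_) rfl
  · have h4 := h2.unique h3
    rw [add_zero] at h4
    linarith
  · rw [show j + (J + 1) + 1 = J + 1 + (j + 1) by omega, show j + (J + 1) = J + 1 + j by omega,
      chooseRatio_add k 1 (J + 1) (j + 1), chooseRatio_add k 1 (J + 1) j]
    ring

theorem mem_slopeForms (hk : 0 < k) (hk2 : k ≤ 2) (hK : K.Encloses ε δ k I J) (hI : 1 ≤ I)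
    (hIJ : I < J) (hr : Mem ε δ r M.r) (hm : Mem ε δ m M.m) {tail : Option (ℕ × ℕ)} {Q : ℝ}
    (hQ : ∀ l : List AForm, MemSeq ε δ l M.g → l.length = J + 1 → Mem ε δ (match tail with
      | none => dot J K.ν l
      | some (i, j) => dotTail i j J 1 K.ν l) Q) :
    Mem ε δ (slopeForms K I J tail r m).S
      (Q * M.X + M.m * M.sumNh * (1 + M.q * M.Z + (1 - M.r) * M.D * (1 - M.t))) ∧
    Mem ε δ (slopeForms K I J tail r m).X M.X ∧ Mem ε δ (slopeForms K I J tail r m).t M.t ∧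
    Mem ε δ (slopeForms K I J tail r m).Y M.Y := by
  obtain ⟨J', rfl⟩ : ∃ J', J = J' + 1 + 1 := ⟨J - 2, by omega⟩
  have hJ' : (0 : ℝ) ≤ J' := J'.cast_nonneg
  have hP := PointForms.encloses_of hr hm (J' + 1 + 1 + 1)
  have ht := mem_tForm hk hk2 hK hP hI (by omega)
  have hd := mem_one.sub hr
  have he := (hK.mem_s.mul hK.mem_k).divNat (d := 2) two_pos
  have hD := he.mul (mem_dotTail (β := k + 1) (i := 1) (d := 1) one_pos (by push_cast; linarith)
    (J' + 1 + 1) hK.mem_E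
    (fun j => (one_mul _).symm) hP.mem_h M.h_nonneg (fun j hj => M.h_succ_le j (by omega))
    (by push_cast; linarith) (by rw [hK.length_E]; omega) (by rw [hP.length_h]; omega) M.hasSum_Eh)
  have hZ := he.mul (mem_dotTail (β := k + 1) (i := 1) (d := 1) one_pos (by push_cast; linarith)
    (J' + 1 + 1) hK.mem_E
    (fun j => (one_mul _).symm) hP.mem_s M.s_nonneg (fun j _ => M.s_succ_le j)
    (by push_cast; linarith) (by rw [hK.length_E]; omega) (by rw [hP.length_s]; omega) M.hasSum_Es)
  replace hD := hD.of_eq (show M.D = _ from rfl)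
  replace hZ := hZ.of_eq (show M.Z = _ from rfl)
  obtain ⟨θ, h0, h1, hN⟩ := exists_sumNh_eq hk hk2 M J'
  have hDN := ((mem_dot (J' + 1) hK.mem_N hP.mem_h (by rw [hK.length_N]; omega)
    (by rw [hP.length_h]; omega)).sub
    (((hK.mem_ν.getD (x := ofNat 1) (i := J' + 1) (by rw [hK.length_ν]; omega)).mul
      (hP.mem_h.getD (x := ofNat 1) (i := J' + 1) (by rw [hP.length_h]; omega))).mul
      (mem_range_unit h0 h1))).of_eq hN
  have hg := memSeq_linRec hP.mem_e₁ hP.mem_e₂ (J' + 1 + 1 + 1) M.g_add_two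
    ((mem_one.sub hm).of_eq M.g_zero)
    (((hP.mem_f.mul (mem_one.sub (hm.scale 2))).add (hm.mul hP.mem_q)).of_eq
      (by rw [M.g_one]; push_cast; rfl))
  have hQ' := hQ _ hg (length_linRec _ _ _ _ _)
  have hqZ := mem_one.add (hP.mem_q.mul hZ)
  have hX := ht.add (hP.mem_q.mul ((ht.mul hZ).sub hD))
  have hζs := mem_dotTail (β := k + 1) (i := 1) (d := 1) one_pos (by push_cast; linarith) 2
    hK.mem_ζ
    (fun j => (one_mul _).symm) hP.mem_s M.s_nonneg (fun j _ => M.s_succ_le j)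
    (by push_cast; linarith) (by rw [hK.length_ζ]; omega) (by rw [hP.length_s]; omega) M.hasSum_ζs
  have hζh := mem_dotTail (β := k + 1) (i := 1) (d := 1) one_pos (by push_cast; linarith) 1
    (n := 3) hK.mem_ζ.tail
    (fun j => chooseRatio_succ' (k + 1) 1 j) hP.mem_h M.h_nonneg (fun j hj => M.h_succ_le j hj)
    (by push_cast; linarith) (by rw [List.length_tail, hK.length_ζ]; omega)
    (by rw [hP.length_h]; omega) M.hasSum_ζh
  exact ⟨(hQ'.mul hX).add ((hm.mul hDN).mul (hqZ.add ((hd.mul hD).mul (mem_one.sub ht)))), hX, ht,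
    ((hK.mem_s.mul hζs).mul hqZ).sub (((hP.mem_q.mul hd).mul (hK.mem_s.mul hζh)).mul hD)⟩

theorem mem_slopeForms_some (hk : 0 < k) (hk2 : k ≤ 2) (hK : K.Encloses ε δ k I J) (hI : 1 ≤ I)
    (hIJ : I < J) (hr : Mem ε δ r M.r) (hm : Mem ε δ m M.m) {i j : ℕ} (hi : 0 < i)
    (hij : (i : ℝ) ≤ k * j) : Mem ε δ (slopeForms K I J (some (i, j)) r m).S M.S ∧
    Mem ε δ (slopeForms K I J (some (i, j)) r m).t M.t ∧
    Mem ε δ (slopeForms K I J (some (i, j)) r m).Y M.Y := by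
  have hJ : (1 : ℝ) ≤ J := by exact_mod_cast hI.trans hIJ.le
  obtain ⟨h1, -, h2⟩ := mem_slopeForms hk hk2 hK hI hIJ hr hm (tail := some (i, j))
    (Q := M.sumνg) (fun l hl hl' => mem_dotTail (β := k) hi hij J hK.mem_ν
      (fun j => (one_mul _).symm) hl M.g_nonneg (fun j _ => M.g_succ_le j)
      (by push_cast; linarith) (by rw [hK.length_ν]; omega) (by omega) M.hasSum_νg)
  exact ⟨h1, h2⟩

theorem mem_slopeForms_none (hk : 0 < k) (hk1 : k ≤ 1) (hK : K.Encloses ε δ k I J) (hI : 1 ≤ I)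
    (hIJ : I < J) (hr : Mem ε δ r M.r) (hm : Mem ε δ m M.m) :
    Mem ε δ (slopeForms K I J none r m).X M.X ∧
    (0 ≤ M.X → ∃ v, v ≤ M.S ∧ Mem ε δ (slopeForms K I J none r m).S v) := by
  obtain ⟨h1, h2, -⟩ := mem_slopeForms hk (by linarith) hK hI hIJ hr hm (tail := none)
    (Q := ∑ j ∈ Finset.range J, chooseRatio k 1 j * M.g j)
    (fun l hl hl' => mem_dot J hK.mem_ν hl (by rw [hK.length_ν]; omega) (by omega))
  refine ⟨h2, fun hX => ⟨_, ?_, h1⟩⟩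
  rw [SlopeSystem.S]
  gcongr
  exact sum_le_hasSum _ (fun j _ => mul_nonneg (chooseRatio_nonneg (by exact_mod_cast hk1) j)
    (M.g_nonneg j)) M.hasSum_νg

end MinkowskiCohn

namespace MinkowskiCohn

open Set Filter Topology
open AForm

theorem abs_div_sub_le_one {x y z : ℝ} (hy : 0 < y) (h₁ : z ≤ x) (h₂ : x ≤ z + y) :
    |(2 * x - (2 * z + y)) / y| ≤ 1 := by
  rw [abs_div, abs_of_pos hy, div_le_one hy, _root_.abs_le]
  constructor <;> linarith

theorem exists_mem_kBox {k : ℝ} {l h : ℕ} (hlh : 1600 ≤ l + h) (hl : (l : ℝ) < 400 * (k + 2))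
    (hh : 400 * (k + 2) ≤ h) : ∃ ε : Noise, ∀ δ : Noise, Mem ε δ (kBox l h) k := by
  have hlt : (l : ℝ) < h := hl.trans_le hh
  have hle : l ≤ h := by exact_mod_cast hlt.le
  have hpos : (0 : ℝ) < h - l := sub_pos.2 hlt
  set e : ℝ := (2 * (400 * (k + 2)) - (2 * l + (h - l))) / (h - l) with he
  refine ⟨⟨e, _root_.abs_le.1 (abs_div_sub_le_one hpos hl.le (by linarith))⟩, fun δ => ?_⟩
  have he1 : |e| ≤ 1 := abs_div_sub_le_one hpos hl.le (by linarith)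
  have hk : k * unit = ((((l + h - 1600) * unit : ℕ) : ℝ) / (800 : ℕ))
      + (((h - l) * unit : ℕ) : ℝ) / (800 : ℕ) * e := by
    have h1 : e * (h - l) = 2 * (400 * (k + 2)) - (2 * l + (h - l)) := div_mul_cancel₀ _ hpos.ne'
    push_cast [Nat.cast_sub hlh, Nat.cast_sub hle]
    linear_combination -(unit : ℝ) / 800 * h1
  have h1 := cast_div_le ((l + h - 1600) * unit) 800
  have h2 := lt_cast_div ((l + h - 1600) * unit) (d := 800) (by norm_num)
  have h3 := cast_div_le ((h - l) * unit) 800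
  have h4 := lt_cast_div ((h - l) * unit) (d := 800) (by norm_num)
  rw [Mem]
  simp only [lin, kBox, Nat.add_eq, Nat.sub_eq, Nat.mul_eq] at *
  rw [hk]
  generalize ((((l + h - 1600) * unit : ℕ) : ℝ) / (800 : ℕ)) = A at *
  generalize ((((h - l) * unit : ℕ) : ℝ) / (800 : ℕ)) = B at *
  generalize ((Nat.div ((l + h - 1600) * unit) 800 : ℕ) : ℝ) = A' at *
  generalize ((Nat.div ((h - l) * unit) 800 : ℕ) : ℝ) = B' at *
  have h5 : |(B - B') * e| ≤ 1 := by
    rw [abs_mul]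
    exact mul_le_one₀ (_root_.abs_le.2 ⟨by linarith, by linarith⟩) (abs_nonneg _) he1
  rw [_root_.abs_le] at h5 ⊢
  push_cast
  constructor <;> linarith

theorem exists_mem_rBox {x : ℝ} {l h : ℕ} (hl : (l : ℝ) < 256 * x) (hh : 256 * x ≤ h) :
    ∃ δ : Noise, ∀ ε : Noise, Mem ε δ (rBox l h) x := by
  have hlt : (l : ℝ) < h := hl.trans_le hh
  have hle : l ≤ h := by exact_mod_cast hlt.le
  have hpos : (0 : ℝ) < h - l := sub_pos.2 hlt
  refine ⟨⟨_, _root_.abs_le.1 (abs_div_sub_le_one hpos hl.le (by linarith))⟩, fun ε => ?_⟩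
  have h1 := div_mul_cancel₀ (2 * (256 * x) - (2 * l + ((h : ℝ) - l))) hpos.ne'
  rw [Mem]
  simp only [lin, rBox, Nat.add_eq, Nat.sub_eq, Nat.mul_eq]
  rw [show (unit : ℝ) = 1073741824 by norm_num [AForm.unit]]
  push_cast [Nat.cast_sub hle]
  refine le_of_eq (abs_eq_zero.2 ?_)
  linear_combination (-2097152) * h1

variable {ε δ : Noise} {x : AForm} {v : ℝ}

theorem nonneg_of_nonneg (hx : Mem ε δ x v) (h : nonneg x = true) : 0 ≤ v := by
  have h1 := (_root_.abs_le.1 hx.abs_sub_le).1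
  have h2 : x.c' + x.rad ≤ x.c := Nat.le_of_ble_eq_true h
  have h3 : (x.c' : ℝ) + x.rad ≤ x.c := by exact_mod_cast h2
  exact nonneg_of_mul_nonneg_left (by linarith) unit_pos

theorem pos_of_pos (hx : Mem ε δ x v) (h : pos x = true) : 0 < v := by
  have h1 := (_root_.abs_le.1 hx.abs_sub_le).1
  have h2 : x.c' + x.rad + 1 ≤ x.c := Nat.le_of_ble_eq_true h
  have h3 : (x.c' : ℝ) + x.rad + 1 ≤ x.c := by exact_mod_cast h2
  exact pos_of_mul_pos_left (by linarith) unit_pos.le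

theorem ne_zero_of_definite (hx : Mem ε δ x v) (h : definite x = true) : v ≠ 0 := by
  rw [definite, Bool.or_eq_true] at h
  rcases h with h | h
  · exact (pos_of_pos hx h).ne'
  · exact (neg_pos.1 (pos_of_pos hx.neg h)).ne

/-- A property that holds on every cell of a partition holds on the whole interval. -/
theorem of_cells {f : List ℕ → Bool} {q : ℕ → ℕ → Bool} {y : ℝ} {P : Prop}
    (hf : ∀ l h c, f (l :: h :: c) = (q l h && f (h :: c)))
    (hq : ∀ l h : ℕ, (l : ℝ) < y → y ≤ h → q l h = true → P) (c : List ℕ) {l : ℕ}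
    (H : f (l :: c) = true) (hl : (l : ℝ) < y) (hy : y ≤ ((l :: c).getLastD 0 : ℕ)) : P := by
  induction c generalizing l with
  | nil => exact absurd hl (not_lt.2 (by simpa using hy))
  | cons h c ih =>
    rw [hf, Bool.and_eq_true] at H
    rcases le_or_gt y h with hle | hlt
    · exact hq l h hl hle H.1
    · exact ih H.2 hlt (by simpa using hy)

variable {k : ℝ} {l h I J n i j : ℕ} {c : List ℕ}

theorem S_pos_of_posCells (hk : 0 < k) (hk1 : k ≤ 1) (hI : 1 ≤ I) (hIJ : I < J)
    (hlh : 1600 ≤ l + h) (hl : (l : ℝ) < 400 * (k + 2)) (hh : 400 * (k + 2) ≤ h)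
    (hc : (0 :: c).getLastD 0 = 256)
    (H : posCells (ExpForms.ofBox (kBox l h) I J) I J n (0 :: c) = true) (M : SlopeSystem k) :
    0 < M.S := by
  have hr0 := M.r_pos
  have hr1 := M.r_lt_one
  obtain ⟨ε, hε⟩ := exists_mem_kBox hlh hl hh
  refine of_cells (y := 256 * M.r) (f := posCells (ExpForms.ofBox (kBox l h) I J) I J n)
    (fun _ _ _ => rfl) (fun l' h' hl' hh' H' => ?_) c H (by push_cast; linarith)
    (by rw [hc]; push_cast; linarith)
  obtain ⟨δ, hδ⟩ := exists_mem_rBox hl' hh'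
  have hK := ExpForms.encloses_ofBox (hε δ) hk.le I J
  obtain ⟨h1, h2⟩ := mem_slopeForms_none hk hk1 hK hI hIJ (hδ ε)
    (mem_mForm hk (by linarith) hK hI (hδ ε) n)
  rw [Bool.and_eq_true] at H'
  obtain ⟨v, hv, hm⟩ := h2 (nonneg_of_nonneg h1 H'.1)
  exact (pos_of_pos hm H'.2).trans_le hv

theorem S_neg_of_negCells (hk : 0 < k) (hk2 : k ≤ 2) (hI : 1 ≤ I) (hIJ : I < J) (hi : 0 < i)
    (hij : (i : ℝ) ≤ k * j) (hlh : 1600 ≤ l + h) (hl : (l : ℝ) < 400 * (k + 2))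
    (hh : 400 * (k + 2) ≤ h) (hc : (0 :: c).getLastD 0 = 256)
    (H : negCells (ExpForms.ofBox (kBox l h) I J) I J n i j (0 :: c) = true) (M : SlopeSystem k) :
    M.S < 0 := by
  have hr0 := M.r_pos
  have hr1 := M.r_lt_one
  obtain ⟨ε, hε⟩ := exists_mem_kBox hlh hl hh
  refine of_cells (y := 256 * M.r) (f := negCells (ExpForms.ofBox (kBox l h) I J) I J n i j)
    (fun _ _ _ => rfl) (fun l' h' hl' hh' H' => ?_) c H (by push_cast; linarith)
    (by rw [hc]; push_cast; linarith)
  obtain ⟨δ, hδ⟩ := exists_mem_rBox hl' hh'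
  have hK := ExpForms.encloses_ofBox (hε δ) hk.le I J
  obtain ⟨h1, -⟩ := mem_slopeForms_some hk hk2 hK hI hIJ (hδ ε)
    (mem_mForm hk hk2 hK hI (hδ ε) n) hi hij
  exact neg_pos.1 (pos_of_pos h1.neg H')

namespace Comparison

variable {C : Comparison}

/-- The comparison function, as a function of `T ^ 2`. -/
noncomputable def deriv (C : Comparison) (u : ℝ) : ℝ :=
  C.g / 10000 * ((1 - C.lam / 1000 * u) * (1 - C.mu / 1000 * u))

/-- The primitive of the comparison function. -/
noncomputable def prim (C : Comparison) (u : ℝ) : ℝ :=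
  C.g / 10000 * (u - (C.lam / 1000 + C.mu / 1000) / 2 * u ^ 2
    + C.lam / 1000 * (C.mu / 1000) / 3 * u ^ 3)

theorem hasStrictDerivAt_prim (C : Comparison) (u : ℝ) :
    HasStrictDerivAt C.prim (C.deriv u) u := by
  have h1 := hasStrictDerivAt_id u
  have h2 := (hasStrictDerivAt_pow 2 u).const_mul ((C.lam / 1000 + C.mu / 1000 : ℝ) / 2)
  have h3 := (hasStrictDerivAt_pow 3 u).const_mul ((C.lam / 1000 : ℝ) * (C.mu / 1000) / 3)
  refine (((h1.sub h2).add h3).const_mul ((C.g : ℝ) / 10000)).congr_deriv ?_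
  rw [deriv]
  push_cast
  ring

theorem mem_U (hl : (C.v : ℝ) / 1000 ≤ v) (hh : v ≤ C.v' / 1000) :
    Mem ε δ C.U ((1 - v) * (1 - v)) := by
  have hV : Mem ε δ (AForm.range (Nat.div (Nat.mul C.v unit) 1000)
      (Nat.add (Nat.div (Nat.mul C.v' unit) 1000) 1)) v := by
    have h1 := cast_div_le (C.v * unit) 1000
    have h2 := lt_cast_div (C.v' * unit) (d := 1000) (by norm_num)
    have hU := unit_pos
    have h3 := mul_le_mul_of_nonneg_right hl hU.le
    have h4 := mul_le_mul_of_nonneg_right hh hU.le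
    apply AForm.mem_range
    · refine h1.trans (le_trans (le_of_eq ?_) h3)
      push_cast
      ring
    · refine (h4.trans (le_of_eq ?_)).trans (h2.le.trans (le_of_eq ?_))
      · push_cast
        ring
      · rw [Nat.add_eq, Nat.cast_add, Nat.cast_one]
        rfl
  exact (mem_one.sub hV).mul (mem_one.sub hV)

theorem mem_ratio (m : ℕ) {d : ℕ} (hd : 0 < d) : Mem ε δ (ratio m d) (m / d) :=
  (mem_ofNat m).divNat hd

theorem check_sound {fk fr fU : AForm} {F : SlopeForms} {r U S t Y u : ℝ}
    (H : C.check fk fr fU F = true) (hk : Mem ε δ fk k) (hr : Mem ε δ fr r) (hU : Mem ε δ fU U)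
    (hS : Mem ε δ F.S S) (ht : Mem ε δ F.t t) (hY : Mem ε δ F.Y Y) (hu : u = t * t * (1 - r)) :
    r * k * S + 2 * (t * (1 - u) * Y) * C.deriv u ≠ 0 ∧ (S = 0 →
      0 < 1 - (C.lam / 1000 + C.mu / 1000) / 2 * u + C.lam / 1000 * (C.mu / 1000) / 3 * (u * u) ∧
      0 < (C.lam / 1000 + C.mu / 1000) / 2 * (u + U)
        - (1 + C.lam / 1000 * (C.mu / 1000) / 3 * (u * u + U * (u + U)))) := by
  have hu' := ((ht.mul ht).mul (mem_one.sub hr)).of_eq hu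
  have ha := (mem_ratio (ε := ε) (δ := δ) C.lam (d := 1000) (by norm_num)).of_eq
    (show (C.lam / 1000 : ℝ) = _ by push_cast; rfl)
  have hb := (mem_ratio (ε := ε) (δ := δ) C.mu (d := 1000) (by norm_num)).of_eq
    (show (C.mu / 1000 : ℝ) = _ by push_cast; rfl)
  have hg := ((mem_one.sub (ha.mul hu')).mul (mem_one.sub (hb.mul hu'))).mul
    (mem_ratio C.g (d := 5000) (by norm_num))
  have hs := ((ha.add hb).divNat (d := 2) two_pos).of_eq
    (show ((C.lam / 1000 + C.mu / 1000) / 2 : ℝ) = _ by push_cast; rfl)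
  have hp := ((ha.mul hb).divNat (d := 3) three_pos).of_eq
    (show (C.lam / 1000 * (C.mu / 1000) / 3 : ℝ) = _ by push_cast; rfl)
  rw [check, Bool.and_eq_true, Bool.or_eq_true, Bool.and_eq_true] at H
  obtain ⟨h1, h2⟩ := H
  refine ⟨?_, fun h0 => ?_⟩
  · have h3 := ne_zero_of_definite
      (((hr.mul hk).mul hS).add (((ht.mul (mem_one.sub hu')).mul hY).mul hg)) h1
    convert h3 using 2
    rw [deriv]
    push_cast
    ring
  · rcases h2 with h2 | h2
    · exact absurd h0 (ne_zero_of_definite hS h2)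
    · exact ⟨pos_of_pos ((mem_one.sub (hs.mul hu')).add (hp.mul (hu'.mul hu'))) h2.1,
        pos_of_pos ((hs.mul (hu'.add hU)).sub
          (mem_one.add (hp.mul ((hu'.mul hu').add (hU.mul (hu'.add hU)))))) h2.2⟩

theorem cells_sound (hk : 0 < k) (hk2 : k ≤ 2) (hI : 1 ≤ I) (hIJ : I < J) (hi : 0 < i)
    (hij : (i : ℝ) ≤ k * j) (hlh : 1600 ≤ l + h) (hl : (l : ℝ) < 400 * (k + 2))
    (hh : 400 * (k + 2) ≤ h) (hc : (0 :: c).getLastD 0 = 256)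
    (hv : (C.v : ℝ) / 1000 ≤ v) (hv' : v ≤ C.v' / 1000)
    (H : C.cells (ExpForms.ofBox (kBox l h) I J) C.U I J n i j (0 :: c) = true) (M : SlopeSystem k)
    {u U : ℝ} (hu : u = M.t * M.t * (1 - M.r)) (hU : U = (1 - v) * (1 - v)) :
    M.r * k * M.S + 2 * (M.t * (1 - u) * M.Y) * C.deriv u ≠ 0 ∧ (M.S = 0 →
      0 < 1 - (C.lam / 1000 + C.mu / 1000) / 2 * u + C.lam / 1000 * (C.mu / 1000) / 3 * (u * u) ∧
      0 < (C.lam / 1000 + C.mu / 1000) / 2 * (u + U)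
        - (1 + C.lam / 1000 * (C.mu / 1000) / 3 * (u * u + U * (u + U)))) := by
  have hr0 := M.r_pos
  have hr1 := M.r_lt_one
  obtain ⟨ε, hε⟩ := exists_mem_kBox hlh hl hh
  refine of_cells (y := 256 * M.r)
    (f := C.cells (ExpForms.ofBox (kBox l h) I J) C.U I J n i j)
    (fun _ _ _ => rfl) (fun l' h' hl' hh' H' => ?_) c H (by push_cast; linarith)
    (by rw [hc]; push_cast; linarith)
  obtain ⟨δ, hδ⟩ := exists_mem_rBox hl' hh'
  have hK := ExpForms.encloses_ofBox (hε δ) hk.le I J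
  obtain ⟨h1, h2, h3⟩ := mem_slopeForms_some hk hk2 hK hI hIJ (hδ ε)
    (mem_mForm hk hk2 hK hI (hδ ε) n) hi hij
  exact check_sound H' hK.mem_k (hδ ε) ((mem_U hv hv').of_eq hU) h1 h2 h3 hu

end Comparison

/-- The claim that the energy on the interior of the curve exceeds its minimum at the ends. -/
def EnergyBound (p : ℝ) : Prop :=
  ∀ a₀ a b T, IsAdmissible p a₀ a₀ 0 → IsInterior p a b T →
    min (energy p a₀ a₀ 0) (energy p 1 0 (1 - 2 ^ (1 - p))) < energy p a b T

theorem energyBound_of_S_ne_zero (hk : 0 < k) (hk2 : k ≤ 2) (hS : ∀ M : SlopeSystem k, M.S ≠ 0) :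
    EnergyBound (k + 2) := by
  refine fun a₀ a b T h₀ h => min_lt_energy_of_slopeNum_ne_zero (by linarith) ?_ h₀ h
  intro a b T h
  obtain ⟨M, c, d, hc, hd, -, -, hs, -⟩ := h.exists_slopeSystem hk hk2
  rw [hs, neg_ne_zero]
  exact mul_ne_zero (mul_pos (by positivity) M.r_pos).ne' (hS M)

variable {p : ℝ}

theorem energyBound_of_posCells (hl : (l : ℝ) < 400 * p) (hh : 400 * p ≤ h)
    (H : posCells (ExpForms.ofBox (kBox l h) I J) I J n (0 :: c) = true) (hl800 : 800 ≤ l)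
    (hh1200 : h ≤ 1200) (hI : 1 ≤ I) (hIJ : I < J) (hc : (0 :: c).getLastD 0 = 256) :
    EnergyBound p := by
  have h1 : (800 : ℝ) ≤ l := by exact_mod_cast hl800
  have h2 : (h : ℝ) ≤ 1200 := by exact_mod_cast hh1200
  have h3 : l < h := by exact_mod_cast hl.trans_le hh
  obtain ⟨k, rfl⟩ : ∃ k, p = k + 2 := ⟨p - 2, by ring⟩
  exact energyBound_of_S_ne_zero (by linarith) (by linarith) fun M =>
    (S_pos_of_posCells (by linarith) (by linarith) hI hIJ (by omega) hl hh hc H M).ne'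

theorem energyBound_of_negCells (hl : (l : ℝ) < 400 * p) (hh : 400 * p ≤ h)
    (H : negCells (ExpForms.ofBox (kBox l h) I J) I J n i 400 (0 :: c) = true) (hl800 : 800 < l)
    (hil : i + 800 = l) (hh1600 : h ≤ 1600) (hI : 1 ≤ I) (hIJ : I < J)
    (hc : (0 :: c).getLastD 0 = 256) : EnergyBound p := by
  have h1 : (i : ℝ) + 800 = l := by exact_mod_cast hil
  have h2 : (h : ℝ) ≤ 1600 := by exact_mod_cast hh1600
  have h3 : l < h := by exact_mod_cast hl.trans_le hh
  have h4 : (0 : ℝ) ≤ i := i.cast_nonneg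
  obtain ⟨k, rfl⟩ : ∃ k, p = k + 2 := ⟨p - 2, by ring⟩
  exact energyBound_of_S_ne_zero (by linarith) (by linarith) fun M =>
    (S_neg_of_negCells (by linarith) (by linarith) hI hIJ (by omega) (by push_cast; linarith)
      (by omega) hl hh hc H M).ne

theorem div_le_two_rpow {m : ℕ} (hh : 400 * p ≤ h) (h400 : 400 ≤ h)
    (hm : m ^ 400 * 2 ^ (h - 400) ≤ 1000 ^ 400) : (m : ℝ) / 1000 ≤ 2 ^ (1 - p) := by
  refine le_of_pow_le_pow_left₀ (n := 400) (by norm_num) (by positivity) ?_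
  have h1 : (2 : ℝ) ^ (-((h - 400 : ℕ) : ℝ)) ≤ (2 ^ (1 - p)) ^ 400 := by
    rw [← Real.rpow_mul_natCast two_pos.le]
    refine Real.rpow_le_rpow_of_exponent_le one_le_two ?_
    push_cast [Nat.cast_sub h400]
    linarith
  refine le_trans ?_ h1
  rw [Real.rpow_neg two_pos.le, Real.rpow_natCast, div_pow, div_le_iff₀ (pow_pos (by norm_num) 400),
    inv_mul_eq_div, le_div_iff₀ (by positivity)]
  exact_mod_cast hm

theorem two_rpow_le_div {m : ℕ} (hl : (l : ℝ) ≤ 400 * p) (h400 : 400 ≤ l)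
    (hm : 1000 ^ 400 ≤ m ^ 400 * 2 ^ (l - 400)) : (2 : ℝ) ^ (1 - p) ≤ m / 1000 := by
  refine le_of_pow_le_pow_left₀ (n := 400) (by norm_num)
    (div_nonneg m.cast_nonneg (by norm_num)) ?_
  have h1 : ((2 : ℝ) ^ (1 - p)) ^ 400 ≤ (2 : ℝ) ^ (-((l - 400 : ℕ) : ℝ)) := by
    rw [← Real.rpow_mul_natCast two_pos.le]
    refine Real.rpow_le_rpow_of_exponent_le one_le_two ?_
    push_cast [Nat.cast_sub h400]
    linarith
  refine h1.trans ?_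
  rw [Real.rpow_neg two_pos.le, Real.rpow_natCast, div_pow, le_div_iff₀ (pow_pos (by norm_num) 400),
    inv_mul_eq_div, div_le_iff₀ (by positivity)]
  exact_mod_cast hm

theorem energyBound_of_cells {C : Comparison} (hl : (l : ℝ) < 400 * p) (hh : 400 * p ≤ h)
    (H : C.cells (ExpForms.ofBox (kBox l h) I J) C.U I J n i 400 (0 :: c) = true) (hl800 : 800 < l)
    (hil : i + 800 = l) (hh1600 : h ≤ 1600) (hI : 1 ≤ I) (hIJ : I < J)
    (hc : (0 :: c).getLastD 0 = 256) (hg : 0 < C.g)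
    (hv : C.v ^ 400 * 2 ^ (h - 400) ≤ 1000 ^ 400)
    (hv' : 1000 ^ 400 ≤ C.v' ^ 400 * 2 ^ (l - 400)) : EnergyBound p := by
  have h1 : (i : ℝ) + 800 = l := by exact_mod_cast hil
  have h2 : (h : ℝ) ≤ 1600 := by exact_mod_cast hh1600
  have h3 : l < h := by exact_mod_cast hl.trans_le hh
  have h4 : (0 : ℝ) ≤ i := i.cast_nonneg
  have hg' : (0 : ℝ) < C.g / 10000 := by positivity
  have hlow := div_le_two_rpow hh (by omega) hv
  have hupp := two_rpow_le_div hl.le (by omega) hv'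
  obtain ⟨k, rfl⟩ : ∃ k, p = k + 2 := ⟨p - 2, by ring⟩
  have hk : 0 < k := by linarith
  have hk2 : k ≤ 2 := by linarith
  refine fun a₀ a b T h₀ H₀ => min_lt_energy (by linarith) C.hasStrictDerivAt_prim ?_ ?_ h₀ H₀
  · intro a b T h
    obtain ⟨M, e, d, he, hd, hd2, hT, hs, hD⟩ := h.exists_slopeSystem hk hk2
    have hu : T ^ 2 = M.t * M.t * (1 - M.r) := by rw [hT, ← hd2]; ring
    obtain ⟨hne, -⟩ := Comparison.cells_sound hk hk2 hI hIJ (by omega) (by push_cast; linarith)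
      (by omega) hl hh hc hlow hupp H M hu rfl
    intro heq
    refine hne ((mul_eq_zero.1 (?_ : e * d * _ = 0)).resolve_left (mul_pos he hd).ne')
    rw [hs, hD] at heq
    generalize C.deriv (T ^ 2) = γ at *
    rw [hT] at heq ⊢
    linear_combination -heq
  · intro a b T h hs0
    obtain ⟨M, e, d, he, hd, hd2, hT, hs, hD⟩ := h.exists_slopeSystem hk hk2
    have hu : T ^ 2 = M.t * M.t * (1 - M.r) := by rw [hT, ← hd2]; ring
    have hS : M.S = 0 := by
      rw [hs, neg_eq_zero] at hs0
      exact (mul_eq_zero.1 hs0).resolve_left (mul_pos (by positivity) M.r_pos).ne'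
    obtain ⟨hp1, hp2⟩ := (Comparison.cells_sound hk hk2 hI hIJ (by omega)
      (by push_cast; linarith) (by omega) hl hh hc hlow hupp H M hu rfl).2 hS
    have hT0 := h.T_pos
    have hTU : T ^ 2 < (1 - 2 ^ (1 - (k + 2))) ^ 2 := by
      have := h.T_lt
      gcongr
    rw [← sq (1 - (2 : ℝ) ^ (1 - (k + 2)))] at hp2
    simp only [Comparison.prim]
    constructor
    · have := mul_pos (mul_pos hg' (pow_pos hT0 2)) hp1
      linear_combination this
    · have := mul_pos (mul_pos hg' (sub_pos.2 hTU)) hp2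
      linear_combination this

end MinkowskiCohn

namespace MinkowskiCohn

set_option maxRecDepth 100000

theorem cells_800 :
    posCells (ExpForms.ofBox (kBox 800 880) 3 5) 3 5 1 [0, 117, 245, 256] = true := by
  decide +kernel

theorem cells_880 :
    posCells (ExpForms.ofBox (kBox 880 920) 3 5) 3 5 1 [0, 128, 256] = true := by
  decide +kernel

theorem cells_920 :
    posCells (ExpForms.ofBox (kBox 920 960) 3 5) 3 5 1 [0, 128, 245, 256] = true := by
  decide +kernel

theorem cells_960 :
    posCells (ExpForms.ofBox (kBox 960 980) 3 5) 3 5 1 [0, 128, 245, 256] = true := by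
  decide +kernel

theorem cells_980 :
    posCells (ExpForms.ofBox (kBox 980 1000) 3 8) 3 8 1 [0, 117, 198, 241, 256] = true := by
  decide +kernel

theorem cells_1000 :
    posCells (ExpForms.ofBox (kBox 1000 1004) 3 12) 3 12 2 [0, 128, 226, 256] = true := by
  decide +kernel

theorem cells_1004 :
    posCells (ExpForms.ofBox (kBox 1004 1008) 3 12) 3 12 2 [0, 128, 217, 256] = true := by
  decide +kernel

theorem cells_1008 :
    Comparison.cells ⟨8500, 2500, 20, 346, 349⟩ (ExpForms.ofBox (kBox 1008 1012) 4 12)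
      (Comparison.U ⟨8500, 2500, 20, 346, 349⟩) 4 12 2 208 400 [0, 13, 42, 91, 151, 205, 256] =
      true := by
  decide +kernel

theorem cells_1012 :
    Comparison.cells ⟨8500, 2500, 20, 343, 347⟩ (ExpForms.ofBox (kBox 1012 1016) 4 12)
      (Comparison.U ⟨8500, 2500, 20, 343, 347⟩) 4 12 2 212 400 [0, 17, 49, 98, 147, 196, 236, 256]
      = true := by
  decide +kernel

theorem cells_1016 :
    Comparison.cells ⟨7241, 2403, 27, 341, 344⟩ (ExpForms.ofBox (kBox 1016 1020) 4 12)
      (Comparison.U ⟨7241, 2403, 27, 341, 344⟩) 4 12 2 216 400 [0, 10, 31, 67, 111, 151, 187, 219,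
      249, 256] = true := by
  decide +kernel

theorem cells_1020 :
    Comparison.cells ⟨5534, 2395, 38, 339, 342⟩ (ExpForms.ofBox (kBox 1020 1024) 4 12)
      (Comparison.U ⟨5534, 2395, 38, 339, 342⟩) 4 12 2 220 400 [0, 11, 32, 64, 104, 140, 176, 208,
      217, 227, 256] = true := by
  decide +kernel

theorem cells_1024 :
    Comparison.cells ⟨4909, 2360, 49, 336, 340⟩ (ExpForms.ofBox (kBox 1024 1028) 4 12)
      (Comparison.U ⟨4909, 2360, 49, 336, 340⟩) 4 12 2 224 400 [0, 9, 26, 52, 84, 113, 139, 165,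
      191, 198, 215, 252, 256] = true := by
  decide +kernel

theorem cells_1028 :
    Comparison.cells ⟨7530, 667, 24, 332, 337⟩ (ExpForms.ofBox (kBox 1028 1036) 4 12) (Comparison.U
      ⟨7530, 667, 24, 332, 337⟩) 4 12 2 228 400 [0, 54, 86, 109, 120, 143, 164, 185, 204, 221,
      234, 244, 250, 253, 255, 256] = true := by
  decide +kernel

theorem cells_1036 :
    Comparison.cells ⟨5848, 667, 33, 327, 333⟩ (ExpForms.ofBox (kBox 1036 1044) 4 12) (Comparison.U
      ⟨5848, 667, 33, 327, 333⟩) 4 12 2 236 400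
      [0, 40, 66, 106, 142, 174, 206, 236, 256] = true := by
  decide +kernel

theorem cells_1044 :
    Comparison.cells ⟨5118, 667, 40, 323, 328⟩ (ExpForms.ofBox (kBox 1044 1052) 4 12) (Comparison.U
      ⟨5118, 667, 40, 323, 328⟩) 4 12 2 244 400 [0, 26, 41, 95, 139, 183, 227, 256] = true := by
  decide +kernel

theorem cells_1052 :
    Comparison.cells ⟨4564, 667, 47, 318, 324⟩ (ExpForms.ofBox (kBox 1052 1060) 4 12) (Comparison.U
      ⟨4564, 667, 47, 318, 324⟩) 4 12 2 252 400 [0, 23, 83, 137, 191, 245, 256] = true := by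
  decide +kernel

theorem cells_1060 :
    Comparison.cells ⟨4517, 667, 50, 314, 319⟩ (ExpForms.ofBox (kBox 1060 1068) 4 12) (Comparison.U
      ⟨4517, 667, 50, 314, 319⟩) 4 12 2 260 400 [0, 17, 83, 149, 215, 256] = true := by
  decide +kernel

theorem cells_1068 :
    Comparison.cells ⟨4486, 667, 51, 312, 315⟩ (ExpForms.ofBox (kBox 1068 1072) 4 12) (Comparison.U
      ⟨4486, 667, 51, 312, 315⟩) 4 12 3 268 400 [0, 23, 103, 183, 256] = true := by
  decide +kernel

theorem cells_1072 :
    Comparison.cells ⟨4429, 667, 53, 309, 313⟩ (ExpForms.ofBox (kBox 1072 1076) 4 12) (Comparison.U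
      ⟨4429, 667, 53, 309, 313⟩) 4 12 3 272 400 [0, 29, 109, 189, 256] = true := by
  decide +kernel

theorem cells_1076 :
    Comparison.cells ⟨4429, 667, 55, 307, 310⟩ (ExpForms.ofBox (kBox 1076 1080) 4 12) (Comparison.U
      ⟨4429, 667, 55, 307, 310⟩) 4 12 2 276 400 [0, 29, 109, 189, 256] = true := by
  decide +kernel

theorem cells_1080 :
    negCells (ExpForms.ofBox (kBox 1080 1084) 3 12) 3 12 1 280 400
      [0, 19, 76, 167, 256] = true := by
  decide +kernel

theorem cells_1084 :
    negCells (ExpForms.ofBox (kBox 1084 1089) 3 12) 3 12 1 284 400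
      [0, 47, 130, 230, 256] = true := by
  decide +kernel

theorem cells_1089 :
    negCells (ExpForms.ofBox (kBox 1089 1099) 3 12) 3 12 1 289 400
      [0, 57, 148, 248, 256] = true := by
  decide +kernel

theorem cells_1099 :
    negCells (ExpForms.ofBox (kBox 1099 1119) 3 10) 3 10 1 299 400
      [0, 63, 146, 229, 256] = true := by
  decide +kernel

theorem cells_1119 :
    negCells (ExpForms.ofBox (kBox 1119 1159) 3 8) 3 8 1 319 400 [0, 57, 126, 195, 256] = true := by
  decide +kernel

theorem cells_1159 :
    negCells (ExpForms.ofBox (kBox 1159 1200) 3 6) 3 6 1 359 400 [0, 83, 166, 234, 256] = true := by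
  decide +kernel

theorem cells_1200 :
    negCells (ExpForms.ofBox (kBox 1200 1240) 3 5) 3 5 1 400 400
      [0, 100, 183, 249, 256] = true := by
  decide +kernel

theorem cells_1240 :
    negCells (ExpForms.ofBox (kBox 1240 1280) 3 5) 3 5 1 440 400 [0, 91, 174, 230, 256] = true := by
  decide +kernel

theorem cells_1280 :
    negCells (ExpForms.ofBox (kBox 1280 1320) 3 5) 3 5 1 480 400 [0, 91, 167, 222, 256] = true := by
  decide +kernel

theorem cells_1320 :
    negCells (ExpForms.ofBox (kBox 1320 1360) 3 5) 3 5 1 520 400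
      [0, 83, 152, 209, 248, 256] = true := by
  decide +kernel

theorem cells_1360 :
    negCells (ExpForms.ofBox (kBox 1360 1400) 3 5) 3 5 1 560 400
      [0, 83, 152, 204, 243, 256] = true := by
  decide +kernel

theorem cells_1400 :
    negCells (ExpForms.ofBox (kBox 1400 1440) 3 5) 3 5 1 600 400
      [0, 76, 139, 191, 231, 256] = true := by
  decide +kernel

theorem cells_1440 :
    negCells (ExpForms.ofBox (kBox 1440 1480) 3 5) 3 5 1 640 400 [0, 76, 139, 186, 221, 250, 256] =
      true := by
  decide +kernel

theorem cells_1480 :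
    negCells (ExpForms.ofBox (kBox 1480 1520) 3 5) 3 5 1 680 400 [0, 69, 126, 173, 208, 234, 256] =
      true := by
  decide +kernel

theorem cells_1520 :
    negCells (ExpForms.ofBox (kBox 1520 1560) 3 5) 3 5 1 720 400 [0, 69, 126, 169, 201, 228, 248,
      256] = true := by
  decide +kernel

theorem cells_1560 :
    negCells (ExpForms.ofBox (kBox 1560 1600) 3 5) 3 5 1 760 400 [0, 63, 115, 158, 191, 217, 236,
      252, 256] = true := by
  decide +kernel

end MinkowskiCohn

namespace MinkowskiCohn

open Set Filter Topology

theorem energyBound_of_mem_Ioc {p : ℝ} (hp : p ∈ Ioc 2 4) : EnergyBound p := by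
  have hl : ((800 : ℕ) : ℝ) < 400 * p := by push_cast; linarith [hp.1]
  have h4 : 400 * p ≤ ((1600 : ℕ) : ℝ) := by push_cast; linarith [hp.2]
  rcases le_or_gt (400 * p) ((880 : ℕ) : ℝ) with hh | hl
  · exact energyBound_of_posCells hl hh cells_800 (by simp) (by simp) (by simp) (by simp) rfl
  rcases le_or_gt (400 * p) ((920 : ℕ) : ℝ) with hh | hl
  · exact energyBound_of_posCells hl hh cells_880 (by simp) (by simp) (by simp) (by simp) rfl
  rcases le_or_gt (400 * p) ((960 : ℕ) : ℝ) with hh | hl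
  · exact energyBound_of_posCells hl hh cells_920 (by simp) (by simp) (by simp) (by simp) rfl
  rcases le_or_gt (400 * p) ((980 : ℕ) : ℝ) with hh | hl
  · exact energyBound_of_posCells hl hh cells_960 (by simp) (by simp) (by simp) (by simp) rfl
  rcases le_or_gt (400 * p) ((1000 : ℕ) : ℝ) with hh | hl
  · exact energyBound_of_posCells hl hh cells_980 (by simp) (by simp) (by simp) (by simp) rfl
  rcases le_or_gt (400 * p) ((1004 : ℕ) : ℝ) with hh | hl
  · exact energyBound_of_posCells hl hh cells_1000 (by simp) (by simp) (by simp) (by simp) rfl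
  rcases le_or_gt (400 * p) ((1008 : ℕ) : ℝ) with hh | hl
  · exact energyBound_of_posCells hl hh cells_1004 (by simp) (by simp) (by simp) (by simp) rfl
  rcases le_or_gt (400 * p) ((1012 : ℕ) : ℝ) with hh | hl
  · exact energyBound_of_cells hl hh cells_1008 (by simp) (by simp) (by simp) (by simp) (by simp)
      rfl (by simp) (by decide +kernel) (by decide +kernel)
  rcases le_or_gt (400 * p) ((1016 : ℕ) : ℝ) with hh | hl
  · exact energyBound_of_cells hl hh cells_1012 (by simp) (by simp) (by simp) (by simp) (by simp)
      rfl (by simp) (by decide +kernel) (by decide +kernel)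
  rcases le_or_gt (400 * p) ((1020 : ℕ) : ℝ) with hh | hl
  · exact energyBound_of_cells hl hh cells_1016 (by simp) (by simp) (by simp) (by simp) (by simp)
      rfl (by simp) (by decide +kernel) (by decide +kernel)
  rcases le_or_gt (400 * p) ((1024 : ℕ) : ℝ) with hh | hl
  · exact energyBound_of_cells hl hh cells_1020 (by simp) (by simp) (by simp) (by simp) (by simp)
      rfl (by simp) (by decide +kernel) (by decide +kernel)
  rcases le_or_gt (400 * p) ((1028 : ℕ) : ℝ) with hh | hl
  · exact energyBound_of_cells hl hh cells_1024 (by simp) (by simp) (by simp) (by simp) (by simp)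
      rfl (by simp) (by decide +kernel) (by decide +kernel)
  rcases le_or_gt (400 * p) ((1036 : ℕ) : ℝ) with hh | hl
  · exact energyBound_of_cells hl hh cells_1028 (by simp) (by simp) (by simp) (by simp) (by simp)
      rfl (by simp) (by decide +kernel) (by decide +kernel)
  rcases le_or_gt (400 * p) ((1044 : ℕ) : ℝ) with hh | hl
  · exact energyBound_of_cells hl hh cells_1036 (by simp) (by simp) (by simp) (by simp) (by simp)
      rfl (by simp) (by decide +kernel) (by decide +kernel)
  rcases le_or_gt (400 * p) ((1052 : ℕ) : ℝ) with hh | hl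
  · exact energyBound_of_cells hl hh cells_1044 (by simp) (by simp) (by simp) (by simp) (by simp)
      rfl (by simp) (by decide +kernel) (by decide +kernel)
  rcases le_or_gt (400 * p) ((1060 : ℕ) : ℝ) with hh | hl
  · exact energyBound_of_cells hl hh cells_1052 (by simp) (by simp) (by simp) (by simp) (by simp)
      rfl (by simp) (by decide +kernel) (by decide +kernel)
  rcases le_or_gt (400 * p) ((1068 : ℕ) : ℝ) with hh | hl
  · exact energyBound_of_cells hl hh cells_1060 (by simp) (by simp) (by simp) (by simp) (by simp)
      rfl (by simp) (by decide +kernel) (by decide +kernel)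
  rcases le_or_gt (400 * p) ((1072 : ℕ) : ℝ) with hh | hl
  · exact energyBound_of_cells hl hh cells_1068 (by simp) (by simp) (by simp) (by simp) (by simp)
      rfl (by simp) (by decide +kernel) (by decide +kernel)
  rcases le_or_gt (400 * p) ((1076 : ℕ) : ℝ) with hh | hl
  · exact energyBound_of_cells hl hh cells_1072 (by simp) (by simp) (by simp) (by simp) (by simp)
      rfl (by simp) (by decide +kernel) (by decide +kernel)
  rcases le_or_gt (400 * p) ((1080 : ℕ) : ℝ) with hh | hl
  · exact energyBound_of_cells hl hh cells_1076 (by simp) (by simp) (by simp) (by simp) (by simp)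
      rfl (by simp) (by decide +kernel) (by decide +kernel)
  rcases le_or_gt (400 * p) ((1084 : ℕ) : ℝ) with hh | hl
  · exact energyBound_of_negCells hl hh cells_1080 (by simp) (by simp) (by simp) (by simp) (by simp)
      rfl
  rcases le_or_gt (400 * p) ((1089 : ℕ) : ℝ) with hh | hl
  · exact energyBound_of_negCells hl hh cells_1084 (by simp) (by simp) (by simp) (by simp) (by simp)
      rfl
  rcases le_or_gt (400 * p) ((1099 : ℕ) : ℝ) with hh | hl
  · exact energyBound_of_negCells hl hh cells_1089 (by simp) (by simp) (by simp) (by simp) (by simp)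
      rfl
  rcases le_or_gt (400 * p) ((1119 : ℕ) : ℝ) with hh | hl
  · exact energyBound_of_negCells hl hh cells_1099 (by simp) (by simp) (by simp) (by simp) (by simp)
      rfl
  rcases le_or_gt (400 * p) ((1159 : ℕ) : ℝ) with hh | hl
  · exact energyBound_of_negCells hl hh cells_1119 (by simp) (by simp) (by simp) (by simp) (by simp)
      rfl
  rcases le_or_gt (400 * p) ((1200 : ℕ) : ℝ) with hh | hl
  · exact energyBound_of_negCells hl hh cells_1159 (by simp) (by simp) (by simp) (by simp) (by simp)
      rfl
  rcases le_or_gt (400 * p) ((1240 : ℕ) : ℝ) with hh | hl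
  · exact energyBound_of_negCells hl hh cells_1200 (by simp) (by simp) (by simp) (by simp) (by simp)
      rfl
  rcases le_or_gt (400 * p) ((1280 : ℕ) : ℝ) with hh | hl
  · exact energyBound_of_negCells hl hh cells_1240 (by simp) (by simp) (by simp) (by simp) (by simp)
      rfl
  rcases le_or_gt (400 * p) ((1320 : ℕ) : ℝ) with hh | hl
  · exact energyBound_of_negCells hl hh cells_1280 (by simp) (by simp) (by simp) (by simp) (by simp)
      rfl
  rcases le_or_gt (400 * p) ((1360 : ℕ) : ℝ) with hh | hl
  · exact energyBound_of_negCells hl hh cells_1320 (by simp) (by simp) (by simp) (by simp) (by simp)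
      rfl
  rcases le_or_gt (400 * p) ((1400 : ℕ) : ℝ) with hh | hl
  · exact energyBound_of_negCells hl hh cells_1360 (by simp) (by simp) (by simp) (by simp) (by simp)
      rfl
  rcases le_or_gt (400 * p) ((1440 : ℕ) : ℝ) with hh | hl
  · exact energyBound_of_negCells hl hh cells_1400 (by simp) (by simp) (by simp) (by simp) (by simp)
      rfl
  rcases le_or_gt (400 * p) ((1480 : ℕ) : ℝ) with hh | hl
  · exact energyBound_of_negCells hl hh cells_1440 (by simp) (by simp) (by simp) (by simp) (by simp)
      rfl
  rcases le_or_gt (400 * p) ((1520 : ℕ) : ℝ) with hh | hl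
  · exact energyBound_of_negCells hl hh cells_1480 (by simp) (by simp) (by simp) (by simp) (by simp)
      rfl
  rcases le_or_gt (400 * p) ((1560 : ℕ) : ℝ) with hh | hl
  · exact energyBound_of_negCells hl hh cells_1520 (by simp) (by simp) (by simp) (by simp) (by simp)
      rfl
  exact energyBound_of_negCells hl h4 cells_1560 (by simp) (by simp) (by simp) (by simp) (by simp)
      rfl

theorem energyBound {p : ℝ} (hp : 1 < p) (hp2 : p ≠ 2) : EnergyBound p := by
  rcases hp2.lt_or_gt with h | h
  · exact fun a₀ a b T h₀ h₁ => min_lt_energy_of_slopeNum_ne_zero hp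
      (fun a b T h' => (slopeNum_pos_of_lt_two hp h h').ne') h₀ h₁
  rcases le_or_gt p 4 with h4 | h4
  · exact energyBound_of_mem_Ioc ⟨h, h4⟩
  · exact fun a₀ a b T h₀ h₁ => min_lt_energy_of_slopeNum_ne_zero hp
      (fun a b T h' => (slopeNum_pos_of_four_le h4.le h').ne') h₀ h₁

end MinkowskiCohn

/-- **Minkowski's analytic conjecture.** For every real `p > 1` with
`p ≠ 2` and every `σ` with `1 < σ < σ_p`,
`Δ(p,σ) > min (Δ(p,1), Δ(p,σ_p))`. -/
theorem stmt_13 (p : ℝ) (hp : 1 < p) (hp2 : p ≠ 2) (τp : ℝ)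
    (hτp : 0 ≤ τp ∧ τp < 1 ∧ 2 * (1 - τp) ^ p = 1 + τp ^ p)
    (T : ℝ → ℝ)
    (hT : ∀ σ ∈ Set.Icc 1 (sigmaP p),
      0 ≤ T σ ∧ T σ ≤ τp ∧ Acoef p σ (T σ) ^ p + Bcoef p σ (T σ) ^ p = 1)
    (σ : ℝ) (hσ : 1 < σ ∧ σ < sigmaP p) :
    DeltaFun p T σ > min (DeltaFun p T 1) (DeltaFun p T (sigmaP p)) := by
  exact MinkowskiCohn.min_lt_deltaFun hp (MinkowskiCohn.energyBound hp hp2) hτp hT hσ
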